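/- Let n ≥ 3, p ≥ 2 real, q = p/(p−1), and let f be a C^d function in some neighbourhood of S_p^{n−1} in ℝⁿ with μ_{p,n}-mean zero. Then for every t ≥ 0, ν_{p,n}(|f| ≥ t) ≤ √2 (p+1)^{1/2 − 1/p} exp( −(C_{p,d}/2) n · min( min_{k=1,…,d−1} (t/‖f^{(k)}‖_{op(q),q})^{p/k}, (t/‖f^{(d)}‖_{op(q),∞})^{p/d} ) ), where C_{p,d} = log(2)^p / (3^{p−1} 4^{2p−1} p² (p−1)^{p−1} d^p e^p) and the norms ‖·‖_{op(q),r} are taken with respect to μ_{p,n}. -/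

import Mathlib

open MeasureTheory Real

/-- The `ℓ_p`-norm on `ℝⁿ` (realized as Euclidean space, so that Hausdorff measure is the
one associated with the Euclidean metric). -/
noncomputable def lpNormE (p : ℝ) {n : ℕ} (x : EuclideanSpace ℝ (Fin n)) : ℝ :=
  (∑ i, |x i| ^ p) ^ (1 / p)

/-- The cone probability measure `μ_{p,n}` on the `ℓ_p`-sphere: the pushforward of the
normalized Lebesgue measure on the `ℓ_p`-unit ball under radial projection `x ↦ x/|x|_p`. -/
noncomputable def coneMeasureE (p : ℝ) (n : ℕ) : Measure (EuclideanSpace ℝ (Fin n)) :=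
  Measure.map (fun x => (lpNormE p x)⁻¹ • x)
    ((volume {x : EuclideanSpace ℝ (Fin n) | lpNormE p x ≤ 1})⁻¹ •
      volume.restrict {x : EuclideanSpace ℝ (Fin n) | lpNormE p x ≤ 1})

/-- The surface measure `ν_{p,n}`: the normalized `(n-1)`-dimensional Hausdorff measure on
the `ℓ_p`-unit sphere. -/
noncomputable def surfaceMeasure (p : ℝ) (n : ℕ) : Measure (EuclideanSpace ℝ (Fin n)) :=
  (μH[(n : ℝ) - 1] {x : EuclideanSpace ℝ (Fin n) | lpNormE p x = 1})⁻¹ •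
    (μH[(n : ℝ) - 1]).restrict {x : EuclideanSpace ℝ (Fin n) | lpNormE p x = 1}

/-- The operator-type norm `|T|_{op(q)}` of a `k`-linear form on `ℝⁿ`: the supremum of
`T[v₁,…,v_k]` over vectors of `ℓ_p`-norm one (`q = p/(p-1)`). -/
noncomputable def opNormQE (p : ℝ) {n k : ℕ}
    (T : ContinuousMultilinearMap ℝ (fun _ : Fin k => EuclideanSpace ℝ (Fin n)) ℝ) : ℝ :=
  sSup {y | ∃ v : Fin k → EuclideanSpace ℝ (Fin n), (∀ i, lpNormE p (v i) = 1) ∧ y = T v}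

/-- The norm `‖f^{(k)}‖_{op(q),q} = (∫ |f^{(k)}|_{op(q)}^q dμ)^{1/q}`. -/
noncomputable def opNormLqE {n : ℕ} (μ : Measure (EuclideanSpace ℝ (Fin n))) (p q : ℝ)
    (k : ℕ) (f : EuclideanSpace ℝ (Fin n) → ℝ) : ℝ :=
  (∫ x, opNormQE p (iteratedFDeriv ℝ k f x) ^ q ∂μ) ^ (1 / q)

/-- The norm `‖f^{(k)}‖_{op(q),∞}`, the essential supremum of `|f^{(k)}|_{op(q)}`. -/
noncomputable def opNormLinftyE {n : ℕ} (μ : Measure (EuclideanSpace ℝ (Fin n))) (p : ℝ)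
    (k : ℕ) (f : EuclideanSpace ℝ (Fin n) → ℝ) : ℝ :=
  essSup (fun x => opNormQE p (iteratedFDeriv ℝ k f x)) μ

set_option linter.unusedVariables false

section basics
variable {p : ℝ} {n : ℕ}

lemma lpN_nonneg (x : EuclideanSpace ℝ (Fin n)) : 0 ≤ lpNormE p x :=
  Real.rpow_nonneg (Finset.sum_nonneg fun i _ => Real.rpow_nonneg (abs_nonneg _) _) _

lemma lpN_rpow (hp : 2 ≤ p) (x : EuclideanSpace ℝ (Fin n)) : lpNormE p x ^ p = ∑ i, |x i| ^ p := by
  unfold lpNormE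
  rw [← Real.rpow_mul (Finset.sum_nonneg fun i _ => Real.rpow_nonneg (abs_nonneg _) _),
    one_div_mul_cancel (by linarith), Real.rpow_one]

lemma lpN_zero (hp : 2 ≤ p) : lpNormE p (0 : EuclideanSpace ℝ (Fin n)) = 0 := by
  have h1 : p ≠ 0 := by linarith
  have h2 : (1 / p) ≠ 0 := by positivity
  simp [lpNormE, Real.zero_rpow h1]
  rw [Real.zero_rpow]; simpa using h1

lemma abs_le_lpN (hp : 2 ≤ p) (x : EuclideanSpace ℝ (Fin n)) (i : Fin n) : |x i| ≤ lpNormE p x := by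
  have h : |x i| ^ p ≤ lpNormE p x ^ p := by
    rw [lpN_rpow hp]
    exact Finset.single_le_sum (f := fun i => |x i| ^ p)
      (fun i _ => Real.rpow_nonneg (abs_nonneg _) _) (Finset.mem_univ i)
  exact (Real.rpow_le_rpow_iff (abs_nonneg _) (lpN_nonneg _) (by linarith)).1 h

lemma lpN_add_le (hp : 2 ≤ p) (x y : EuclideanSpace ℝ (Fin n)) :
    lpNormE p (x + y) ≤ lpNormE p x + lpNormE p y := by
  have := Real.Lp_add_le Finset.univ (fun i => x i) (fun i => y i) (p := p) (by linarith)
  simpa [lpNormE] using this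

lemma lpN_smul (hp : 2 ≤ p) (c : ℝ) (x : EuclideanSpace ℝ (Fin n)) :
    lpNormE p (c • x) = |c| * lpNormE p x := by
  have h1 : p ≠ 0 := by linarith
  unfold lpNormE
  have : ∀ i, |(c • x) i| ^ p = |c| ^ p * |x i| ^ p := fun i => by
    rw [PiLp.smul_apply, smul_eq_mul, abs_mul, Real.mul_rpow (abs_nonneg _) (abs_nonneg _)]
  simp_rw [this]
  rw [← Finset.mul_sum, Real.mul_rpow (Real.rpow_nonneg (abs_nonneg _) _)
    (Finset.sum_nonneg fun i _ => Real.rpow_nonneg (abs_nonneg _) _), ← Real.rpow_mul (abs_nonneg _),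
    mul_one_div_cancel h1, Real.rpow_one]

lemma lpN_neg (x : EuclideanSpace ℝ (Fin n)) : lpNormE p (-x) = lpNormE p x := by
  simp [lpNormE]

lemma lpN_sub_comm (x y : EuclideanSpace ℝ (Fin n)) : lpNormE p (x - y) = lpNormE p (y - x) := by
  rw [← lpN_neg, neg_sub]

lemma lpN_abs_sub (hp : 2 ≤ p) (x y : EuclideanSpace ℝ (Fin n)) :
    |lpNormE p x - lpNormE p y| ≤ lpNormE p (x - y) := by
  have h1 := lpN_add_le hp (x - y) y
  have h2 := lpN_add_le hp (y - x) x
  rw [lpN_sub_comm y x] at h2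
  simp only [sub_add_cancel] at h1 h2
  rw [abs_le]; constructor <;> linarith

lemma lpN_continuous (hp : 2 ≤ p) : Continuous (lpNormE p : EuclideanSpace ℝ (Fin n) → ℝ) := by
  unfold lpNormE
  refine Continuous.rpow_const ?_ (fun x => Or.inr (by positivity))
  refine continuous_finsetSum _ fun i _ => ?_
  exact Continuous.rpow_const (by fun_prop) (fun x => Or.inr (by linarith))

lemma lpN_eq_zero (hp : 2 ≤ p) {x : EuclideanSpace ℝ (Fin n)} : lpNormE p x = 0 ↔ x = 0 := by
  constructor
  · intro h
    ext i
    have := abs_le_lpN hp x i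
    rw [h] at this
    simpa using this
  · rintro rfl; exact lpN_zero hp

lemma lpN_pos (hp : 2 ≤ p) {x : EuclideanSpace ℝ (Fin n)} (hx : x ≠ 0) : 0 < lpNormE p x :=
  lt_of_le_of_ne (lpN_nonneg x) (fun h => hx ((lpN_eq_zero hp).1 h.symm))

lemma norm_le_lpN (hp : 2 ≤ p) (x : EuclideanSpace ℝ (Fin n)) : ‖x‖ ≤ (n : ℝ) * lpNormE p x := by
  have h1 : ‖x‖ ≤ ∑ i, |x i| := by
    rw [EuclideanSpace.norm_eq]
    apply Real.sqrt_le_iff.2 ⟨Finset.sum_nonneg fun i _ => abs_nonneg _, ?_⟩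
    simp only [Real.norm_eq_abs]
    exact Finset.sum_sq_le_sq_sum_of_nonneg (fun i _ => abs_nonneg _)
  refine h1.trans ?_
  calc ∑ i, |x i| ≤ ∑ i : Fin n, lpNormE p x := Finset.sum_le_sum fun i _ => abs_le_lpN hp x i
    _ = _ := by simp

lemma lpN_le_norm (hp : 2 ≤ p) (x : EuclideanSpace ℝ (Fin n)) : lpNormE p x ≤ (n : ℝ) * ‖x‖ := by
  rcases Nat.eq_zero_or_pos n with h0 | h0
  · subst h0
    have : x = 0 := Subsingleton.elim _ _
    rw [this, lpN_zero hp]; simp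
  have hn : (1 : ℝ) ≤ n := by exact_mod_cast h0
  have h1 : ∑ i, |x i| ^ p ≤ ((n : ℝ) * ‖x‖) ^ p := by
    calc ∑ i, |x i| ^ p ≤ ∑ _i : Fin n, ‖x‖ ^ p := Finset.sum_le_sum fun i _ =>
          Real.rpow_le_rpow (abs_nonneg _) (PiLp.norm_apply_le x i) (by linarith)
      _ = (n : ℝ) * ‖x‖ ^ p := by simp
      _ ≤ (n : ℝ) ^ p * ‖x‖ ^ p := by
          gcongr
          conv_lhs => rw [← Real.rpow_one (n : ℝ)]
          exact Real.rpow_le_rpow_of_exponent_le hn (by linarith)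
      _ = _ := by rw [Real.mul_rpow (by positivity) (by positivity)]
  rw [← lpN_rpow hp] at h1
  exact (Real.rpow_le_rpow_iff (lpN_nonneg _) (by positivity) (by linarith)).1 h1

/-- the sphere -/
def Sph (p : ℝ) (n : ℕ) : Set (EuclideanSpace ℝ (Fin n)) := {x | lpNormE p x = 1}

lemma Sph_closed (hp : 2 ≤ p) : IsClosed (Sph p n) :=
  isClosed_eq (lpN_continuous hp) continuous_const

lemma Sph_meas (hp : 2 ≤ p) : MeasurableSet (Sph p n) := (Sph_closed hp).measurableSet

lemma Sph_compact (hp : 2 ≤ p) : IsCompact (Sph p n) := by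
  refine Metric.isCompact_of_isClosed_isBounded (Sph_closed hp) ?_
  refine (Metric.isBounded_closedBall (x := (0 : EuclideanSpace ℝ (Fin n))) (r := (n : ℝ))).subset ?_
  intro x hx
  have := norm_le_lpN hp x
  rw [show lpNormE p x = 1 from hx] at this
  simpa using this

/-- radial projection -/
noncomputable def prj (p : ℝ) {n : ℕ} (x : EuclideanSpace ℝ (Fin n)) : EuclideanSpace ℝ (Fin n) :=
  (lpNormE p x)⁻¹ • x

lemma prj_mem (hp : 2 ≤ p) {x : EuclideanSpace ℝ (Fin n)} (hx : x ≠ 0) : prj p x ∈ Sph p n := by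
  have := lpN_pos hp hx
  show lpNormE p _ = 1
  unfold prj
  rw [lpN_smul hp, abs_of_pos (inv_pos.2 this), inv_mul_cancel₀ this.ne']

lemma prj_meas (hp : 2 ≤ p) : Measurable (prj p : EuclideanSpace ℝ (Fin n) → _) := by
  unfold prj
  exact ((lpN_continuous hp).measurable.inv).smul measurable_id

lemma prj_smul (hp : 2 ≤ p) {c : ℝ} (hc : 0 < c) (x : EuclideanSpace ℝ (Fin n)) :
    prj p (c • x) = prj p x := by
  unfold prj
  rw [lpN_smul hp, abs_of_pos hc, smul_smul]
  congr 1
  field_simp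

lemma prj_of_mem {x : EuclideanSpace ℝ (Fin n)} (hx : x ∈ Sph p n) : prj p x = x := by
  unfold prj
  rw [show lpNormE p x = 1 from hx]; simp

lemma smul_prj (hp : 2 ≤ p) (x : EuclideanSpace ℝ (Fin n)) : lpNormE p x • prj p x = x := by
  by_cases hx : x = 0
  · simp [hx, prj]
  · unfold prj
    rw [smul_smul, mul_inv_cancel₀ (lpN_pos hp hx).ne', one_smul]

lemma Sph_ne_zero (hp : 2 ≤ p) {x : EuclideanSpace ℝ (Fin n)} (hx : x ∈ Sph p n) : x ≠ 0 := by
  rintro rfl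
  have : lpNormE p (0 : EuclideanSpace ℝ (Fin n)) = 1 := hx
  rw [lpN_zero hp] at this; norm_num at this

lemma prj_continuousOn (hp : 2 ≤ p) :
    ContinuousOn (prj p : EuclideanSpace ℝ (Fin n) → _) {x | x ≠ 0} := by
  unfold prj
  exact ((lpN_continuous hp).continuousOn.inv₀ (fun x hx => (lpN_pos hp hx).ne')).smul continuousOn_id

end basics

lemma bm_one_compact {K L : Set ℝ} (hK : IsCompact K) (hL : IsCompact L) (hK0 : K.Nonempty)
    (hL0 : L.Nonempty) (C : Set ℝ) (hC : ∀ x ∈ K, ∀ y ∈ L, x + y ∈ C) :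
    volume K + volume L ≤ volume C := by
  obtain ⟨a, ha, ha'⟩ := hK.exists_isGreatest hK0
  obtain ⟨b, hb, hb'⟩ := hL.exists_isLeast hL0
  have h1 : volume ((fun x => x + b) '' K) = volume K := by
    rw [Set.image_add_right]; exact measure_preimage_add_right _ _ _
  have h2 : volume ((fun x => a + x) '' L) = volume L := by
    rw [Set.image_add_left]; exact measure_preimage_add _ _ _
  have hm : MeasurableSet ((fun x => a + x) '' L) := (hL.image (by fun_prop)).measurableSet
  have hd : AEDisjoint volume ((fun x => x + b) '' K) ((fun x => a + x) '' L) := by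
    refine measure_mono_null (t := {a + b}) ?_ (by simp)
    rintro z ⟨⟨x, hx, rfl⟩, ⟨y, hy, hxy⟩⟩
    have := ha' hx
    have := hb' hy
    simp only at hxy ⊢
    simp only [Set.mem_singleton_iff]; linarith
  rw [← h1, ← h2, ← measure_union₀ hm.nullMeasurableSet hd]
  apply measure_mono
  rintro z (⟨x, hx, rfl⟩ | ⟨y, hy, rfl⟩)
  · exact hC _ hx _ hb
  · exact hC _ ha _ hy

lemma bm_one {A B : Set ℝ} (hA : MeasurableSet A) (hB : MeasurableSet B) (hA0 : A.Nonempty)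
    (hB0 : B.Nonempty) (C : Set ℝ) (hC : ∀ x ∈ A, ∀ y ∈ B, x + y ∈ C) :
    volume A + volume B ≤ volume C := by
  obtain ⟨a, ha⟩ := hA0
  obtain ⟨b, hb⟩ := hB0
  by_cases hA1 : volume A = 0
  · rw [hA1, zero_add]
    have h2 : volume ((fun x => a + x) '' B) = volume B := by
      rw [Set.image_add_left]; exact measure_preimage_add _ _ _
    rw [← h2]; apply measure_mono
    rintro z ⟨y, hy, rfl⟩; exact hC _ ha _ hy
  by_cases hB1 : volume B = 0
  · rw [hB1, add_zero]
    have h1 : volume ((fun x => x + b) '' A) = volume A := by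
      rw [Set.image_add_right]; exact measure_preimage_add_right _ _ _
    rw [← h1]; apply measure_mono
    rintro z ⟨x, hx, rfl⟩; exact hC _ hx _ hb
  refine le_of_forall_lt fun c hc => ?_
  obtain ⟨y, hy, z, hz, hyz⟩ := ENNReal.exists_lt_add_of_lt_add hc hA1 hB1
  obtain ⟨K, hKA, hK, hyK⟩ := hA.exists_lt_isCompact hy
  obtain ⟨L, hLB, hL, hzL⟩ := hB.exists_lt_isCompact hz
  have hK0 : K.Nonempty := by
    rw [Set.nonempty_iff_ne_empty]; rintro rfl; simp at hyK
  have hL0 : L.Nonempty := by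
    rw [Set.nonempty_iff_ne_empty]; rintro rfl; simp at hzL
  calc c < y + z := hyz
    _ ≤ volume K + volume L := add_le_add hyK.le hzL.le
    _ ≤ volume C := bm_one_compact hK hL hK0 hL0 C fun x hx y hy => hC _ (hKA hx) _ (hLB hy)

open scoped Pointwise in
lemma bm_one_scaled {s : ℝ} (hs : 0 < s) (hs1 : s < 1) {A B : Set ℝ} (hA : MeasurableSet A)
    (hB : MeasurableSet B) (hA0 : A.Nonempty) (hB0 : B.Nonempty) (C : Set ℝ)
    (hC : ∀ x ∈ A, ∀ y ∈ B, s * x + (1 - s) * y ∈ C) :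
    ENNReal.ofReal s * volume A + ENNReal.ofReal (1 - s) * volume B ≤ volume C := by
  have h1 : volume (s • A) = ENNReal.ofReal s * volume A := by
    rw [Measure.addHaar_smul]; simp [abs_of_pos hs]
  have h2 : volume ((1 - s) • B) = ENNReal.ofReal (1 - s) * volume B := by
    rw [Measure.addHaar_smul]; simp [abs_of_pos (sub_pos.2 hs1)]
  rw [← h1, ← h2]
  refine bm_one (hA.const_smul_of_ne_zero hs.ne') (hB.const_smul_of_ne_zero (sub_pos.2 hs1).ne')
    hA0.smul_set hB0.smul_set C ?_
  rintro _ ⟨x, hx, rfl⟩ _ ⟨y, hy, rfl⟩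
  exact hC x hx y hy

lemma amgm_enn {s : ℝ} (hs : 0 < s) (hs1 : s < 1) (x y : ENNReal) :
    x ^ s * y ^ (1 - s) ≤ ENNReal.ofReal s * x + ENNReal.ofReal (1 - s) * y := by
  have hs2 : 0 < 1 - s := by linarith
  by_cases hx : x = ⊤
  · have : ENNReal.ofReal s * x = ⊤ := by
      rw [hx, ENNReal.mul_top]; simpa using hs
    rw [this]; simp
  by_cases hy : y = ⊤
  · have : ENNReal.ofReal (1 - s) * y = ⊤ := by
      rw [hy, ENNReal.mul_top]; simpa using hs1
    rw [this]; simp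
  lift x to NNReal using hx
  lift y to NNReal using hy
  have := NNReal.geom_mean_le_arith_mean2_weighted s.toNNReal (1 - s).toNNReal x y (by
    rw [← Real.toNNReal_add hs.le hs2.le]; simp)
  rw [Real.coe_toNNReal _ hs.le, Real.coe_toNNReal _ hs2.le] at this
  rw [← ENNReal.coe_rpow_of_nonneg _ hs.le, ← ENNReal.coe_rpow_of_nonneg _ hs2.le]
  simp only [ENNReal.ofReal]
  exact_mod_cast this

lemma pl_real_one {s : ℝ} (hs : 0 < s) (hs1 : s < 1) (u v w : ℝ → ℝ) (hu : Measurable u)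
    (hv : Measurable v) (hw : Measurable w) (hu0 : ∀ x, 0 ≤ u x) (hv0 : ∀ x, 0 ≤ v x)
    (hw0 : ∀ x, 0 ≤ w x) (hua : ∀ x, u x ≤ 1)
    (hvb : ∀ x, v x ≤ 1) (hua' : ∀ t < 1, ∃ x, t < u x) (hvb' : ∀ t < 1, ∃ x, t < v x)
    (h : ∀ x y, u x ^ s * v y ^ (1 - s) ≤ w (s * x + (1 - s) * y)) :
    (∫⁻ x, ENNReal.ofReal (u x)) ^ s * (∫⁻ x, ENNReal.ofReal (v x)) ^ (1 - s) ≤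
      ∫⁻ x, ENNReal.ofReal (w x) := by
  refine (amgm_enn hs hs1 _ _).trans ?_
  rw [lintegral_eq_lintegral_meas_lt volume (Filter.Eventually.of_forall hu0) hu.aemeasurable,
    lintegral_eq_lintegral_meas_lt volume (Filter.Eventually.of_forall hv0) hv.aemeasurable,
    lintegral_eq_lintegral_meas_lt volume (Filter.Eventually.of_forall hw0) hw.aemeasurable,
    ← lintegral_const_mul' _ _ ENNReal.ofReal_ne_top,
    ← lintegral_const_mul' _ _ ENNReal.ofReal_ne_top, ← lintegral_add_left']
  · refine setLIntegral_mono' measurableSet_Ioi fun t ht => ?_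
    have ht0 : (0 : ℝ) < t := ht
    by_cases ht1 : t < 1
    · refine bm_one_scaled hs hs1 (hu measurableSet_Ioi) (hv measurableSet_Ioi) (hua' t ht1)
        (hvb' t ht1) _ ?_
      intro x hx y hy
      have hx : t < u x := hx
      have hy : t < v y := hy
      show t < w _
      refine lt_of_lt_of_le ?_ (h x y)
      calc t = t ^ s * t ^ (1 - s) := by rw [← Real.rpow_add ht0]; simp
        _ < u x ^ s * v y ^ (1 - s) := by
          apply mul_lt_mul'' (Real.rpow_lt_rpow ht0.le hx hs)
            (Real.rpow_lt_rpow ht0.le hy (by linarith)) <;> positivity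
    · have h1 : {a | t < u a} = ∅ := by
        ext x; simp; have := hua x; linarith
      have h2 : {a | t < v a} = ∅ := by
        ext x; simp; have := hvb x; linarith
      rw [h1, h2]; simp
  · apply Measurable.aemeasurable
    apply Measurable.const_mul
    apply Antitone.measurable
    intro a b hab
    exact measure_mono fun x hx => lt_of_le_of_lt hab hx

lemma pl_real {s : ℝ} (hs : 0 < s) (hs1 : s < 1) (u v w : ℝ → ℝ) (hu : Measurable u)
    (hv : Measurable v) (hw : Measurable w) (hu0 : ∀ x, 0 ≤ u x) (hv0 : ∀ x, 0 ≤ v x)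
    (hw0 : ∀ x, 0 ≤ w x) (a b : ℝ) (ha : 0 < a) (hb : 0 < b) (hua : ∀ x, u x ≤ a)
    (hvb : ∀ x, v x ≤ b) (hua' : ∀ t < a, ∃ x, t < u x) (hvb' : ∀ t < b, ∃ x, t < v x)
    (h : ∀ x y, u x ^ s * v y ^ (1 - s) ≤ w (s * x + (1 - s) * y)) :
    (∫⁻ x, ENNReal.ofReal (u x)) ^ s * (∫⁻ x, ENNReal.ofReal (v x)) ^ (1 - s) ≤
      ∫⁻ x, ENNReal.ofReal (w x) := by
  have hs2 : 0 < 1 - s := by linarith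
  have hc : 0 < a ^ s * b ^ (1 - s) := by positivity
  have key := pl_real_one hs hs1 (fun x => a⁻¹ * u x) (fun x => b⁻¹ * v x)
    (fun x => (a ^ s * b ^ (1 - s))⁻¹ * w x) (hu.const_mul _) (hv.const_mul _) (hw.const_mul _)
    (fun x => by have := hu0 x; positivity) (fun x => by have := hv0 x; positivity)
    (fun x => by have := hw0 x; positivity)
    (fun x => by rw [inv_mul_le_iff₀ ha]; simpa using hua x)
    (fun x => by rw [inv_mul_le_iff₀ hb]; simpa using hvb x)
    (fun t ht => by
      obtain ⟨x, hx⟩ := hua' (a * t) (by nlinarith)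
      exact ⟨x, by rwa [lt_inv_mul_iff₀ ha]⟩)
    (fun t ht => by
      obtain ⟨x, hx⟩ := hvb' (b * t) (by nlinarith)
      exact ⟨x, by rwa [lt_inv_mul_iff₀ hb]⟩)
    (fun x y => by
      rw [Real.mul_rpow (by positivity) (hu0 x), Real.mul_rpow (by positivity) (hv0 y),
        Real.inv_rpow ha.le, Real.inv_rpow hb.le, mul_inv]
      calc _ = ((a ^ s)⁻¹ * (b ^ (1 - s))⁻¹) * (u x ^ s * v y ^ (1 - s)) := by ring
        _ ≤ _ := by gcongr; exact h x y)
  simp_rw [ENNReal.ofReal_mul (inv_pos.2 ha).le, ENNReal.ofReal_mul (inv_pos.2 hb).le,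
    ENNReal.ofReal_mul (inv_pos.2 hc).le] at key
  rw [lintegral_const_mul' _ _ ENNReal.ofReal_ne_top, lintegral_const_mul' _ _ ENNReal.ofReal_ne_top,
    lintegral_const_mul' _ _ ENNReal.ofReal_ne_top, ENNReal.mul_rpow_of_nonneg _ _ hs.le,
    ENNReal.mul_rpow_of_nonneg _ _ hs2.le, ENNReal.ofReal_rpow_of_pos (inv_pos.2 ha),
    ENNReal.ofReal_rpow_of_pos (inv_pos.2 hb)] at key
  have e : ENNReal.ofReal (a ^ s * b ^ (1 - s)) * (ENNReal.ofReal (a⁻¹ ^ s) *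
      ENNReal.ofReal (b⁻¹ ^ (1 - s))) = 1 := by
    rw [← ENNReal.ofReal_mul (by positivity), ← ENNReal.ofReal_mul (by positivity),
      Real.inv_rpow ha.le, Real.inv_rpow hb.le, ← mul_inv, mul_inv_cancel₀ hc.ne']; simp
  have e2 : ENNReal.ofReal (a ^ s * b ^ (1 - s)) * ENNReal.ofReal (a ^ s * b ^ (1 - s))⁻¹ = 1 := by
    rw [← ENNReal.ofReal_mul (by positivity), mul_inv_cancel₀ hc.ne']; simp
  have key2 := mul_le_mul_right key (ENNReal.ofReal (a ^ s * b ^ (1 - s)))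
  rw [← mul_assoc _ _ (∫⁻ x, ENNReal.ofReal (w x)), e2, one_mul] at key2
  refine le_trans (le_of_eq ?_) key2
  calc _ = 1 * ((∫⁻ x, ENNReal.ofReal (u x)) ^ s * (∫⁻ x, ENNReal.ofReal (v x)) ^ (1 - s)) := by
        rw [one_mul]
    _ = _ := by rw [← e]; ring

lemma pl_bdd {s : ℝ} (hs : 0 < s) (hs1 : s < 1) (u v w : ℝ → ENNReal) (hu : Measurable u)
    (hv : Measurable v) (hw : Measurable w) (K : NNReal) (huK : ∀ x, u x ≤ K) (hvK : ∀ x, v x ≤ K)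
    (h : ∀ x y, u x ^ s * v y ^ (1 - s) ≤ w (s * x + (1 - s) * y)) :
    (∫⁻ x, u x) ^ s * (∫⁻ x, v x) ^ (1 - s) ≤ ∫⁻ x, w x := by
  have hs2 : 0 < 1 - s := by linarith
  by_cases hu0 : ∀ x, u x = 0
  · simp [hu0, hs]
  by_cases hv0 : ∀ x, v x = 0
  · simp [hv0, hs2]
  push Not at hu0 hv0
  obtain ⟨x0, hx0⟩ := hu0
  obtain ⟨y0, hy0⟩ := hv0
  have hut : ∀ x, u x ≠ ⊤ := fun x => ((huK x).trans_lt ENNReal.coe_lt_top).ne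
  have hvt : ∀ x, v x ≠ ⊤ := fun x => ((hvK x).trans_lt ENNReal.coe_lt_top).ne
  have hwt : ∀ x, min (w x) K ≠ ⊤ := fun x => ((min_le_right _ _).trans_lt ENNReal.coe_lt_top).ne
  have bu : BddAbove (Set.range fun x => (u x).toReal) := ⟨K, by
    rintro _ ⟨x, rfl⟩; exact ENNReal.toReal_le_coe_of_le_coe (huK x)⟩
  have bv : BddAbove (Set.range fun x => (v x).toReal) := ⟨K, by
    rintro _ ⟨x, rfl⟩; exact ENNReal.toReal_le_coe_of_le_coe (hvK x)⟩
  have key := pl_real hs hs1 (fun x => (u x).toReal) (fun x => (v x).toReal)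
    (fun x => (min (w x) K).toReal) hu.ennreal_toReal hv.ennreal_toReal
    (hw.min measurable_const).ennreal_toReal (fun _ => ENNReal.toReal_nonneg)
    (fun _ => ENNReal.toReal_nonneg) (fun _ => ENNReal.toReal_nonneg)
    (⨆ x, (u x).toReal) (⨆ x, (v x).toReal)
    (lt_of_lt_of_le (ENNReal.toReal_pos hx0 (hut _)) (le_ciSup bu x0))
    (lt_of_lt_of_le (ENNReal.toReal_pos hy0 (hvt _)) (le_ciSup bv y0))
    (fun x => le_ciSup bu x) (fun x => le_ciSup bv x) (fun t ht => exists_lt_of_lt_ciSup ht)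
    (fun t ht => exists_lt_of_lt_ciSup ht) (fun x y => by
      rw [ENNReal.toReal_rpow, ENNReal.toReal_rpow, ← ENNReal.toReal_mul]
      refine ENNReal.toReal_mono (hwt _) (le_min (h x y) ?_)
      calc u x ^ s * v y ^ (1 - s) ≤ (K : ENNReal) ^ s * (K : ENNReal) ^ (1 - s) := by
            gcongr
            · exact huK x
            · exact hvK y
        _ = K := by
            rw [← ENNReal.rpow_add_of_nonneg _ _ hs.le hs2.le]; simp)
  simp only [ENNReal.ofReal_toReal (hut _), ENNReal.ofReal_toReal (hvt _),
    ENNReal.ofReal_toReal (hwt _)] at key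
  exact key.trans (lintegral_mono fun x => min_le_left _ _)

lemma iSup_min_nat (a : ENNReal) : ⨆ k : ℕ, min a ((k : NNReal) : ENNReal) = a := by
  apply le_antisymm (iSup_le fun k => min_le_left _ _)
  refine le_of_forall_lt fun c hc => ?_
  obtain ⟨k, hk⟩ := ENNReal.exists_nat_gt (ne_top_of_lt hc)
  refine lt_of_lt_of_le (lt_min hc hk) ?_
  exact le_iSup (fun k : ℕ => min a ((k : NNReal) : ENNReal)) k

theorem pl_one {s : ℝ} (hs : 0 < s) (hs1 : s < 1) (u v w : ℝ → ENNReal) (hu : Measurable u)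
    (hv : Measurable v) (hw : Measurable w)
    (h : ∀ x y, u x ^ s * v y ^ (1 - s) ≤ w (s * x + (1 - s) * y)) :
    (∫⁻ x, u x) ^ s * (∫⁻ x, v x) ^ (1 - s) ≤ ∫⁻ x, w x := by
  have hs2 : 0 < 1 - s := by linarith
  have hmono : ∀ f : ℝ → ENNReal, Monotone fun (k : ℕ) x => min (f x) ((k : NNReal) : ENNReal) := by
    intro f j k hjk x
    exact min_le_min le_rfl (ENNReal.coe_le_coe.2 (Nat.cast_le.2 hjk))
  have lim : ∀ f : ℝ → ENNReal, Measurable f → Filter.Tendsto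
      (fun k : ℕ => ∫⁻ x, min (f x) ((k : NNReal) : ENNReal)) Filter.atTop (nhds (∫⁻ x, f x)) := by
    intro f hf
    have := tendsto_atTop_iSup (f := fun k : ℕ => ∫⁻ x, min (f x) ((k : NNReal) : ENNReal))
      (fun j k hjk => lintegral_mono (hmono f hjk))
    rw [← lintegral_iSup (fun k => hf.min measurable_const) (hmono f)] at this
    simpa only [iSup_min_nat] using this
  by_cases hu0 : ∫⁻ x, u x = 0
  · simp [hu0, hs]
  by_cases hv0 : ∫⁻ x, v x = 0
  · simp [hv0, hs2]
  have t1 := ENNReal.Tendsto.mul ((lim u hu).ennrpow_const s) (Or.inl (by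
    simp [ENNReal.rpow_eq_zero_iff, hu0, hs, hs.le])) ((lim v hv).ennrpow_const (1 - s)) (Or.inl (by
    simp [ENNReal.rpow_eq_zero_iff, hv0, hs1, hs1.le]))
  refine le_of_tendsto' t1 fun k => ?_
  refine pl_bdd hs hs1 _ _ w (hu.min measurable_const) (hv.min measurable_const) hw (k : NNReal)
    (fun x => min_le_right _ _) (fun x => min_le_right _ _) fun x y => ?_
  refine le_trans ?_ (h x y)
  gcongr <;> exact min_le_left _ _

theorem pl_pi {s : ℝ} (hs : 0 < s) (hs1 : s < 1) : ∀ (n : ℕ) (u v w : (Fin n → ℝ) → ENNReal)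
    (hu : Measurable u) (hv : Measurable v) (hw : Measurable w)
    (h : ∀ x y, u x ^ s * v y ^ (1 - s) ≤ w (s • x + (1 - s) • y)),
    (∫⁻ x, u x) ^ s * (∫⁻ x, v x) ^ (1 - s) ≤ ∫⁻ x, w x := by
  intro n
  induction n with
  | zero =>
    intro u v w hu hv hw h
    have hv' : (volume : Measure (Fin 0 → ℝ)) = Measure.dirac (fun i => i.elim0) := by
      rw [volume_pi]; exact Measure.pi_of_empty _ _
    rw [hv', lintegral_dirac, lintegral_dirac, lintegral_dirac]
    exact (h _ _).trans (le_of_eq (congrArg w (Subsingleton.elim _ _)))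
  | succ n ih =>
    intro u v w hu hv hw h
    let e := (MeasurableEquiv.piFinSuccAbove (fun _ : Fin (n + 1) => ℝ) 0).symm
    have he : MeasurePreserving e volume volume :=
      (volume_preserving_piFinSuccAbove (fun _ : Fin (n + 1) => ℝ) 0).symm
    have fub : ∀ f : (Fin (n + 1) → ℝ) → ENNReal, Measurable f →
        ∫⁻ x, f x = ∫⁻ a : ℝ, ∫⁻ y : Fin n → ℝ, f (e (a, y)) := by
      intro f hf
      rw [← he.lintegral_comp hf, Measure.volume_eq_prod]
      exact lintegral_prod (fun z => f (e z)) (hf.comp e.measurable).aemeasurable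
    have hadd : ∀ a b x y, e (s * a + (1 - s) * b, s • x + (1 - s) • y) =
        s • e (a, x) + (1 - s) • e (b, y) := by
      intro a b x y
      ext i
      refine Fin.cases ?_ (fun i => ?_) i <;> simp [e, MeasurableEquiv.piFinSuccAbove]
    rw [fub u hu, fub v hv, fub w hw]
    refine pl_one hs hs1 _ _ _ ((hu.comp e.measurable).lintegral_prod_right')
      ((hv.comp e.measurable).lintegral_prod_right')
      ((hw.comp e.measurable).lintegral_prod_right') fun a b => ?_
    refine ih _ _ _ (hu.comp (e.measurable.comp measurable_prodMk_left))
      (hv.comp (e.measurable.comp measurable_prodMk_left))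
      (hw.comp (e.measurable.comp measurable_prodMk_left)) fun x y => ?_
    have := h (e (a, x)) (e (b, y))
    rwa [← hadd] at this

theorem pl_euc {s : ℝ} (hs : 0 < s) (hs1 : s < 1) {n : ℕ} (u v w : EuclideanSpace ℝ (Fin n) → ENNReal)
    (hu : Measurable u) (hv : Measurable v) (hw : Measurable w)
    (h : ∀ x y, u x ^ s * v y ^ (1 - s) ≤ w (s • x + (1 - s) • y)) :
    (∫⁻ x, u x) ^ s * (∫⁻ x, v x) ^ (1 - s) ≤ ∫⁻ x, w x := by
  have he := PiLp.volume_preserving_toLp (Fin n)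
  rw [← he.lintegral_comp hu, ← he.lintegral_comp hv, ← he.lintegral_comp hw]
  exact pl_pi hs hs1 n _ _ _ (hu.comp he.measurable) (hv.comp he.measurable)
    (hw.comp he.measurable) fun x y => h _ _

lemma abs_rpow_eq (p x : ℝ) : |x| ^ p = (x ^ 2) ^ (p / 2) := by
  rw [← sq_abs, ← Real.rpow_natCast, ← Real.rpow_mul (abs_nonneg _)]
  congr 1; push_cast; ring

lemma clarkson_real {p : ℝ} (hp : 2 ≤ p) (x y : ℝ) :
    |(x + y) / 2| ^ p + |(x - y) / 2| ^ p ≤ (|x| ^ p + |y| ^ p) / 2 := by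
  simp only [abs_rpow_eq p]
  have h1 := Real.add_rpow_le_rpow_add (sq_nonneg ((x + y) / 2)) (sq_nonneg ((x - y) / 2))
    (p := p / 2) (by linarith)
  refine h1.trans ?_
  have h2 : ((x + y) / 2) ^ 2 + ((x - y) / 2) ^ 2 = (1 / 2) * x ^ 2 + (1 / 2) * y ^ 2 := by ring
  rw [h2]
  have h3 := (convexOn_rpow (p := p / 2) (by linarith)).2 (Set.mem_Ici.2 (sq_nonneg x))
    (Set.mem_Ici.2 (sq_nonneg y)) (by norm_num : (0 : ℝ) ≤ 1 / 2) (by norm_num : (0 : ℝ) ≤ 1 / 2)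
    (by norm_num)
  simp only [smul_eq_mul] at h3
  linarith

lemma abs_rpow_support {p : ℝ} (hp : 2 ≤ p) (a : ℝ) :
    ∃ l : ℝ, ∀ b : ℝ, |a| ^ p + l * b ≤ |a + b| ^ p := by
  by_cases ha : a = 0
  · refine ⟨0, fun b => ?_⟩
    subst ha
    rw [abs_zero, Real.zero_rpow (by linarith)]
    simp; positivity
  refine ⟨p * |a| ^ p / a, fun b => ?_⟩
  have h1 : 1 + p * (b / a) ≤ |1 + b / a| ^ p := by
    by_cases h : -1 ≤ b / a
    · rw [abs_of_nonneg (by linarith)]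
      exact one_add_mul_self_le_rpow_one_add h (by linarith)
    · push Not at h
      have : 0 ≤ |1 + b / a| ^ p := by positivity
      nlinarith
  have h2 : |a + b| ^ p = |a| ^ p * |1 + b / a| ^ p := by
    rw [← Real.mul_rpow (abs_nonneg _) (abs_nonneg _), ← abs_mul]
    congr 2; field_simp
  rw [h2]
  have h3 : 0 ≤ |a| ^ p := by positivity
  calc _ = |a| ^ p * (1 + p * (b / a)) := by field_simp
    _ ≤ _ := by gcongr

noncomputable def cpc (p : ℝ) : ℝ := 1 / (2 ^ (p - 1) - 1)

lemma cpc_aux {p : ℝ} (hp : 2 ≤ p) : (2 : ℝ) ≤ 2 ^ (p - 1) := by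
  calc (2 : ℝ) = 2 ^ (1 : ℝ) := by simp
    _ ≤ _ := Real.rpow_le_rpow_of_exponent_le (by norm_num) (by linarith)

lemma cpc_pos {p : ℝ} (hp : 2 ≤ p) : 0 < cpc p := by
  have := cpc_aux hp
  unfold cpc
  exact one_div_pos.2 (by linarith)

lemma abs_rpow_unif {p : ℝ} (hp : 2 ≤ p) (a : ℝ) :
    ∃ l : ℝ, ∀ b : ℝ, |a| ^ p + l * b + cpc p * |b| ^ p ≤ |a + b| ^ p := by
  obtain ⟨l, hl⟩ := abs_rpow_support hp a
  refine ⟨l, fun b => ?_⟩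
  set T : ℝ := 2 ^ (p - 1) with hT
  have hT2 : 2 ≤ T := cpc_aux hp
  have hc : cpc p + 1 = cpc p * T := by
    unfold cpc; rw [← hT]
    have : T - 1 ≠ 0 := by linarith
    field_simp; ring
  have hhalf : ∀ b : ℝ, |b / 2| ^ p * (2 * T) = |b| ^ p := by
    intro b
    rw [abs_div, Real.div_rpow (abs_nonneg _) (abs_nonneg _), abs_of_pos (by norm_num : (0:ℝ) < 2)]
    have : (2 : ℝ) ^ p = 2 * T := by
      rw [hT, Real.rpow_sub (by norm_num)]; simp; ring
    rw [this]; field_simp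
  have key : ∀ k : ℕ, ∀ b : ℝ,
      |a| ^ p + l * b + cpc p * (1 - (T⁻¹) ^ k) * |b| ^ p ≤ |a + b| ^ p := by
    intro k
    induction k with
    | zero => intro b; simpa using hl b
    | succ k ih =>
      intro b
      have h1 := ih (b / 2)
      have h2 := clarkson_real hp (a + b) a
      have e1 : (a + b + a) / 2 = a + b / 2 := by ring
      have e2 : (a + b - a) / 2 = b / 2 := by ring
      rw [e1, e2] at h2
      set X := |b / 2| ^ p with hX
      have hb : |b| ^ p = X * (2 * T) := (hhalf b).symm
      rw [hb, pow_succ]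
      have : cpc p * (1 - T⁻¹ ^ k * T⁻¹) * (X * (2 * T)) =
        2 * X * (cpc p * T - cpc p * T⁻¹ ^ k) := by
        field_simp
      rw [this, ← hc]
      nlinarith
  have hlim : Filter.Tendsto (fun k : ℕ => |a| ^ p + l * b + cpc p * (1 - (T⁻¹) ^ k) * |b| ^ p)
      Filter.atTop (nhds (|a| ^ p + l * b + cpc p * (1 - 0) * |b| ^ p)) := by
    have := tendsto_pow_atTop_nhds_zero_of_lt_one (r := T⁻¹) (by positivity)
      (inv_lt_one_of_one_lt₀ (by linarith))
    exact ((((this.const_sub 1).const_mul _).mul_const _).const_add _)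
  have := le_of_tendsto' hlim fun k => key k b
  simpa using this

/-- Quantitative convexity of `|.|^p`. -/
lemma quant_conv {p : ℝ} (hp : 2 ≤ p) {σ : ℝ} (h0 : 0 < σ) (h1 : σ < 1) (x y : ℝ) :
    |(1 - σ) * x + σ * y| ^ p + cpc p * σ * (1 - σ) ^ p * |y - x| ^ p ≤
      (1 - σ) * |x| ^ p + σ * |y| ^ p := by
  set z := (1 - σ) * x + σ * y with hz
  obtain ⟨l, hl⟩ := abs_rpow_unif hp z
  have hx := hl (x - z)
  have hy := hl (y - z)
  have hc := cpc_pos hp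
  have hy2 : |y - z| ^ p = (1 - σ) ^ p * |y - x| ^ p := by
    have : y - z = (1 - σ) * (y - x) := by rw [hz]; ring
    rw [this, abs_mul, abs_of_pos (by linarith : 0 < 1 - σ),
      Real.mul_rpow (by linarith) (abs_nonneg _)]
  have hx2 : 0 ≤ cpc p * |x - z| ^ p := by positivity
  rw [hy2] at hy
  have e1 : z + (x - z) = x := by ring
  have e2 : z + (y - z) = y := by ring
  rw [e1] at hx
  rw [e2] at hy
  have h2 : 0 < 1 - σ := by linarith
  have k1 : (1 - σ) * (|z| ^ p + l * (x - z)) ≤ (1 - σ) * |x| ^ p := by gcongr; linarith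
  have k2 : σ * (|z| ^ p + l * (y - z) + cpc p * ((1 - σ) ^ p * |y - x| ^ p)) ≤ σ * |y| ^ p := by
    gcongr
  have e3 : (1 - σ) * (l * (x - z)) + σ * (l * (y - z)) = 0 := by rw [hz]; ring
  nlinarith

/-- Vector version. -/
lemma quant_conv_lp {p : ℝ} (hp : 2 ≤ p) {n : ℕ} {σ : ℝ} (h0 : 0 < σ) (h1 : σ < 1)
    (x y : EuclideanSpace ℝ (Fin n)) :
    lpNormE p ((1 - σ) • x + σ • y) ^ p + cpc p * σ * (1 - σ) ^ p * lpNormE p (y - x) ^ p ≤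
      (1 - σ) * lpNormE p x ^ p + σ * lpNormE p y ^ p := by
  simp only [lpN_rpow hp, Finset.mul_sum, ← Finset.sum_add_distrib]
  refine Finset.sum_le_sum fun i _ => ?_
  simpa using quant_conv hp h0 h1 (x i) (y i)

section onestep
variable {n : ℕ}

/-- Gibbs measure with density `exp (-N^p - ζ)`. -/
noncomputable def gm (p ζ : ℝ) (n : ℕ) : Measure (EuclideanSpace ℝ (Fin n)) :=
  volume.withDensity fun x => ENNReal.ofReal (Real.exp (-(lpNormE p x) ^ p - ζ))

lemma gm_dens_meas {p ζ : ℝ} (hp : 2 ≤ p) :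
    Measurable fun x : EuclideanSpace ℝ (Fin n) =>
      ENNReal.ofReal (Real.exp (-(lpNormE p x) ^ p - ζ)) := by
  have := (lpN_continuous (n := n) hp).measurable
  fun_prop

lemma gm_lintegral {p ζ : ℝ} (hp : 2 ≤ p) {g : EuclideanSpace ℝ (Fin n) → ENNReal}
    (hg : Measurable g) :
    ∫⁻ x, g x ∂(gm p ζ n) =
      ∫⁻ x, g x * ENNReal.ofReal (Real.exp (-(lpNormE p x) ^ p - ζ)) := by
  unfold gm
  rw [lintegral_withDensity_eq_lintegral_mul _ (gm_dens_meas hp) hg]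
  simp [mul_comm]

lemma step_int {p q ζ : ℝ} (hp : 2 ≤ p) (hq : 1 < q) [IsProbabilityMeasure (gm p ζ n)]
    {σ r M : ℝ} (h0 : 0 < σ) (h1 : σ < 1) (hr : q ≤ r) (hM : 0 ≤ M)
    (G H : EuclideanSpace ℝ (Fin n) → ℝ) (hG : Measurable G) (hH : Measurable H)
    (hG0 : ∀ x, 0 ≤ G x) (hH0 : ∀ x, 0 ≤ H x)
    (hpt : ∀ x z, G x ≤ (G z ^ q + M * H z ^ q) ^ (1 / q) *
      Real.exp (cpc p * (1 - σ) ^ p * σ ^ (1 - p) * lpNormE p (x - z) ^ p / r)) :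
    eLpNorm' G (r / (1 - σ)) (gm p ζ n) ^ q ≤
      eLpNorm' G r (gm p ζ n) ^ q + ENNReal.ofReal M * eLpNorm' H r (gm p ζ n) ^ q := by
  have hs : 0 < 1 - σ := by linarith
  have hq0 : 0 < q := by linarith
  have hr0 : 0 < r := by linarith
  set ρ : EuclideanSpace ℝ (Fin n) → ENNReal := fun x =>
    ENNReal.ofReal (Real.exp (-(lpNormE p x) ^ p - ζ)) with hρ
  have hρm : Measurable ρ := gm_dens_meas hp
  set W : EuclideanSpace ℝ (Fin n) → ℝ := fun z => (G z ^ q + M * H z ^ q) with hW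
  have hW0 : ∀ z, 0 ≤ W z := fun z => by
    have := hG0 z; have := hH0 z; positivity
  have hWm : Measurable W := by fun_prop
  have hp0 : 0 < p := by linarith
  have e1 : ∫⁻ x, ENNReal.ofReal (G x) ^ (r / (1 - σ)) ∂(gm p ζ n) =
      ∫⁻ x, ENNReal.ofReal (G x) ^ (r / (1 - σ)) * ρ x :=
    gm_lintegral hp (by fun_prop)
  have e2 : ∫⁻ x, ENNReal.ofReal (W x) ^ (r / q) ∂(gm p ζ n) =
      ∫⁻ x, ENNReal.ofReal (W x) ^ (r / q) * ρ x :=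
    gm_lintegral hp (by fun_prop)
  have e3 : ∫⁻ x, ρ x = 1 := by
    have : gm p ζ n Set.univ = 1 := measure_univ
    unfold gm at this
    rwa [withDensity_apply _ MeasurableSet.univ, Measure.restrict_univ] at this
  have key := pl_euc hs (by linarith) (fun x => ENNReal.ofReal (G x) ^ (r / (1 - σ)) * ρ x) ρ
    (fun x => ENNReal.ofReal (W x) ^ (r / q) * ρ x) (by fun_prop) hρm (by fun_prop) (by
      intro x y
      have e4 : (1 - (1 - σ)) = σ := by ring
      rw [e4]
      set z := (1 - σ) • x + σ • y with hz
      simp only [hρ]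
      rw [ENNReal.ofReal_rpow_of_nonneg (hG0 x) (by positivity),
        ENNReal.ofReal_rpow_of_nonneg (hW0 z) (by positivity),
        ← ENNReal.ofReal_mul (by have := hG0 x; positivity),
        ← ENNReal.ofReal_mul (by have := hW0 z; positivity),
        ENNReal.ofReal_rpow_of_nonneg (by have := hG0 x; positivity) hs.le,
        ENNReal.ofReal_rpow_of_nonneg (by positivity) h0.le,
        ← ENNReal.ofReal_mul (by have := hG0 x; positivity)]
      apply ENNReal.ofReal_le_ofReal
      rw [Real.mul_rpow (by have := hG0 x; positivity) (by positivity), ← Real.rpow_mul (hG0 x),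
        div_mul_cancel₀ _ hs.ne', ← Real.exp_mul, ← Real.exp_mul, mul_assoc, ← Real.exp_add]
      set κ := cpc p * (1 - σ) ^ p * σ ^ (1 - p) with hκ
      have hxz : x - z = -(σ • (y - x)) := by
        rw [hz]; module
      have hτ : lpNormE p (x - z) ^ p = σ ^ p * lpNormE p (y - x) ^ p := by
        rw [hxz, lpN_neg, lpN_smul hp, abs_of_pos h0, Real.mul_rpow h0.le (lpN_nonneg _)]
      have hκτ : κ * lpNormE p (x - z) ^ p = cpc p * σ * (1 - σ) ^ p * lpNormE p (y - x) ^ p := by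
        rw [hτ, hκ]
        have : σ ^ (1 - p) * σ ^ p = σ := by rw [← Real.rpow_add h0]; simp
        linear_combination (cpc p * (1 - σ) ^ p * lpNormE p (y - x) ^ p) * this
      have hconv := quant_conv_lp hp h0 h1 x y
      rw [← hz, ← hκτ] at hconv
      have h5 : G x ^ r ≤ W z ^ (r / q) * Real.exp (κ * lpNormE p (x - z) ^ p) := by
        have := Real.rpow_le_rpow (hG0 x) (hpt x z) hr0.le
        rw [Real.mul_rpow (by have := hW0 z; positivity) (by positivity), ← Real.exp_mul,
          ← Real.rpow_mul (hW0 z), div_mul_cancel₀ _ hr0.ne'] at this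
        convert this using 3
        ring
      calc _ ≤ (W z ^ (r / q) * Real.exp (κ * lpNormE p (x - z) ^ p)) *
            Real.exp ((-lpNormE p x ^ p - ζ) * (1 - σ) + (-lpNormE p y ^ p - ζ) * σ) := by gcongr
        _ ≤ _ := by
          rw [mul_assoc, ← Real.exp_add]
          have := hW0 z
          gcongr
          linarith)
  rw [e3, ENNReal.one_rpow, mul_one, ← e1, ← e2] at key
  have hnorm : ∀ g : EuclideanSpace ℝ (Fin n) → ℝ, (∀ x, 0 ≤ g x) → ∀ x, ‖g x‖ₑ = ENNReal.ofReal (g x) :=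
    fun g hg x => Real.enorm_of_nonneg (hg x)
  simp only [eLpNorm', hnorm G hG0, hnorm H hH0]
  have hrq : 1 ≤ r / q := by rw [le_div_iff₀ hq0]; linarith
  have key2 := ENNReal.rpow_le_rpow key (z := q / r) (by positivity)
  rw [← ENNReal.rpow_mul] at key2
  have e5 : (1 - σ) * (q / r) = (1 / (r / (1 - σ))) * q := by field_simp
  rw [e5, ENNReal.rpow_mul] at key2
  refine key2.trans ?_
  have e6 : ∀ x, ENNReal.ofReal (W x) =
      ENNReal.ofReal (G x) ^ q + ENNReal.ofReal M * ENNReal.ofReal (H x) ^ q := by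
    intro x
    have h1 := hG0 x
    have h2 := hH0 x
    rw [ENNReal.ofReal_rpow_of_nonneg h1 hq0.le, ENNReal.ofReal_rpow_of_nonneg h2 hq0.le,
      ← ENNReal.ofReal_mul hM, ← ENNReal.ofReal_add (by positivity) (by positivity)]
  simp only [e6]
  have mink := ENNReal.lintegral_Lp_add_le (μ := gm p ζ n)
    (f := fun x => ENNReal.ofReal (G x) ^ q)
    (g := fun x => ENNReal.ofReal M * ENNReal.ofReal (H x) ^ q) (p := r / q)
    (by fun_prop) (by fun_prop) hrq
  have e7 : 1 / (r / q) = q / r := by field_simp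
  rw [e7] at mink
  simp only [Pi.add_apply] at mink
  refine mink.trans ?_
  have e8 : q * (r / q) = r := by field_simp
  have e9 : q / r = (1 / r) * q := by ring
  simp only [ENNReal.mul_rpow_of_nonneg _ _ (by positivity : 0 ≤ r / q), ← ENNReal.rpow_mul, e8]
  rw [lintegral_const_mul _ (by fun_prop), ENNReal.mul_rpow_of_nonneg _ _ (by positivity),
    ← ENNReal.rpow_mul]
  have e10 : r / q * (q / r) = 1 := by field_simp
  rw [e10, ENNReal.rpow_one, e9]

lemma exp_far {X Λ : ℝ} (hX : 0 ≤ X) (hΛ : 2 * Λ ≤ X) : 1 + Λ * X ≤ Real.exp X := by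
  have := Real.quadratic_le_exp_of_nonneg hX
  nlinarith

/-- Hölder for two terms -/
lemma holder2 {p q : ℝ} (hpq : p.HolderConjugate q) {a b M τ : ℝ} (ha : 0 ≤ a) (hb : 0 ≤ b)
    (hM : 0 < M) (hτ : 0 ≤ τ) :
    a + b * τ ≤ (a ^ q + M * b ^ q) ^ (1 / q) * (1 + τ ^ p / M ^ (p - 1)) ^ (1 / p) := by
  have hq0 := hpq.symm.pos
  have hp0 := hpq.pos
  have := Real.inner_le_Lp_mul_Lq_of_nonneg (Finset.univ : Finset (Fin 2)) hpq.symm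
    (f := ![a, M ^ (1 / q) * b]) (g := ![1, M ^ (-(1 / q)) * τ])
    (by intro i _; fin_cases i <;> simp <;> positivity)
    (by intro i _; fin_cases i <;> simp <;> positivity)
  simp only [Fin.sum_univ_two, Matrix.cons_val_zero, Matrix.cons_val_one] at this
  rw [Real.mul_rpow (by positivity) hb, Real.mul_rpow (by positivity) hτ, ← Real.rpow_mul hM.le,
    ← Real.rpow_mul hM.le, one_div_mul_cancel hq0.ne', Real.rpow_one, Real.one_rpow] at this
  have e1 : M ^ (1 / q) * b * (M ^ (-(1 / q)) * τ) = b * τ := by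
    have : M ^ (1 / q) * M ^ (-(1 / q)) = 1 := by rw [← Real.rpow_add hM]; simp
    linear_combination b * τ * this
  have e2 : M ^ (-(1 / q) * p) * τ ^ p = τ ^ p / M ^ (p - 1) := by
    have : -(1 / q) * p = -(p - 1) := by
      have := hpq.symm.sub_one_mul_conj
      have h2 := hpq.mul_eq_add
      field_simp; linarith
    rw [this, Real.rpow_neg hM.le]; field_simp
  rw [e1, e2, mul_one] at this
  exact this

lemma exp_root {p X Y : ℝ} (hp : 0 < p) (hY : 0 ≤ Y) (h : Y ≤ Real.exp X) :
    Y ^ (1 / p) ≤ Real.exp (X / p) := by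
  calc Y ^ (1 / p) ≤ (Real.exp X) ^ (1 / p) := by gcongr
    _ = _ := by rw [← Real.exp_mul]; congr 1; ring

lemma step_pt {p q : ℝ} (hp : 2 ≤ p) (hpq : p.HolderConjugate q) {κ r M δ η L : ℝ} (hr : 0 < r)
    (hM : 0 < M) (hκ : 0 < κ) (hMκ : M ^ (p - 1) * (p * κ) = r) (hδ : 0 < δ) (hη : 0 < η) (hL : 0 ≤ L)
    (hfar : 2 * (L / η) ^ p * M ^ (p - 1) ≤ δ ^ p)
    (G H : EuclideanSpace ℝ (Fin n) → ℝ)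
    (hG0 : ∀ x, 0 ≤ G x) (hH0 : ∀ x, 0 ≤ H x)
    (hnear : ∀ x z, lpNormE p (x - z) ≤ δ → G x ≤ G z + H z * lpNormE p (x - z))
    (hlip : ∀ x z, G x ≤ G z + L * lpNormE p (x - z)) (x z : EuclideanSpace ℝ (Fin n)) :
    G x ≤ (G z ^ q + M * (H z + η) ^ q) ^ (1 / q) *
      Real.exp (κ * lpNormE p (x - z) ^ p / r) := by
  have hp0 : 0 < p := by linarith
  have hq0 := hpq.symm.pos
  set τ := lpNormE p (x - z) with hτ
  have hτ0 : 0 ≤ τ := lpN_nonneg _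
  set X := τ ^ p / M ^ (p - 1) with hX
  have hMp : 0 < M ^ (p - 1) := by positivity
  have hX0 : 0 ≤ X := by positivity
  have hXe : κ * τ ^ p / r = X / p := by
    rw [hX, ← hMκ]; field_simp
  rw [hXe]
  have hGz := hG0 z
  have hHz := hH0 z
  by_cases hn : τ ≤ δ
  · refine (hnear x z hn).trans ((holder2 hpq hGz hHz hM hτ0).trans ?_)
    gcongr
    · linarith
    · exact exp_root hp0 (by positivity) (by have := Real.add_one_le_exp X; linarith)
  · push Not at hn
    refine (hlip x z).trans ?_
    have e : G z + L * τ = G z + η * (L / η * τ) := by field_simp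
    rw [e]
    refine ((holder2 hpq hGz hη.le hM (by positivity : 0 ≤ L / η * τ)).trans ?_)
    gcongr
    · linarith
    · apply exp_root hp0 (by positivity)
      have e2 : (L / η * τ) ^ p / M ^ (p - 1) = (L / η) ^ p * X := by
        rw [Real.mul_rpow (by positivity) hτ0, hX]; ring
      rw [e2]
      apply exp_far hX0
      rw [hX, le_div_iff₀ hMp]
      exact hfar.trans (by gcongr)

end onestep

section iter
variable {n : ℕ}

lemma bern_neg {s a : ℝ} (hs : 0 < s) (ha : 0 ≤ a) : 1 + a * (1 - s) ≤ s⁻¹ ^ a := by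
  have h1 := Real.log_le_sub_one_of_pos hs
  rw [Real.inv_rpow hs.le, ← Real.rpow_neg hs.le, Real.rpow_def_of_pos hs]
  have := Real.add_one_le_exp (Real.log s * -a)
  nlinarith

lemma iter_step {p q ζ : ℝ} (hp : 2 ≤ p) (hpq : p.HolderConjugate q)
    [IsProbabilityMeasure (gm p ζ n)]
    {s R δ η L : ℝ} (h0 : 0 < s) (h1 : s < 1) (hδ : 0 < δ) (hη : 0 < η)
    (hL : 0 ≤ L)
    (hfar : 2 * (L / η) ^ p * (R / (p * (cpc p * s ^ p * (1 - s) ^ (1 - p)))) ≤ δ ^ p)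
    (G H : EuclideanSpace ℝ (Fin n) → ℝ) (hG : Measurable G) (hH : Measurable H)
    (hG0 : ∀ x, 0 ≤ G x) (hH0 : ∀ x, 0 ≤ H x)
    (hnear : ∀ x z, lpNormE p (x - z) ≤ δ → G x ≤ G z + H z * lpNormE p (x - z))
    (hlip : ∀ x z, G x ≤ G z + L * lpNormE p (x - z)) (j : ℕ) (hj : q * s⁻¹ ^ j ≤ R) :
    eLpNorm' G (q * s⁻¹ ^ j) (gm p ζ n) ^ q ≤ eLpNorm' G q (gm p ζ n) ^ q +
      ENNReal.ofReal ((p - 1) * s⁻¹ ^ q * (p * cpc p)⁻¹ ^ (q - 1) *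
        ((q * s⁻¹ ^ j) ^ (q - 1) - q ^ (q - 1))) *
      eLpNorm' (fun x => H x + η) R (gm p ζ n) ^ q := by
  have hp0 : 0 < p := by linarith
  have hq1 : 1 < q := hpq.symm.lt
  have hq0 : 0 < q := by linarith
  have hc := cpc_pos hp
  have hpq1 : (p - 1) * (q - 1) = 1 := by
    have := hpq.mul_eq_add; linarith
  have hsi : 1 < s⁻¹ := (one_lt_inv₀ h0).2 h1
  induction j with
  | zero => simp
  | succ j ih =>
    set r := q * s⁻¹ ^ j with hr
    have hrs : q * s⁻¹ ^ (j + 1) = r / s := by rw [hr, pow_succ]; field_simp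
    rw [hrs] at hj ⊢
    have hr0 : 0 < r := by positivity
    have hrq : q ≤ r := by
      rw [hr]; exact le_mul_of_one_le_right hq0.le (one_le_pow₀ hsi.le)
    have hrR : r ≤ R := by
      refine le_trans ?_ hj
      rw [le_div_iff₀ h0]; nlinarith
    have ih := ih hrR
    set M := (1 - s) * (r * (p * cpc p)⁻¹) ^ (q - 1) * s⁻¹ ^ q with hM
    have hs1 : 0 < 1 - s := by linarith
    have hM0 : 0 < M := by positivity
    set κ := cpc p * s ^ p * (1 - s) ^ (1 - p) with hκ
    have hκ0 : 0 < κ := by positivity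
    have hMp : M ^ (p - 1) = r / (p * κ) := by
      rw [hM, Real.mul_rpow (by positivity) (by positivity), Real.mul_rpow (by positivity) (by positivity),
        ← Real.rpow_mul (by positivity), ← Real.rpow_mul (by positivity)]
      have e1 : (q - 1) * (p - 1) = 1 := by linarith
      have e2 : q * (p - 1) = p := by have := hpq.mul_eq_add; linarith
      rw [e1, e2, Real.rpow_one, hκ, show (1 - p) = -(p - 1) by ring, Real.rpow_neg hs1.le,
        Real.inv_rpow h0.le]
      field_simp
    have hMκ : M ^ (p - 1) * (p * κ) = r := by rw [hMp]; field_simp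
    have hpt := step_pt hp hpq hr0 hM0 hκ0 hMκ hδ hη hL (by
      refine le_trans ?_ hfar
      rw [hMp]; gcongr) G H hG0 hH0 hnear hlip
    have hss : 1 - (1 - s) = s := by ring
    have st := step_int (ζ := ζ) hp hq1 hs1 (by linarith) hrq hM0.le G (fun x => H x + η) hG (by fun_prop)
      hG0 (fun x => by have := hH0 x; positivity) (by
        intro x z
        rw [hss, ← hκ]; exact hpt x z)
    rw [hss] at st
    refine st.trans ?_
    have mono : eLpNorm' (fun x => H x + η) r (gm p ζ n) ≤ eLpNorm' (fun x => H x + η) R (gm p ζ n) :=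
      eLpNorm'_le_eLpNorm'_of_exponent_le hr0 hrR _ (by fun_prop)
    set K := eLpNorm' (fun x => H x + η) R (gm p ζ n)
    have b := bern_neg h0 (by linarith : 0 ≤ q - 1)
    set A := (p - 1) * s⁻¹ ^ q * (p * cpc p)⁻¹ ^ (q - 1) with hA
    have hA0 : 0 < A := by
      have : 0 < p - 1 := by linarith
      positivity
    have hMle : M ≤ A * ((r / s) ^ (q - 1) - r ^ (q - 1)) := by
      have e3 : (r / s) ^ (q - 1) = r ^ (q - 1) * s⁻¹ ^ (q - 1) := by
        rw [div_eq_mul_inv, Real.mul_rpow hr0.le (by positivity)]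
      rw [e3, hM, Real.mul_rpow hr0.le (by positivity)]
      have h3 : 0 ≤ A * r ^ (q - 1) := by positivity
      calc _ = A * r ^ (q - 1) * ((q - 1) * (1 - s)) := by
            rw [hA]; linear_combination (-(1 - s) * r ^ (q - 1) * (p * cpc p)⁻¹ ^ (q - 1) * s⁻¹ ^ q) * hpq1
        _ ≤ A * r ^ (q - 1) * (s⁻¹ ^ (q - 1) - 1) := by gcongr; linarith
        _ = _ := by ring
    calc _ ≤ (eLpNorm' G q (gm p ζ n) ^ q + ENNReal.ofReal (A * (r ^ (q - 1) - q ^ (q - 1))) * K ^ q) +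
          ENNReal.ofReal (A * ((r / s) ^ (q - 1) - r ^ (q - 1))) * K ^ q := by gcongr
      _ = _ := by
        rw [add_assoc, ← add_mul, ← ENNReal.ofReal_add]
        · congr 3; ring
        · apply mul_nonneg hA0.le
          rw [sub_nonneg]; gcongr
        · linarith

theorem moment_gm {p q ζ : ℝ} (hp : 2 ≤ p) (hpq : p.HolderConjugate q)
    [IsProbabilityMeasure (gm p ζ n)]
    {R δ η L : ℝ} (hR : p ≤ R) (hδ : 0 < δ) (hη : 0 < η)
    (hL : 0 ≤ L)
    (G H : EuclideanSpace ℝ (Fin n) → ℝ) (hG : Measurable G) (hH : Measurable H)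
    (hG0 : ∀ x, 0 ≤ G x) (hH0 : ∀ x, 0 ≤ H x)
    (hnear : ∀ x z, lpNormE p (x - z) ≤ δ → G x ≤ G z + H z * lpNormE p (x - z))
    (hlip : ∀ x z, G x ≤ G z + L * lpNormE p (x - z)) :
    eLpNorm' G R (gm p ζ n) ^ q ≤ eLpNorm' G q (gm p ζ n) ^ q +
      ENNReal.ofReal ((p - 1) * (R / (p * cpc p)) ^ (q - 1)) *
      eLpNorm' (fun x => H x + η) R (gm p ζ n) ^ q := by
  have hp0 : 0 < p := by linarith
  have hq1 : 1 < q := hpq.symm.lt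
  have hq0 : 0 < q := by linarith
  have hc := cpc_pos hp
  have hpq1 : (p - 1) * (q - 1) = 1 := by
    have := hpq.mul_eq_add; linarith
  have hq2 : q ≤ p := by nlinarith
  have hp1 : 0 < p - 1 := by linarith
  have hR0 : 0 < R := by linarith
  rcases (hq2.trans hR).eq_or_lt with hqR | hqR
  · rw [← hqR]; exact le_self_add
  set sJ : ℕ → ℝ := fun J => (q / R) ^ (1 / (J : ℝ)) with hsJ
  have hqR1 : q / R < 1 := by rw [div_lt_one hR0]; exact hqR
  have hqR0 : 0 < q / R := by positivity
  have lim_s : Filter.Tendsto sJ Filter.atTop (nhds 1) := by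
    have := (Real.continuousAt_const_rpow (a := q / R) (b := 0) hqR0.ne').tendsto.comp
      tendsto_one_div_atTop_nhds_zero_nat
    rw [Real.rpow_zero] at this
    exact this
  have lim_far : Filter.Tendsto (fun J => 2 * (L / η) ^ p *
      (R / (p * cpc p)) * ((sJ J ^ p)⁻¹ * (1 - sJ J) ^ (p - 1))) Filter.atTop (nhds 0) := by
    have a1 := ((Real.continuousAt_rpow_const 1 p (Or.inl one_ne_zero)).tendsto.comp lim_s).inv₀
      (by simp)
    have a2 : Filter.Tendsto (fun J => (1 - sJ J)) Filter.atTop (nhds (1 - 1)) := lim_s.const_sub 1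
    rw [sub_self] at a2
    have a3 := (Real.continuousAt_rpow_const 0 (p - 1) (Or.inr hp1.le)).tendsto.comp a2
    rw [Real.zero_rpow hp1.ne'] at a3
    have := (a1.mul a3).const_mul (2 * (L / η) ^ p * (R / (p * cpc p)))
    simpa using this
  have lim_out : Filter.Tendsto (fun J => eLpNorm' G q (gm p ζ n) ^ q +
      ENNReal.ofReal ((p - 1) * (sJ J)⁻¹ ^ q * (p * cpc p)⁻¹ ^ (q - 1) * R ^ (q - 1)) *
      eLpNorm' (fun x => H x + η) R (gm p ζ n) ^ q) Filter.atTop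
      (nhds (eLpNorm' G q (gm p ζ n) ^ q +
      ENNReal.ofReal ((p - 1) * (R / (p * cpc p)) ^ (q - 1)) *
      eLpNorm' (fun x => H x + η) R (gm p ζ n) ^ q)) := by
    have b1 : Filter.Tendsto (fun J => (p - 1) * (sJ J)⁻¹ ^ q * (p * cpc p)⁻¹ ^ (q - 1) * R ^ (q - 1))
        Filter.atTop (nhds ((p - 1) * (R / (p * cpc p)) ^ (q - 1))) := by
      have a1 := (Real.continuousAt_rpow_const (1 : ℝ)⁻¹ q (Or.inl (by simp))).tendsto.comp
        (lim_s.inv₀ one_ne_zero)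
      have := ((a1.const_mul (p - 1)).mul_const ((p * cpc p)⁻¹ ^ (q - 1))).mul_const (R ^ (q - 1))
      refine (this.congr fun J => rfl).trans (le_of_eq ?_)
      congr 1
      rw [div_eq_mul_inv, Real.mul_rpow hR0.le (by positivity)]
      simp; ring
    refine Filter.Tendsto.const_add _ (ENNReal.Tendsto.mul_const (ENNReal.tendsto_ofReal b1) (Or.inl ?_))
    have : 0 < (p - 1) * (R / (p * cpc p)) ^ (q - 1) := by positivity
    simpa using this
  refine ge_of_tendsto lim_out ?_
  have ev := lim_far.eventually (gt_mem_nhds (by positivity : 0 < δ ^ p))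
  filter_upwards [ev, Filter.eventually_gt_atTop 0] with J hJ hJ0
  have hJ0' : (0 : ℝ) < J := by exact_mod_cast hJ0
  have hs0 : 0 < sJ J := by positivity
  have hs1 : sJ J < 1 := Real.rpow_lt_one hqR0.le hqR1 (by positivity)
  have hs1' : 0 < 1 - sJ J := by linarith
  have hpow : q * (sJ J)⁻¹ ^ J = R := by
    have : sJ J ^ J = q / R := by
      simp only [hsJ]
      rw [← Real.rpow_natCast, ← Real.rpow_mul hqR0.le, one_div_mul_cancel hJ0'.ne', Real.rpow_one]
    rw [inv_pow, this]; field_simp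
  have := iter_step (ζ := ζ) hp hpq hs0 hs1 hδ hη hL (R := R) (by
    refine le_trans (le_of_eq ?_) hJ.le
    rw [show (1 - p) = -(p - 1) by ring, Real.rpow_neg hs1'.le]
    field_simp) G H hG hH hG0 hH0 hnear hlip J hpow.le
  rw [hpow] at this
  refine this.trans ?_
  gcongr
  have : 0 < q ^ (q - 1) := by positivity
  linarith

end iter

section gibbs
variable {n : ℕ}

noncomputable def gI (p a : ℝ) : ℝ := 2 * ((1 / p) * Real.Gamma ((a + 1) / p))

lemma gI_pos {p a : ℝ} (hp : 0 < p) (ha : 0 ≤ a) : 0 < gI p a := by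
  have := Real.Gamma_pos_of_pos (s := (a + 1) / p) (by positivity)
  unfold gI; positivity

lemma gI_integral {p a : ℝ} (hp : 0 < p) (ha : 0 ≤ a) :
    ∫ t : ℝ, |t| ^ a * Real.exp (-|t| ^ p) = gI p a := by
  rw [integral_comp_abs (f := fun t => t ^ a * Real.exp (-t ^ p)),
    integral_rpow_mul_exp_neg_rpow hp (by linarith)]
  rfl

lemma gm_int {p a : ℝ} (hp : 2 ≤ p) (ha : 0 ≤ a) (i : Fin n) :
    ∫ x : EuclideanSpace ℝ (Fin n), |x i| ^ a * Real.exp (-lpNormE p x ^ p) =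
      gI p a * gI p 0 ^ (n - 1) := by
  have he := PiLp.volume_preserving_toLp (Fin n)
  have hme : MeasurableEmbedding (WithLp.toLp 2 : (Fin n → ℝ) → EuclideanSpace ℝ (Fin n)) :=
    (MeasurableEquiv.toLp 2 (Fin n → ℝ)).measurableEmbedding
  rw [← he.integral_comp hme]
  have : ∀ y : Fin n → ℝ, |(WithLp.toLp 2 y : EuclideanSpace ℝ (Fin n)) i| ^ a *
      Real.exp (-lpNormE p (WithLp.toLp 2 y : EuclideanSpace ℝ (Fin n)) ^ p) =
      ∏ j, (fun (j : Fin n) (t : ℝ) => |t| ^ (if j = i then a else 0) * Real.exp (-|t| ^ p)) j (y j) := by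
    intro y
    rw [Finset.prod_mul_distrib, lpN_rpow hp, ← Real.exp_sum, Finset.sum_neg_distrib]
    congr 1
    rw [Finset.prod_eq_single i]
    · simp
    · intro b _ hb; simp [hb]
    · simp
  rw [integral_congr_ae (Filter.Eventually.of_forall this)]
  rw [integral_fintype_prod_volume_eq_prod (fun (j : Fin n) (t : ℝ) =>
    |t| ^ (if j = i then a else 0) * Real.exp (-|t| ^ p))]
  have hp0 : 0 < p := by linarith
  have : ∀ j : Fin n, ∫ t : ℝ, |t| ^ (if j = i then a else 0) * Real.exp (-|t| ^ p) =
      if j = i then gI p a else gI p 0 := by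
    intro j; split_ifs
    · exact gI_integral hp0 ha
    · exact gI_integral hp0 le_rfl
  simp_rw [this]
  rw [← Finset.mul_prod_erase _ _ (Finset.mem_univ i), if_pos rfl]
  congr 1
  rw [Finset.prod_congr rfl (g := fun _ => gI p 0)]
  · simp
  · intro j hj; rw [if_neg (Finset.ne_of_mem_erase hj)]

noncomputable def zet (p : ℝ) (n : ℕ) : ℝ := n * Real.log (gI p 0)

lemma gm_mom {p a : ℝ} (hp : 2 ≤ p) (ha : 0 ≤ a) (i : Fin n) :
    ∫⁻ x, ENNReal.ofReal (|x i| ^ a) ∂(gm p (zet p n) n) = ENNReal.ofReal (gI p a / gI p 0) := by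
  have hp0 : 0 < p := by linarith
  have hn : n ≠ 0 := by rintro rfl; exact i.elim0
  rw [gm_lintegral hp (by fun_prop)]
  have h1 := gI_pos hp0 ha
  have h2 := gI_pos hp0 le_rfl
  have e : ∀ x : EuclideanSpace ℝ (Fin n), ENNReal.ofReal (|x i| ^ a) *
      ENNReal.ofReal (Real.exp (-lpNormE p x ^ p - zet p n)) =
      ENNReal.ofReal ((gI p 0 ^ n)⁻¹ * (|x i| ^ a * Real.exp (-lpNormE p x ^ p))) := by
    intro x
    rw [← ENNReal.ofReal_mul (by positivity)]
    congr 1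
    unfold zet
    rw [Real.exp_sub, ← Real.log_rpow h2, Real.exp_log (by positivity),
      Real.rpow_natCast]
    ring
  simp_rw [e]
  have hval : ∫ x : EuclideanSpace ℝ (Fin n), (gI p 0 ^ n)⁻¹ * (|x i| ^ a * Real.exp (-lpNormE p x ^ p)) =
      gI p a / gI p 0 := by
    rw [integral_const_mul, gm_int hp ha]
    obtain ⟨m, rfl⟩ := Nat.exists_eq_succ_of_ne_zero hn
    simp only [Nat.succ_eq_add_one, Nat.add_sub_cancel, pow_succ]
    field_simp
  rw [← hval, ofReal_integral_eq_lintegral_ofReal]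
  · apply Integrable.of_integral_ne_zero
    rw [hval]; positivity
  · exact Filter.Eventually.of_forall fun x => by positivity

instance gm_prob {p : ℝ} [h : Fact (2 ≤ p)] [NeZero n] : IsProbabilityMeasure (gm p (zet p n) n) := by
  have := gm_mom (n := n) h.1 le_rfl 0
  have h2 := gI_pos (p := p) (by linarith [h.1]) le_rfl
  constructor
  simpa [div_self h2.ne'] using this

lemma gI_p {p : ℝ} (hp : 2 ≤ p) : gI p p / gI p 0 = 1 / p := by
  have hp0 : 0 < p := by linarith
  unfold gI
  have : (p + 1) / p = (0 + 1) / p + 1 := by field_simp; ring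
  have h := Real.Gamma_pos_of_pos (s := (0 + 1) / p) (by positivity)
  rw [this, Real.Gamma_add_one (by positivity)]
  field_simp; ring

lemma gI_2p {p : ℝ} (hp : 2 ≤ p) : gI p (2 * p) / gI p 0 = (1 / p) * (1 / p + 1) := by
  have hp0 : 0 < p := by linarith
  unfold gI
  have : (2 * p + 1) / p = ((0 + 1) / p + 1) + 1 := by field_simp; ring
  have h := Real.Gamma_pos_of_pos (s := (0 + 1) / p) (by positivity)
  rw [this, Real.Gamma_add_one (by positivity), Real.Gamma_add_one (by positivity)]
  field_simp; ring

/-- `E N^p = n/p`. -/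
lemma gm_Np {p : ℝ} (hp : 2 ≤ p) :
    ∫⁻ x, ENNReal.ofReal (lpNormE p x ^ p) ∂(gm p (zet p n) n) = ENNReal.ofReal (n / p) := by
  have : ∀ x : EuclideanSpace ℝ (Fin n), ENNReal.ofReal (lpNormE p x ^ p) =
      ∑ i, ENNReal.ofReal (|x i| ^ p) := by
    intro x
    rw [lpN_rpow hp, ENNReal.ofReal_sum_of_nonneg]
    intro i _; positivity
  simp_rw [this]
  rw [lintegral_finsetSum _ (fun i _ => by fun_prop)]
  simp_rw [gm_mom hp (by linarith : 0 ≤ p), gI_p hp]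
  rw [Finset.sum_const, Finset.card_univ, Fintype.card_fin, nsmul_eq_mul, ← ENNReal.ofReal_natCast,
    ← ENNReal.ofReal_mul (by positivity)]
  congr 1; ring

lemma gm_NR_lt_top {p R : ℝ} (hp : 2 ≤ p) (hR : p ≤ R) :
    ∫⁻ x, ENNReal.ofReal (lpNormE p x ^ R) ∂(gm p (zet p n) n) < ⊤ := by
  have hp0 : 0 < p := by linarith
  have : ∀ x : EuclideanSpace ℝ (Fin n), ENNReal.ofReal (lpNormE p x ^ R) ≤
      ENNReal.ofReal ((n : ℝ) ^ (R / p - 1)) * ∑ i, ENNReal.ofReal (|x i| ^ R) := by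
    intro x
    rw [← ENNReal.ofReal_sum_of_nonneg (fun i _ => by positivity), ← ENNReal.ofReal_mul (by positivity)]
    apply ENNReal.ofReal_le_ofReal
    have h1 : lpNormE p x ^ R = (∑ i, |x i| ^ p) ^ (R / p) := by
      rw [← lpN_rpow hp, ← Real.rpow_mul (lpN_nonneg _)]; congr 1; field_simp
    rw [h1]
    have := Real.rpow_sum_le_const_mul_sum_rpow_of_nonneg Finset.univ (f := fun i => |x i| ^ p)
      (p := R / p) (by rw [le_div_iff₀ hp0]; linarith) (fun i _ => by positivity)
    refine this.trans (le_of_eq ?_)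
    simp only [Finset.card_univ, Fintype.card_fin]
    congr 1
    refine Finset.sum_congr rfl fun i _ => ?_
    rw [← Real.rpow_mul (abs_nonneg _)]; congr 1; field_simp
  refine (lintegral_mono this).trans_lt ?_
  rw [lintegral_const_mul _ (by fun_prop), lintegral_finsetSum _ (fun i _ => by fun_prop)]
  simp_rw [gm_mom hp (by linarith : 0 ≤ R)]
  refine ENNReal.mul_lt_top ENNReal.ofReal_lt_top ?_
  simp [ENNReal.ofReal_lt_top, ENNReal.mul_lt_top_iff]

end gibbs

section polar
variable {n : ℕ} {p : ℝ}

def Bal (p : ℝ) (n : ℕ) : Set (EuclideanSpace ℝ (Fin n)) := {x | lpNormE p x ≤ 1}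

lemma Bal_closed (hp : 2 ≤ p) : IsClosed (Bal p n) :=
  isClosed_le (lpN_continuous hp) continuous_const

lemma Bal_meas (hp : 2 ≤ p) : MeasurableSet (Bal p n) := (Bal_closed hp).measurableSet

lemma Bal_vol_lt (hp : 2 ≤ p) : volume (Bal p n) < ⊤ := by
  refine (Bornology.IsBounded.measure_lt_top ?_)
  refine (Metric.isBounded_closedBall (x := 0) (r := n)).subset fun x hx => ?_
  have hx : lpNormE p x ≤ 1 := hx
  rw [mem_closedBall_zero_iff]
  refine (norm_le_lpN hp x).trans ?_
  have : (0 : ℝ) ≤ n := by positivity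
  nlinarith

lemma Bal_vol_pos (hp : 2 ≤ p) : 0 < volume (Bal p n) := by
  have hopen : IsOpen {x : EuclideanSpace ℝ (Fin n) | lpNormE p x < 1} :=
    isOpen_lt (lpN_continuous hp) continuous_const
  refine lt_of_lt_of_le (hopen.measure_pos volume ⟨0, ?_⟩) (measure_mono fun x hx => (show lpNormE p x ≤ 1 from
    le_of_lt (show lpNormE p x < 1 from hx)))
  show lpNormE p 0 < 1
  rw [lpN_zero hp]; norm_num

lemma cone_apply (hp : 2 ≤ p) {A : Set (EuclideanSpace ℝ (Fin n))} (hA : MeasurableSet A) :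
    coneMeasureE p n A = (volume (Bal p n))⁻¹ * volume (prj p ⁻¹' A ∩ Bal p n) := by
  unfold coneMeasureE
  have h : Measurable (prj p : EuclideanSpace ℝ (Fin n) → _) := prj_meas hp
  rw [show (fun x : EuclideanSpace ℝ (Fin n) => (lpNormE p x)⁻¹ • x) = prj p from rfl,
    Measure.map_apply h hA, Measure.smul_apply, Measure.restrict_apply (h hA)]
  rfl

lemma cone_prob (hp : 2 ≤ p) : IsProbabilityMeasure (coneMeasureE p n) := by
  constructor
  rw [cone_apply hp MeasurableSet.univ]
  simp only [Set.preimage_univ, Set.univ_inter]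
  exact ENNReal.inv_mul_cancel (Bal_vol_pos hp).ne' (Bal_vol_lt hp).ne

lemma cone_mem_Sph [NeZero n] (hp : 2 ≤ p) : ∀ᵐ x ∂(coneMeasureE p n), x ∈ Sph p n := by
  rw [ae_iff]
  have : MeasurableSet {x | x ∉ Sph p n} := (Sph_meas hp).compl
  rw [cone_apply hp this]
  have : volume (prj p ⁻¹' {x | x ∉ Sph p n} ∩ Bal p n) = 0 := by
    refine measure_mono_null (t := {0}) ?_ (by simp)
    rintro x ⟨hx, -⟩
    by_contra h
    exact hx (prj_mem hp h)
  rw [this, mul_zero]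

lemma cone_scale (hp : 2 ≤ p) {A : Set (EuclideanSpace ℝ (Fin n))} (hA : MeasurableSet A)
    {t : ℝ} (ht : 0 < t) :
    volume (prj p ⁻¹' A ∩ {x | lpNormE p x ≤ t}) =
      ENNReal.ofReal (t ^ n) * volume (prj p ⁻¹' A ∩ Bal p n) := by
  have := Measure.addHaar_preimage_smul (volume : Measure (EuclideanSpace ℝ (Fin n)))
    (inv_ne_zero ht.ne') (prj p ⁻¹' A ∩ Bal p n)
  rw [finrank_euclideanSpace, Fintype.card_fin, inv_pow, inv_inv, abs_of_pos (by positivity)] at this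
  rw [← this]
  congr 1
  ext x
  simp only [Set.mem_inter_iff, Set.mem_preimage, Set.mem_ofPred_eq, Bal,
    prj_smul hp (inv_pos.2 ht), lpN_smul hp, abs_of_pos (inv_pos.2 ht), inv_mul_le_iff₀ ht, mul_one]

lemma polar_set [NeZero n] (hp : 2 ≤ p) {A : Set (EuclideanSpace ℝ (Fin n))} (hA : MeasurableSet A) :
    Measure.map (lpNormE p) (volume.restrict (prj p ⁻¹' A)) =
      coneMeasureE p n A • Measure.map (lpNormE p) (volume : Measure (EuclideanSpace ℝ (Fin n))) := by
  have hN : Measurable (lpNormE p : EuclideanSpace ℝ (Fin n) → ℝ) := (lpN_continuous hp).measurable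
  have hv0 := (Bal_vol_pos (n := n) hp).ne'
  have hvt := (Bal_vol_lt (n := n) hp).ne
  have hset : ∀ (t : ℝ) (A : Set (EuclideanSpace ℝ (Fin n))), MeasurableSet A →
      Measure.map (lpNormE p) (volume.restrict (prj p ⁻¹' A)) (Set.Iic t) =
      volume (prj p ⁻¹' A ∩ {x | lpNormE p x ≤ t}) := by
    intro t A hA
    rw [Measure.map_apply hN measurableSet_Iic, Measure.restrict_apply (hN measurableSet_Iic),
      Set.inter_comm]
    rfl
  have hle : ∀ t : ℝ, t ≤ 0 → ∀ A : Set (EuclideanSpace ℝ (Fin n)),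
      volume (prj p ⁻¹' A ∩ {x | lpNormE p x ≤ t}) = 0 := by
    intro t ht A
    refine measure_mono_null (t := {0}) ?_ (by simp)
    rintro x ⟨-, hx⟩
    have hx : lpNormE p x ≤ t := hx
    exact (lpN_eq_zero hp).1 (le_antisymm (hx.trans ht) (lpN_nonneg _))
  have huniv : (volume : Measure (EuclideanSpace ℝ (Fin n))) =
      volume.restrict (prj p ⁻¹' Set.univ) := by simp
  refine Measure.ext_of_generateFrom_of_iUnion (Set.range Set.Iic) (fun k : ℕ => Set.Iic (k : ℝ))
    (by rw [← borel_eq_generateFrom_Iic]; exact BorelSpace.measurable_eq) isPiSystem_Iic ?_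
    (fun k => ⟨_, rfl⟩) ?_ ?_
  · ext x; simp only [Set.mem_iUnion, Set.mem_Iic, Set.mem_univ, iff_true]; exact exists_nat_ge x
  · intro k
    rw [hset _ _ hA]
    rcases le_or_gt (k : ℝ) 0 with h | h
    · rw [hle _ h]; simp
    · rw [cone_scale hp hA h]
      exact (ENNReal.mul_lt_top ENNReal.ofReal_lt_top
        ((measure_mono Set.inter_subset_right).trans_lt (Bal_vol_lt hp))).ne
  · rintro _ ⟨t, rfl⟩
    rw [Measure.smul_apply]
    nth_rewrite 2 [huniv]
    rw [hset _ _ hA, hset _ _ MeasurableSet.univ, smul_eq_mul]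
    rcases le_or_gt t 0 with h | h
    · rw [hle _ h, hle _ h]; simp
    · rw [cone_scale hp hA h, cone_scale hp MeasurableSet.univ h, cone_apply hp hA]
      simp only [Set.preimage_univ, Set.univ_inter]
      calc _ = ENNReal.ofReal (t ^ n) * volume (prj p ⁻¹' A ∩ Bal p n) *
            ((volume (Bal p n))⁻¹ * volume (Bal p n)) := by
            rw [ENNReal.inv_mul_cancel hv0 hvt, mul_one]
        _ = _ := by ring

lemma radial_sfin (hp : 2 ≤ p) :
    SigmaFinite (Measure.map (lpNormE p) (volume : Measure (EuclideanSpace ℝ (Fin n)))) := by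
  have hN : Measurable (lpNormE p : EuclideanSpace ℝ (Fin n) → ℝ) := (lpN_continuous hp).measurable
  refine ⟨⟨⟨fun k => Set.Iic (k : ℝ), fun _ => trivial, fun k => ?_, ?_⟩⟩⟩
  · rw [Measure.map_apply hN measurableSet_Iic]
    refine (Bornology.IsBounded.measure_lt_top ?_)
    refine (Metric.isBounded_closedBall (x := 0) (r := n * k)).subset fun x hx => ?_
    have hx : lpNormE p x ≤ k := hx
    rw [mem_closedBall_zero_iff]
    refine (norm_le_lpN hp x).trans ?_
    gcongr
  · ext x; simp only [Set.mem_iUnion, Set.mem_Iic, Set.mem_univ, iff_true]; exact exists_nat_ge x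

theorem polar [NeZero n] (hp : 2 ≤ p) {g : ℝ → ENNReal} {φ : EuclideanSpace ℝ (Fin n) → ENNReal}
    (hg : Measurable g) (hφ : Measurable φ) :
    ∫⁻ x, g (lpNormE p x) * φ (prj p x) =
      (∫⁻ x : EuclideanSpace ℝ (Fin n), g (lpNormE p x)) * ∫⁻ x, φ x ∂(coneMeasureE p n) := by
  have hN : Measurable (lpNormE p : EuclideanSpace ℝ (Fin n) → ℝ) := (lpN_continuous hp).measurable
  have := radial_sfin (n := n) hp
  have := cone_prob (n := n) hp
  have hprod : (Measure.map (lpNormE p) (volume : Measure (EuclideanSpace ℝ (Fin n)))).prod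
      (coneMeasureE p n) = Measure.map (fun x => (lpNormE p x, prj p x)) volume := by
    refine Measure.prod_eq fun s t hs ht => ?_
    rw [Measure.map_apply (hN.prodMk (prj_meas hp)) (hs.prod ht)]
    have h1 := congrArg (fun m => m s) (polar_set hp ht)
    simp only [Measure.smul_apply, smul_eq_mul] at h1
    rw [mul_comm, ← h1, Measure.map_apply hN hs, Measure.restrict_apply (hN hs)]
    rfl
  rw [← lintegral_map hg hN, ← lintegral_prod_mul hg.aemeasurable hφ.aemeasurable, hprod,
    lintegral_map (by fun_prop) (hN.prodMk (prj_meas hp))]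

/-- polar decomposition for the Gibbs measure -/
theorem polar_gm [NeZero n] (hp : 2 ≤ p) {g : ℝ → ENNReal} {φ : EuclideanSpace ℝ (Fin n) → ENNReal}
    (hg : Measurable g) (hφ : Measurable φ) (ζ : ℝ) :
    ∫⁻ x, g (lpNormE p x) * φ (prj p x) ∂(gm p ζ n) =
      (∫⁻ x, g (lpNormE p x) ∂(gm p ζ n)) * ∫⁻ x, φ x ∂(coneMeasureE p n) := by
  have hN : Measurable (lpNormE p : EuclideanSpace ℝ (Fin n) → ℝ) := (lpN_continuous hp).measurable
  have hpi := prj_meas (n := n) hp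
  rw [gm_lintegral hp (by fun_prop), gm_lintegral hp (by fun_prop)]
  rw [← polar (g := fun t => g t * ENNReal.ofReal (Real.exp (-t ^ p - ζ))) hp (by fun_prop) hφ]
  refine lintegral_congr fun x => by ring

end polar

section sphere
variable {n : ℕ} {p : ℝ}

/-- `h` is a (uniform) upper gradient of `f` on the sphere. -/
def UG (p : ℝ) {n : ℕ} (f h : EuclideanSpace ℝ (Fin n) → ℝ) : Prop :=
  ∀ η > 0, ∃ δ > 0, ∀ x ∈ Sph p n, ∀ y ∈ Sph p n, lpNormE p (y - x) ≤ δ →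
    |f y - f x| ≤ (h x + η) * lpNormE p (y - x)

lemma prj_dist (hp : 2 ≤ p) {x z : EuclideanSpace ℝ (Fin n)} (hx : x ≠ 0) (hz : z ≠ 0) :
    lpNormE p z * lpNormE p (prj p x - prj p z) ≤ 2 * lpNormE p (x - z) := by
  have hx0 := lpN_pos hp hx
  have hz0 := lpN_pos hp hz
  have h1 : lpNormE p z * lpNormE p (prj p x - prj p z) =
      lpNormE p (lpNormE p z • (prj p x - prj p z)) := by
    rw [lpN_smul hp, abs_of_pos hz0]
  have h2 : lpNormE p z • (prj p x - prj p z) =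
      (x - z) + (lpNormE p z - lpNormE p x) • prj p x := by
    have e1 := smul_prj hp x
    have e2 := smul_prj hp z
    rw [smul_sub, sub_smul, e1, e2]; abel
  rw [h1, h2]
  refine (lpN_add_le hp _ _).trans ?_
  have h3 : lpNormE p (prj p x) = 1 := prj_mem hp hx
  rw [lpN_smul hp, h3, mul_one]
  have := lpN_abs_sub hp z x
  rw [lpN_sub_comm z x] at this
  linarith

lemma core_sphere [NeZero n] (hp : 2 ≤ p) {q : ℝ} (hpq : p.HolderConjugate q) {R : ℝ} (hR : p ≤ R)
    (f h : EuclideanSpace ℝ (Fin n) → ℝ) (hf : Measurable f) (hh : Measurable h) (C : ℝ)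
    (hf0 : ∀ x, 0 ≤ f x) (hh0 : ∀ x, 0 ≤ h x) (hfC : ∀ x, f x ≤ C) (hhC : ∀ x, h x ≤ C)
    (hug : UG p f h) :
    eLpNorm' (fun x => lpNormE p x * f (prj p x)) R (gm p (zet p n) n) ^ q ≤
      eLpNorm' (fun x => lpNormE p x * f (prj p x)) q (gm p (zet p n) n) ^ q +
      ENNReal.ofReal ((p - 1) * (R / (p * cpc p)) ^ (q - 1)) *
      eLpNorm' (fun x => f (prj p x) + 2 * h (prj p x)) R (gm p (zet p n) n) ^ q := by
  haveI : Fact (2 ≤ p) := ⟨hp⟩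
  have hp0 : 0 < p := by linarith
  have hq1 : 1 < q := hpq.symm.lt
  have hq0 : 0 < q := by linarith
  have hR0 : 0 < R := by linarith
  have hN : Measurable (lpNormE p : EuclideanSpace ℝ (Fin n) → ℝ) := (lpN_continuous hp).measurable
  have hpi := prj_meas (n := n) hp
  have hC0 : 0 ≤ C := (hf0 0).trans (hfC 0)
  obtain ⟨δ1, hδ1, hug1⟩ := hug 1 one_pos
  -- Lipschitz on the sphere
  set L0 := C + 1 + C / δ1 with hL0
  have hL00 : 0 ≤ L0 := by positivity
  have hlipS : ∀ x ∈ Sph p n, ∀ y ∈ Sph p n, f y - f x ≤ L0 * lpNormE p (y - x) := by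
    intro x hx y hy
    have hτ : 0 ≤ lpNormE p (y - x) := lpN_nonneg _
    by_cases hd : lpNormE p (y - x) ≤ δ1
    · have h1 := (le_abs_self _).trans (hug1 x hx y hy hd)
      have h2 := hhC x
      have h3 : 0 ≤ C / δ1 := by positivity
      refine h1.trans ?_
      gcongr
      linarith
    · push Not at hd
      have h1 : f y - f x ≤ C := by have := hfC y; have := hf0 x; linarith
      have h2 : C ≤ C / δ1 * lpNormE p (y - x) := by
        rw [div_mul_eq_mul_div, le_div_iff₀ hδ1]; gcongr
      nlinarith
  set G : EuclideanSpace ℝ (Fin n) → ℝ := fun x => lpNormE p x * f (prj p x) with hG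
  have hG0 : ∀ x, 0 ≤ G x := fun x => mul_nonneg (lpN_nonneg _) (hf0 _)
  have hGm : Measurable G := by fun_prop
  set L := C + 2 * L0 with hL
  have hL0' : 0 ≤ L := by positivity
  have hzero : ∀ x z : EuclideanSpace ℝ (Fin n), x = 0 → G x = 0 := by
    rintro x z rfl; simp [hG, lpN_zero hp]
  have hlip : ∀ x z, G x ≤ G z + L * lpNormE p (x - z) := by
    intro x z
    have hτ : 0 ≤ lpNormE p (x - z) := lpN_nonneg _
    by_cases hx : x = 0
    · rw [hzero x x hx]; have := hG0 z; positivity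
    by_cases hz : z = 0
    · rw [hzero z z hz, hz, sub_zero, zero_add]
      simp only [hG]
      rw [mul_comm]
      have := lpN_nonneg (p := p) x
      gcongr
      exact (hfC _).trans (by rw [hL]; linarith)
    have h1 := hlipS _ (prj_mem hp hz) _ (prj_mem hp hx)
    have h2 := prj_dist hp hx hz
    have h3 := (le_abs_self _).trans (lpN_abs_sub hp x z)
    have hz0 := lpN_nonneg (p := p) z
    have h4 : lpNormE p z * (f (prj p x) - f (prj p z)) ≤ 2 * L0 * lpNormE p (x - z) := by
      calc _ ≤ lpNormE p z * (L0 * lpNormE p (prj p x - prj p z)) := by gcongr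
        _ = L0 * (lpNormE p z * lpNormE p (prj p x - prj p z)) := by ring
        _ ≤ L0 * (2 * lpNormE p (x - z)) := by gcongr
        _ = _ := by ring
    have h5 : (lpNormE p x - lpNormE p z) * f (prj p x) ≤ C * lpNormE p (x - z) := by
      calc _ ≤ lpNormE p (x - z) * f (prj p x) := by gcongr; exact hf0 _
        _ ≤ lpNormE p (x - z) * C := by gcongr; exact hfC _
        _ = _ := by ring
    simp only [hG, hL]
    linarith
  set K0 := eLpNorm' (fun x => f (prj p x) + 2 * h (prj p x)) R (gm p (zet p n) n) with hK0
  -- the main inequality for each η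
  have main : ∀ η > 0, eLpNorm' G R (gm p (zet p n) n) ^ q ≤ eLpNorm' G q (gm p (zet p n) n) ^ q +
      ENNReal.ofReal ((p - 1) * (R / (p * cpc p)) ^ (q - 1)) *
      (K0 + (ENNReal.ofReal (3 * η) +
        ENNReal.ofReal L * (gm p (zet p n) n {x | lpNormE p x < η}) ^ (1 / R))) ^ q := by
    intro η hη
    obtain ⟨δ', hδ', hug'⟩ := hug η hη
    set ind : EuclideanSpace ℝ (Fin n) → ℝ :=
      {x : EuclideanSpace ℝ (Fin n) | lpNormE p x < η}.indicator (fun _ => L) with hind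
    have hmeas : MeasurableSet {x : EuclideanSpace ℝ (Fin n) | lpNormE p x < η} :=
      hN measurableSet_Iio
    have hindm : Measurable ind := measurable_const.indicator hmeas
    have hind0 : ∀ x, 0 ≤ ind x := fun x => Set.indicator_nonneg (fun _ _ => hL0') x
    set H : EuclideanSpace ℝ (Fin n) → ℝ := fun z => f (prj p z) + 2 * h (prj p z) + 2 * η + ind z
      with hH
    have hH0 : ∀ x, 0 ≤ H x := fun x => by
      have := hf0 (prj p x); have := hh0 (prj p x); have := hind0 x
      positivity
    have hHm : Measurable H := by fun_prop
    have hnear : ∀ x z, lpNormE p (x - z) ≤ η * δ' / 2 → G x ≤ G z + H z * lpNormE p (x - z) := by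
      intro x z hxz
      have hτ : 0 ≤ lpNormE p (x - z) := lpN_nonneg _
      by_cases hz : lpNormE p z < η
      · refine (hlip x z).trans ?_
        gcongr
        have : ind z = L := Set.indicator_of_mem (show z ∈ {x | lpNormE p x < η} from hz) _
        simp only [hH, this]
        have := hf0 (prj p z); have := hh0 (prj p z)
        linarith
      · push Not at hz
        have hz0 : z ≠ 0 := by
          rintro rfl; rw [lpN_zero hp] at hz; linarith
        by_cases hx : x = 0
        · rw [hzero x x hx]; have := hG0 z; have := hH0 z; positivity
        have h2 := prj_dist hp hx hz0
        have h2' := prj_dist hp hz0 hx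
        rw [lpN_sub_comm (prj p z), lpN_sub_comm z] at h2'
        have hd : lpNormE p (prj p x - prj p z) ≤ δ' := by
          have : η * lpNormE p (prj p x - prj p z) ≤ η * δ' := by
            calc _ ≤ lpNormE p z * lpNormE p (prj p x - prj p z) := by
                  gcongr; exact lpN_nonneg _
              _ ≤ 2 * lpNormE p (x - z) := h2
              _ ≤ _ := by linarith
          exact le_of_mul_le_mul_left this hη
        have h1 := (le_abs_self _).trans (hug' _ (prj_mem hp hz0) _ (prj_mem hp hx) hd)
        have h3 := (le_abs_self _).trans (lpN_abs_sub hp x z)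
        have hx0 := lpN_nonneg (p := p) x
        have hhz := hh0 (prj p z)
        have hfz := hf0 (prj p z)
        have h4 : lpNormE p x * (f (prj p x) - f (prj p z)) ≤
            2 * (h (prj p z) + η) * lpNormE p (x - z) := by
          calc _ ≤ lpNormE p x * ((h (prj p z) + η) * lpNormE p (prj p x - prj p z)) := by gcongr
            _ = (h (prj p z) + η) * (lpNormE p x * lpNormE p (prj p x - prj p z)) := by ring
            _ ≤ (h (prj p z) + η) * (2 * lpNormE p (x - z)) := by gcongr
            _ = _ := by ring
        have h5 : (lpNormE p x - lpNormE p z) * f (prj p z) ≤ lpNormE p (x - z) * f (prj p z) := by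
          gcongr
        have h6 : 0 ≤ ind z * lpNormE p (x - z) := mul_nonneg (hind0 z) hτ
        simp only [hG, hH]
        linarith
    have mm := moment_gm (ζ := zet p n) hp hpq hR (by positivity : 0 < η * δ' / 2) hη hL0' G H hGm hHm
      hG0 hH0 hnear hlip
    refine mm.trans ?_
    have hR1 : 1 ≤ R := by linarith
    have tri : eLpNorm' (fun x => H x + η) R (gm p (zet p n) n) ≤ K0 + (ENNReal.ofReal (3 * η) +
        ENNReal.ofReal L * (gm p (zet p n) n {x | lpNormE p x < η}) ^ (1 / R)) := by
      have e : (fun x => H x + η) = (fun x => f (prj p x) + 2 * h (prj p x)) +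
          ((fun _ => 3 * η) + ind) := by
        funext x; simp only [hH, Pi.add_apply]; ring
      rw [e]
      refine (eLpNorm'_add_le (by fun_prop) (by fun_prop) hR1).trans ?_
      gcongr
      refine (eLpNorm'_add_le (by fun_prop) (by fun_prop) hR1).trans ?_
      gcongr
      · rw [eLpNorm'_const _ hR0]; simp [abs_of_pos hη, Real.enorm_eq_ofReal_abs]
      · rw [eLpNorm', hind]
        have : ∀ x, ‖({x : EuclideanSpace ℝ (Fin n) | lpNormE p x < η}.indicator (fun _ => L)) x‖ₑ ^ R =
            {x : EuclideanSpace ℝ (Fin n) | lpNormE p x < η}.indicator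
              (fun _ => ENNReal.ofReal L ^ R) x := by
          intro x
          by_cases hx : x ∈ {x : EuclideanSpace ℝ (Fin n) | lpNormE p x < η}
          · rw [Set.indicator_of_mem hx, Set.indicator_of_mem hx, Real.enorm_of_nonneg hL0']
          · rw [Set.indicator_of_notMem hx, Set.indicator_of_notMem hx]; simp [hR0]
        simp_rw [this]
        rw [lintegral_indicator hmeas, setLIntegral_const, ENNReal.mul_rpow_of_nonneg _ _ (by positivity),
          ← ENNReal.rpow_mul, mul_one_div_cancel hR0.ne', ENNReal.rpow_one]
    gcongr
  have limP : Filter.Tendsto (fun k : ℕ => gm p (zet p n) n {x | lpNormE p x < 1 / ((k : ℝ) + 1)})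
      Filter.atTop (nhds 0) := by
    have := tendsto_measure_iInter_atTop (μ := gm p (zet p n) n)
      (s := fun k : ℕ => {x : EuclideanSpace ℝ (Fin n) | lpNormE p x < 1 / ((k : ℝ) + 1)})
      (fun k => (hN measurableSet_Iio).nullMeasurableSet) (by
        intro j k hjk x hx
        have hx : lpNormE p x < 1 / ((k : ℝ) + 1) := hx
        have : 1 / ((k : ℝ) + 1) ≤ 1 / ((j : ℝ) + 1) := by gcongr
        exact (show lpNormE p x < 1 / ((j : ℝ) + 1) from lt_of_lt_of_le hx this))
      ⟨0, measure_ne_top _ _⟩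
    have e : gm p (zet p n) n (⋂ k : ℕ, {x : EuclideanSpace ℝ (Fin n) | lpNormE p x < 1 / ((k : ℝ) + 1)}) = 0 := by
      refine measure_mono_null (t := {0}) ?_ ?_
      · intro x hx
        rw [Set.mem_iInter] at hx
        have hx : ∀ k : ℕ, lpNormE p x < 1 / ((k : ℝ) + 1) := hx
        refine (lpN_eq_zero hp).1 (le_antisymm ?_ (lpN_nonneg _))
        exact ge_of_tendsto' tendsto_one_div_add_atTop_nhds_zero_nat fun k => (hx k).le
      · exact (withDensity_absolutelyContinuous _ _) (by simp)
    rw [e] at this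
    exact this
  have limη : Filter.Tendsto (fun k : ℕ => ENNReal.ofReal (3 * (1 / ((k : ℝ) + 1)))) Filter.atTop
      (nhds 0) := by
    have := ENNReal.tendsto_ofReal ((tendsto_one_div_add_atTop_nhds_zero_nat (𝕜 := ℝ)).const_mul 3)
    simpa using this
  have limP2 := ENNReal.Tendsto.const_mul (a := ENNReal.ofReal L) (limP.ennrpow_const (1 / R))
    (Or.inr ENNReal.ofReal_ne_top)
  rw [ENNReal.zero_rpow_of_pos (by positivity), mul_zero] at limP2
  have limK := ((limη.add limP2).const_add K0).ennrpow_const q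
  have lim := (ENNReal.Tendsto.const_mul (a := ENNReal.ofReal ((p - 1) * (R / (p * cpc p)) ^ (q - 1)))
    limK (Or.inr ENNReal.ofReal_ne_top)).const_add (eLpNorm' G q (gm p (zet p n) n) ^ q)
  rw [add_zero, add_zero] at lim
  exact ge_of_tendsto' lim fun k => main _ (by positivity)

end sphere

section sphere2
variable {n : ℕ} {p : ℝ}

noncomputable def Bc (p : ℝ) (n : ℕ) (R : ℝ) : ℝ := ((p - 1) ^ (p - 1) * (R / (n * cpc p))) ^ (1 / p)

lemma gm_to_cone [NeZero n] (hp : 2 ≤ p) {R : ℝ} (hR : 0 < R) (f : EuclideanSpace ℝ (Fin n) → ℝ)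
    (hf : Measurable f) :
    eLpNorm' (fun x => f (prj p x)) R (gm p (zet p n) n) = eLpNorm' f R (coneMeasureE p n) := by
  have : Fact (2 ≤ p) := ⟨hp⟩
  have := polar_gm (n := n) hp (g := fun _ => 1) (φ := fun x => ‖f x‖ₑ ^ R) measurable_const
    (by fun_prop) (zet p n)
  simp only [one_mul, lintegral_one, measure_univ] at this
  rw [eLpNorm', eLpNorm', this]

lemma gm_to_cone_N [NeZero n] (hp : 2 ≤ p) {R : ℝ} (hR : 0 < R) (f : EuclideanSpace ℝ (Fin n) → ℝ)
    (hf : Measurable f) :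
    eLpNorm' (fun x => lpNormE p x * f (prj p x)) R (gm p (zet p n) n) =
      eLpNorm' (lpNormE p) R (gm p (zet p n) n) * eLpNorm' f R (coneMeasureE p n) := by
  have := polar_gm (n := n) hp (g := fun t => ‖t‖ₑ ^ R) (φ := fun x => ‖f x‖ₑ ^ R) (by fun_prop)
    (by fun_prop) (zet p n)
  rw [eLpNorm', eLpNorm', eLpNorm', ← ENNReal.mul_rpow_of_nonneg _ _ (by positivity), ← this]
  simp_rw [enorm_mul, ENNReal.mul_rpow_of_nonneg _ _ hR.le]

lemma sphere_bdd [NeZero n] (hp : 2 ≤ p) {q : ℝ} (hpq : p.HolderConjugate q) {R : ℝ} (hR : p ≤ R)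
    (f h : EuclideanSpace ℝ (Fin n) → ℝ) (hf : Measurable f) (hh : Measurable h) (C : ℝ)
    (hf0 : ∀ x, 0 ≤ f x) (hh0 : ∀ x, 0 ≤ h x) (hfC : ∀ x, f x ≤ C) (hhC : ∀ x, h x ≤ C)
    (hug : UG p f h) :
    eLpNorm' f R (coneMeasureE p n) ^ q ≤ eLpNorm' f q (coneMeasureE p n) ^ q +
      ENNReal.ofReal (Bc p n R) ^ q *
        eLpNorm' (fun x => f x + 2 * h x) R (coneMeasureE p n) ^ q := by
  have : Fact (2 ≤ p) := ⟨hp⟩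
  have hp0 : 0 < p := by linarith
  have hp1 : 0 < p - 1 := by linarith
  have hq1 : 1 < q := hpq.symm.lt
  have hq0 : 0 < q := by linarith
  have hR0 : 0 < R := by linarith
  have hc := cpc_pos hp
  have hpq1 : (p - 1) * (q - 1) = 1 := by
    have := hpq.mul_eq_add; linarith
  have hq2 : q ≤ p := by nlinarith
  have hn0 : (0 : ℝ) < n := by exact_mod_cast Nat.pos_of_ne_zero (NeZero.ne n)
  have hN : Measurable (lpNormE p : EuclideanSpace ℝ (Fin n) → ℝ) := (lpN_continuous hp).measurable
  have key := core_sphere hp hpq hR f h hf hh C hf0 hh0 hfC hhC hug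
  rw [gm_to_cone_N hp hR0 f hf, gm_to_cone_N hp hq0 f hf,
    gm_to_cone hp hR0 (fun x => f x + 2 * h x) (by fun_prop),
    ENNReal.mul_rpow_of_nonneg _ _ hq0.le, ENNReal.mul_rpow_of_nonneg _ _ hq0.le] at key
  set e := eLpNorm' (lpNormE p) R (gm p (zet p n) n) with he
  have hNn : ∀ x : EuclideanSpace ℝ (Fin n), ∀ a : ℝ, 0 ≤ a → ‖lpNormE p x‖ₑ ^ a =
      ENNReal.ofReal (lpNormE p x ^ a) := by
    intro x a ha
    rw [Real.enorm_of_nonneg (lpN_nonneg _), ENNReal.ofReal_rpow_of_nonneg (lpN_nonneg _) ha]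
  have heq : eLpNorm' (lpNormE p) q (gm p (zet p n) n) ≤ e :=
    eLpNorm'_le_eLpNorm'_of_exponent_le hq0 (hq2.trans hR) _ hN.aestronglyMeasurable
  have hep : ENNReal.ofReal ((n / p) ^ (1 / p)) ≤ e := by
    have h1 : eLpNorm' (lpNormE p) p (gm p (zet p n) n) ≤ e :=
      eLpNorm'_le_eLpNorm'_of_exponent_le hp0 hR _ hN.aestronglyMeasurable
    refine le_trans (le_of_eq ?_) h1
    rw [eLpNorm']
    simp_rw [hNn _ p hp0.le]
    rw [gm_Np hp, ENNReal.ofReal_rpow_of_nonneg (by positivity) (by positivity)]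
  have het : e ≠ ⊤ := by
    rw [he, eLpNorm']
    simp_rw [hNn _ R hR0.le]
    exact ENNReal.rpow_ne_top_of_nonneg (by positivity) (gm_NR_lt_top hp hR).ne
  have he0 : e ≠ 0 := by
    refine (lt_of_lt_of_le ?_ hep).ne'
    simp only [ENNReal.ofReal_pos]; positivity
  have heq0 : e ^ q ≠ 0 := by simp [ENNReal.rpow_eq_zero_iff, he0, het]
  have heqt : e ^ q ≠ ⊤ := ENNReal.rpow_ne_top_of_nonneg hq0.le het
  rw [← ENNReal.mul_le_mul_iff_right heq0 heqt, mul_add]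
  refine key.trans ?_
  gcongr ?_ * _ + ?_
  · gcongr
  rw [← mul_assoc]
  gcongr
  have hD : (p - 1) * (R / (p * cpc p)) ^ (q - 1) = ((n / p) ^ (1 / p)) ^ q * Bc p n R ^ q := by
    have e1 : 1 / p * q = q - 1 := by
      have := hpq.mul_eq_add; field_simp; linarith
    unfold Bc
    rw [← Real.rpow_mul (by positivity), ← Real.rpow_mul (by positivity), e1,
      ← Real.mul_rpow (by positivity) (by positivity)]
    have e2 : (n : ℝ) / p * ((p - 1) ^ (p - 1) * (R / (n * cpc p))) =
        (p - 1) ^ (p - 1) * (R / (p * cpc p)) := by field_simp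
    rw [e2, Real.mul_rpow (by positivity) (by positivity), ← Real.rpow_mul hp1.le, hpq1, Real.rpow_one]
  have hB0 : 0 ≤ Bc p n R := by unfold Bc; positivity
  rw [hD, ENNReal.ofReal_mul (by positivity), ← ENNReal.ofReal_rpow_of_nonneg (by positivity) hq0.le,
    ← ENNReal.ofReal_rpow_of_nonneg hB0 hq0.le]
  gcongr

lemma Sph_nonempty [NeZero n] (hp : 2 ≤ p) : (Sph p n).Nonempty := by
  refine ⟨prj p (EuclideanSpace.single 0 1), prj_mem hp ?_⟩
  intro h
  have := congrArg (fun x : EuclideanSpace ℝ (Fin n) => x 0) h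
  simp at this

lemma ind_meas (hp : 2 ≤ p) {f : EuclideanSpace ℝ (Fin n) → ℝ} (hf : ContinuousOn f (Sph p n)) :
    Measurable ((Sph p n).indicator f) := by
  classical
  rw [← Set.piecewise_eq_indicator]
  exact hf.measurable_piecewise continuousOn_const (Sph_meas hp)

lemma ind_ae [NeZero n] (hp : 2 ≤ p) (f : EuclideanSpace ℝ (Fin n) → ℝ) :
    f =ᵐ[coneMeasureE p n] (Sph p n).indicator f := by
  filter_upwards [cone_mem_Sph hp] with x hx
  rw [Set.indicator_of_mem hx]

theorem sphere_moment [NeZero n] (hp : 2 ≤ p) {q : ℝ} (hpq : p.HolderConjugate q) {R : ℝ} (hR : p ≤ R)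
    (f h : EuclideanSpace ℝ (Fin n) → ℝ) (hf : ContinuousOn f (Sph p n))
    (hh : ContinuousOn h (Sph p n))
    (hf0 : ∀ x ∈ Sph p n, 0 ≤ f x) (hh0 : ∀ x ∈ Sph p n, 0 ≤ h x)
    (hug : UG p f h) :
    eLpNorm' f R (coneMeasureE p n) ^ q ≤ eLpNorm' f q (coneMeasureE p n) ^ q +
      ENNReal.ofReal (Bc p n R) ^ q *
        eLpNorm' (fun x => f x + 2 * h x) R (coneMeasureE p n) ^ q := by
  obtain ⟨C1, hC1⟩ := (Sph_compact (n := n) hp).bddAbove_image hf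
  obtain ⟨C2, hC2⟩ := (Sph_compact (n := n) hp).bddAbove_image hh
  set f' := (Sph p n).indicator f
  set h' := (Sph p n).indicator h
  have hf' : ∀ x ∈ Sph p n, f' x = f x := fun x hx => Set.indicator_of_mem hx f
  have hh' : ∀ x ∈ Sph p n, h' x = h x := fun x hx => Set.indicator_of_mem hx h
  obtain ⟨x0, hx0⟩ := Sph_nonempty (n := n) hp
  have hC10 : 0 ≤ C1 := (hf0 x0 hx0).trans (hC1 ⟨x0, hx0, rfl⟩)
  have hC20 : 0 ≤ C2 := (hh0 x0 hx0).trans (hC2 ⟨x0, hx0, rfl⟩)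
  have key := sphere_bdd (n := n) hp hpq hR f' h' (ind_meas hp hf) (ind_meas hp hh) (max C1 C2)
    (fun x => Set.indicator_apply_nonneg (hf0 x)) (fun x => Set.indicator_apply_nonneg (hh0 x))
    (fun x => by
      by_cases hx : x ∈ Sph p n
      · rw [hf' x hx]; exact (hC1 ⟨x, hx, rfl⟩).trans (le_max_left _ _)
      · rw [show f' x = 0 from Set.indicator_of_notMem hx f]; exact hC10.trans (le_max_left _ _))
    (fun x => by
      by_cases hx : x ∈ Sph p n
      · rw [hh' x hx]; exact (hC2 ⟨x, hx, rfl⟩).trans (le_max_right _ _)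
      · rw [show h' x = 0 from Set.indicator_of_notMem hx h]; exact hC10.trans (le_max_left _ _))
    (by
      intro η hη
      obtain ⟨δ, hδ, H⟩ := hug η hη
      refine ⟨δ, hδ, fun x hx y hy hxy => ?_⟩
      rw [hf' x hx, hf' y hy, hh' x hx]; exact H x hx y hy hxy)
  have a1 := ind_ae hp f
  have a2 := ind_ae hp h
  rw [eLpNorm'_congr_ae a1, eLpNorm'_congr_ae (q := q) a1,
    eLpNorm'_congr_ae (q := R) (f := fun x => f x + 2 * h x) (g := fun x => f' x + 2 * h' x) (by
      filter_upwards [a1, a2] with x h1 h2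
      rw [h1, h2])]
  exact key

end sphere2

section realnorm
variable {n : ℕ} {p : ℝ}

/-- real-valued `L^r` norm with respect to the cone measure -/
noncomputable def LN (p : ℝ) (n : ℕ) (r : ℝ) (f : EuclideanSpace ℝ (Fin n) → ℝ) : ℝ :=
  (eLpNorm' f r (coneMeasureE p n)).toReal

lemma LN_nonneg (r : ℝ) (f : EuclideanSpace ℝ (Fin n) → ℝ) : 0 ≤ LN p n r f := ENNReal.toReal_nonneg

lemma cont_aesm [NeZero n] (hp : 2 ≤ p) {f : EuclideanSpace ℝ (Fin n) → ℝ}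
    (hf : ContinuousOn f (Sph p n)) : AEStronglyMeasurable f (coneMeasureE p n) :=
  (ind_meas hp hf).aestronglyMeasurable.congr (ind_ae hp f).symm

lemma cont_bdd (hp : 2 ≤ p) {f : EuclideanSpace ℝ (Fin n) → ℝ}
    (hf : ContinuousOn f (Sph p n)) : ∃ C, 0 ≤ C ∧ ∀ x ∈ Sph p n, |f x| ≤ C := by
  obtain ⟨C, hC⟩ := (Sph_compact (n := n) hp).bddAbove_image hf.abs
  exact ⟨max C 0, le_max_right _ _, fun x hx => (hC ⟨x, hx, rfl⟩).trans (le_max_left _ _)⟩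

lemma eLp_le_const [NeZero n] (hp : 2 ≤ p) {r : ℝ} (hr : 0 < r) {f : EuclideanSpace ℝ (Fin n) → ℝ} {C : ℝ}
    (hC0 : 0 ≤ C) (hC : ∀ x ∈ Sph p n, |f x| ≤ C) :
    eLpNorm' f r (coneMeasureE p n) ≤ ENNReal.ofReal C := by
  have := cone_prob (n := n) hp
  have h1 : eLpNorm' f r (coneMeasureE p n) ≤ eLpNorm' (fun _ => C) r (coneMeasureE p n) := by
    apply eLpNorm'_mono_ae hr.le
    filter_upwards [cone_mem_Sph hp] with x hx
    rw [Real.norm_eq_abs, Real.norm_eq_abs, abs_of_nonneg hC0]; exact hC x hx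
  rw [eLpNorm'_const _ hr, measure_univ, ENNReal.one_rpow, mul_one, Real.enorm_of_nonneg hC0] at h1
  exact h1

lemma eLp_ne_top [NeZero n] (hp : 2 ≤ p) {r : ℝ} (hr : 0 < r) {f : EuclideanSpace ℝ (Fin n) → ℝ}
    (hf : ContinuousOn f (Sph p n)) : eLpNorm' f r (coneMeasureE p n) ≠ ⊤ := by
  obtain ⟨C, hC0, hC⟩ := cont_bdd hp hf
  exact ne_top_of_le_ne_top ENNReal.ofReal_ne_top (eLp_le_const hp hr hC0 hC)

lemma LN_le_const [NeZero n] (hp : 2 ≤ p) {r : ℝ} (hr : 0 < r) {f : EuclideanSpace ℝ (Fin n) → ℝ} {C : ℝ}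
    (hC0 : 0 ≤ C) (hC : ∀ x ∈ Sph p n, |f x| ≤ C) : LN p n r f ≤ C :=
  ENNReal.toReal_le_of_le_ofReal hC0 (eLp_le_const hp hr hC0 hC)

lemma LN_mono [NeZero n] (hp : 2 ≤ p) {r : ℝ} (hr : 0 < r) {f g : EuclideanSpace ℝ (Fin n) → ℝ}
    (hg : ContinuousOn g (Sph p n)) (h : ∀ x ∈ Sph p n, |f x| ≤ |g x|) : LN p n r f ≤ LN p n r g := by
  apply ENNReal.toReal_mono (eLp_ne_top hp hr hg)
  apply eLpNorm'_mono_ae hr.le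
  filter_upwards [cone_mem_Sph hp] with x hx using h x hx

lemma LN_add_le [NeZero n] (hp : 2 ≤ p) {r : ℝ} (hr : 1 ≤ r) {f g : EuclideanSpace ℝ (Fin n) → ℝ}
    (hf : ContinuousOn f (Sph p n)) (hg : ContinuousOn g (Sph p n)) :
    LN p n r (fun x => f x + g x) ≤ LN p n r f + LN p n r g := by
  have hr0 : 0 < r := by linarith
  rw [LN, LN, LN, ← ENNReal.toReal_add (eLp_ne_top hp hr0 hf) (eLp_ne_top hp hr0 hg)]
  refine ENNReal.toReal_mono (ENNReal.add_ne_top.2 ⟨eLp_ne_top hp hr0 hf, eLp_ne_top hp hr0 hg⟩) ?_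
  exact eLpNorm'_add_le (cont_aesm hp hf) (cont_aesm hp hg) hr

lemma LN_const_mul [NeZero n] (hp : 2 ≤ p) {r : ℝ} (hr : 0 < r) (c : ℝ) (f : EuclideanSpace ℝ (Fin n) → ℝ) :
    LN p n r (fun x => c * f x) = |c| * LN p n r f := by
  have := eLpNorm'_const_smul (f := f) (μ := coneMeasureE p n) c hr
  rw [LN, LN, show (fun x => c * f x) = c • f from rfl, this, ENNReal.toReal_mul]; simp

lemma LN_exp_mono [NeZero n] (hp : 2 ≤ p) {r s : ℝ} (hr : 0 < r) (hrs : r ≤ s)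
    {f : EuclideanSpace ℝ (Fin n) → ℝ} (hf : ContinuousOn f (Sph p n)) : LN p n r f ≤ LN p n s f := by
  have := cone_prob (n := n) hp
  exact ENNReal.toReal_mono (eLp_ne_top hp (hr.trans_le hrs) hf)
    (eLpNorm'_le_eLpNorm'_of_exponent_le hr hrs _ (cont_aesm hp hf))

lemma LN_rpow [NeZero n] (hp : 2 ≤ p) {r : ℝ} (hr : 0 < r) (f : EuclideanSpace ℝ (Fin n) → ℝ) :
    LN p n r f ^ r = (∫⁻ x, ENNReal.ofReal (|f x| ^ r) ∂(coneMeasureE p n)).toReal := by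
  rw [LN, ENNReal.toReal_rpow, ← lintegral_rpow_enorm_eq_rpow_eLpNorm' hr]
  congr 2; ext x
  rw [← ENNReal.ofReal_rpow_of_nonneg (abs_nonneg _) hr.le, ← Real.enorm_eq_ofReal_abs]

lemma cont_integrable [NeZero n] (hp : 2 ≤ p) {f : EuclideanSpace ℝ (Fin n) → ℝ}
    (hf : ContinuousOn f (Sph p n)) : Integrable f (coneMeasureE p n) := by
  have := cone_prob (n := n) hp
  obtain ⟨C, hC0, hC⟩ := cont_bdd hp hf
  refine Integrable.of_bound (cont_aesm hp hf) C ?_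
  filter_upwards [cone_mem_Sph hp] with x hx using hC x hx

lemma LN_eq_integral [NeZero n] (hp : 2 ≤ p) {r : ℝ} (hr : 0 < r) {f : EuclideanSpace ℝ (Fin n) → ℝ}
    (hf : ContinuousOn f (Sph p n)) :
    LN p n r f = (∫ x, |f x| ^ r ∂(coneMeasureE p n)) ^ (1 / r) := by
  rw [integral_eq_lintegral_of_nonneg_ae (Filter.Eventually.of_forall fun x => by positivity)
    (cont_aesm hp (hf.abs.rpow_const (fun _ _ => Or.inr hr.le))), ← LN_rpow hp hr, ← Real.rpow_mul (LN_nonneg _ _),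
    mul_one_div_cancel hr.ne', Real.rpow_one]

lemma sphere_moment_real [NeZero n] (hp : 2 ≤ p) {q : ℝ} (hpq : p.HolderConjugate q) {R : ℝ} (hR : p ≤ R)
    (f h : EuclideanSpace ℝ (Fin n) → ℝ) (hf : ContinuousOn f (Sph p n))
    (hh : ContinuousOn h (Sph p n))
    (hf0 : ∀ x ∈ Sph p n, 0 ≤ f x) (hh0 : ∀ x ∈ Sph p n, 0 ≤ h x) (hug : UG p f h) :
    LN p n R f ^ q ≤ LN p n q f ^ q + (Bc p n R * (LN p n R f + 2 * LN p n R h)) ^ q := by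
  have hq1 : 1 < q := hpq.symm.lt
  have hq0 : 0 < q := by linarith
  have hR0 : 0 < R := by linarith
  have hB : 0 ≤ Bc p n R := by
    have := cpc_pos hp
    have : 0 < p - 1 := by linarith
    unfold Bc; positivity
  have hfh : ContinuousOn (fun x => f x + 2 * h x) (Sph p n) := by fun_prop
  have key := ENNReal.toReal_mono ?_ (sphere_moment (n := n) hp hpq hR f h hf hh hf0 hh0 hug)
  · rw [ENNReal.toReal_add, ENNReal.toReal_mul, ← ENNReal.toReal_rpow, ← ENNReal.toReal_rpow,
      ← ENNReal.toReal_rpow, ← ENNReal.toReal_rpow, ENNReal.toReal_ofReal hB,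
      ← Real.mul_rpow hB ENNReal.toReal_nonneg] at key
    · refine key.trans ?_
      have h1 := LN_add_le hp (by linarith : 1 ≤ R) hf (g := fun x => 2 * h x) (by fun_prop)
      rw [LN_const_mul hp hR0, abs_of_nonneg (by norm_num : (0:ℝ) ≤ 2)] at h1
      gcongr
      · exact le_rfl
      · exact h1
    · exact ENNReal.rpow_ne_top_of_nonneg hq0.le (eLp_ne_top hp hq0 hf)
    · exact ENNReal.mul_ne_top (ENNReal.rpow_ne_top_of_nonneg hq0.le ENNReal.ofReal_ne_top)
        (ENNReal.rpow_ne_top_of_nonneg hq0.le (eLp_ne_top hp hR0 hfh))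
  · exact ENNReal.add_ne_top.2 ⟨ENNReal.rpow_ne_top_of_nonneg hq0.le (eLp_ne_top hp hq0 hf),
      ENNReal.mul_ne_top (ENNReal.rpow_ne_top_of_nonneg hq0.le ENNReal.ofReal_ne_top)
        (ENNReal.rpow_ne_top_of_nonneg hq0.le (eLp_ne_top hp hR0 hfh))⟩

lemma Bc_nonneg (hp : 2 ≤ p) {R : ℝ} (hR : 0 ≤ R) : 0 ≤ Bc p n R := by
  have := cpc_pos hp
  have : 0 < p - 1 := by linarith
  unfold Bc; positivity

/-- linear form of the moment recursion -/
lemma moment_lin [NeZero n] (hp : 2 ≤ p) {q : ℝ} (hpq : p.HolderConjugate q) {R : ℝ} (hR : p ≤ R)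
    (f h : EuclideanSpace ℝ (Fin n) → ℝ) (hf : ContinuousOn f (Sph p n))
    (hh : ContinuousOn h (Sph p n))
    (hf0 : ∀ x ∈ Sph p n, 0 ≤ f x) (hh0 : ∀ x ∈ Sph p n, 0 ≤ h x) (hug : UG p f h) :
    LN p n R f ≤ LN p n q f + Bc p n R * (LN p n R f + 2 * LN p n R h) := by
  have hq1 : 1 < q := hpq.symm.lt
  have hq0 : 0 < q := by linarith
  have key := sphere_moment_real hp hpq hR f h hf hh hf0 hh0 hug
  have h0 := LN_nonneg (p := p) R f
  have h1 := LN_nonneg (p := p) q f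
  have h2 := LN_nonneg (p := p) R h
  have h3 : 0 ≤ Bc p n R := Bc_nonneg hp (by linarith)
  have h4 : 0 ≤ Bc p n R * (LN p n R f + 2 * LN p n R h) := by positivity
  have := Real.add_rpow_le_rpow_add h1 h4 hq1.le
  exact (Real.rpow_le_rpow_iff h0 (by positivity) hq0).1 (key.trans this)

end realnorm

section median
variable {n : ℕ} {p : ℝ}

lemma exists_median {Ω : Type*} [MeasurableSpace Ω] (μ : Measure Ω) [IsProbabilityMeasure μ]
    (f : Ω → ℝ) (hf : AEMeasurable f μ) (C : ℝ) (hC : ∀ᵐ x ∂μ, |f x| ≤ C) :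
    ∃ m, μ {x | m < f x} ≤ 1 / 2 ∧ μ {x | f x < m} ≤ 1 / 2 := by
  set A : Set ℝ := {a | μ {x | a < f x} ≤ 1 / 2} with hA
  have hCA : C ∈ A := by
    have : μ {x | C < f x} = 0 := by
      rw [measure_eq_zero_iff_ae_notMem]
      filter_upwards [hC] with x hx h
      have h : C < f x := h
      linarith [le_abs_self (f x)]
    show μ {x | C < f x} ≤ 1 / 2
    rw [this]; exact bot_le
  have hbdd : BddBelow A := by
    refine ⟨-C - 1, fun a ha => ?_⟩
    by_contra hlt
    push Not at hlt
    have h1 : 1 ≤ μ {x | a < f x} := by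
      have h0 : μ {x | a < f x}ᶜ = 0 := by
        rw [measure_eq_zero_iff_ae_notMem]
        filter_upwards [hC] with x hx h
        have h : ¬ a < f x := h
        linarith [neg_abs_le (f x)]
      calc 1 = μ ({x | a < f x} ∪ {x | a < f x}ᶜ) := by rw [Set.union_compl_self, measure_univ]
        _ ≤ _ := measure_union_le _ _
        _ = _ := by rw [h0, add_zero]
    have ha : μ {x | a < f x} ≤ 1 / 2 := ha
    have := h1.trans ha
    norm_num at this
  refine ⟨sInf A, ?_, ?_⟩
  · have hU : {x | sInf A < f x} = ⋃ k : ℕ, {x | sInf A + 1 / ((k : ℝ) + 1) < f x} := by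
      ext x
      simp only [Set.mem_iUnion, Set.mem_ofPred_eq]
      constructor
      · intro h
        obtain ⟨k, hk⟩ := exists_nat_one_div_lt (sub_pos.2 h)
        exact ⟨k, by linarith⟩
      · rintro ⟨k, hk⟩
        have : (0 : ℝ) < 1 / ((k : ℝ) + 1) := by positivity
        linarith
    rw [hU, Monotone.measure_iUnion]
    · refine iSup_le fun k => ?_
      have hpos : (0 : ℝ) < 1 / ((k : ℝ) + 1) := by positivity
      obtain ⟨a, ha, hlt⟩ := exists_lt_of_csInf_lt ⟨C, hCA⟩ (lt_add_of_pos_right (sInf A) hpos)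
      have ha : μ {x | a < f x} ≤ 1 / 2 := ha
      exact (measure_mono (fun x (hx : _ < f x) => (hlt.trans hx : a < f x))).trans ha
    · intro k l hkl x hx
      have hx : sInf A + 1 / ((k : ℝ) + 1) < f x := hx
      show sInf A + 1 / ((l : ℝ) + 1) < f x
      have : 1 / ((l : ℝ) + 1) ≤ 1 / ((k : ℝ) + 1) := Nat.one_div_le_one_div hkl
      linarith
  · have hU : {x | f x < sInf A} = ⋃ k : ℕ, {x | f x ≤ sInf A - 1 / ((k : ℝ) + 1)} := by
      ext x
      simp only [Set.mem_iUnion, Set.mem_ofPred_eq]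
      constructor
      · intro h
        obtain ⟨k, hk⟩ := exists_nat_one_div_lt (sub_pos.2 h)
        exact ⟨k, by linarith⟩
      · rintro ⟨k, hk⟩
        have : (0 : ℝ) < 1 / ((k : ℝ) + 1) := by positivity
        linarith
    rw [hU, Monotone.measure_iUnion]
    · refine iSup_le fun k => ?_
      have hpos : (0 : ℝ) < 1 / ((k : ℝ) + 1) := by positivity
      have hnot : sInf A - 1 / ((k : ℝ) + 1) ∉ A := fun h => by
        have := csInf_le hbdd h
        linarith
      have hnot : 1 / 2 ≤ μ {x | sInf A - 1 / ((k : ℝ) + 1) < f x} := by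
        by_contra hh
        exact hnot (not_le.1 hh).le
      have hc : {x | f x ≤ sInf A - 1 / ((k : ℝ) + 1)} = {x | sInf A - 1 / ((k : ℝ) + 1) < f x}ᶜ := by
        ext x; simp
      rw [hc, prob_compl_eq_one_sub₀ (nullMeasurableSet_lt aemeasurable_const hf)]
      refine (tsub_le_tsub_left hnot 1).trans (le_of_eq ?_)
      rw [one_div, ENNReal.one_sub_inv_two]
    · intro k l hkl x hx
      have hx : f x ≤ sInf A - 1 / ((k : ℝ) + 1) := hx
      show f x ≤ sInf A - 1 / ((l : ℝ) + 1)
      have : 1 / ((l : ℝ) + 1) ≤ 1 / ((k : ℝ) + 1) := Nat.one_div_le_one_div hkl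
      linarith

lemma scal_half {q R p : ℝ} (hp : 2 ≤ p) (hpq : p.HolderConjugate q) (hR : 2 * p ≤ R) :
    (2 : ℝ) ^ (-q) ≤ 1 - (1 / 2 : ℝ) ^ (1 - q / R) := by
  have hq1 : 1 < q := hpq.symm.lt
  have hmul := hpq.mul_eq_add
  have hp0 : 0 < p := by linarith
  have hq2 : q ≤ 2 := by nlinarith
  have h1 : q / R ≤ (q - 1) / 2 := by
    rw [div_le_div_iff₀ (by linarith) (by norm_num)]
    nlinarith
  set u : ℝ := 2 ^ ((3 - q) / 2) with hu
  have hu0 : 0 < u := by positivity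
  have hu2 : u ≤ 2 := by
    calc u ≤ 2 ^ (1 : ℝ) := Real.rpow_le_rpow_of_exponent_le (by norm_num) (by linarith)
      _ = 2 := by simp
  have husq : u ^ 2 = 2 ^ (3 - q) := by
    rw [hu, ← Real.rpow_natCast, ← Real.rpow_mul (by norm_num)]; congr 1; push_cast; ring
  have husq2 : 2 ≤ u ^ 2 := by
    rw [husq]
    calc (2:ℝ) = 2 ^ (1 : ℝ) := by simp
      _ ≤ _ := Real.rpow_le_rpow_of_exponent_le (by norm_num) (by linarith)
  have h2 : (2 : ℝ) ^ (-q) = u ^ 2 / 8 := by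
    rw [husq, show (3 - q) = -q + 3 by ring, Real.rpow_add (by norm_num)]; norm_num
  have h3 : (1 / 2 : ℝ) ^ (1 - q / R) ≤ 1 / u := by
    have : (1 / u) = (1 / 2 : ℝ) ^ ((3 - q) / 2) := by
      rw [hu, Real.div_rpow (by norm_num) (by norm_num), Real.one_rpow]
    rw [this]
    exact Real.rpow_le_rpow_of_exponent_ge (by norm_num) (by norm_num) (by linarith)
  have h4 : u ^ 2 / 8 + 1 / u ≤ 1 := by
    have h5 : 1 ≤ u := by nlinarith
    rw [div_add_div _ _ (by norm_num) hu0.ne', div_le_one (by positivity)]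
    nlinarith [mul_nonneg (sub_nonneg.2 hu2) (by nlinarith : 0 ≤ u ^ 2 + 2 * u - 4)]
  linarith

lemma half_supp [NeZero n] (hp : 2 ≤ p) {q R : ℝ} (hq : 0 < q) (hqR : q ≤ R)
    (g : EuclideanSpace ℝ (Fin n) → ℝ) (hg : ContinuousOn g (Sph p n))
    (A : Set (EuclideanSpace ℝ (Fin n))) (hA : coneMeasureE p n A ≤ 1 / 2) 
    (hgA : ∀ x ∉ A, g x = 0) :
    LN p n q g ≤ (1 / 2) ^ (1 / q - 1 / R) * LN p n R g := by
  set B := toMeasurable (coneMeasureE p n) A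
  have hB : coneMeasureE p n B ≤ 1 / 2 := by rwa [measure_toMeasurable]
  have hBm : MeasurableSet B := measurableSet_toMeasurable _ _
  have hgB : ∀ x ∉ B, g x = 0 := fun x hx => hgA x (fun h => hx (subset_toMeasurable _ _ h))
  have hR0 : 0 < R := hq.trans_le hqR
  have hres : ∀ s : ℝ, 0 < s → eLpNorm' g s (coneMeasureE p n) = eLpNorm' g s ((coneMeasureE p n).restrict B) := by
    intro s hs
    rw [eLpNorm', eLpNorm', ← lintegral_indicator hBm]
    congr 2; ext x
    by_cases hx : x ∈ B
    · rw [Set.indicator_of_mem hx]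
    · rw [Set.indicator_of_notMem hx, hgB x hx]; simp [hs]
  have h1 := eLpNorm'_le_eLpNorm'_mul_rpow_measure_univ hq hqR ((cont_aesm hp hg).restrict (s := B))
  rw [← hres q hq, ← hres R hR0, Measure.restrict_apply_univ] at h1
  have he : 0 ≤ 1 / q - 1 / R := by
    rw [sub_nonneg]; exact one_div_le_one_div_of_le hq hqR
  have h2 : eLpNorm' g q (coneMeasureE p n) ≤ eLpNorm' g R (coneMeasureE p n) * ENNReal.ofReal ((1 / 2) ^ (1 / q - 1 / R)) := by
    refine h1.trans ?_
    rw [← ENNReal.ofReal_rpow_of_nonneg (by norm_num) he]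
    gcongr
    refine hB.trans (le_of_eq ?_)
    rw [ENNReal.ofReal_div_of_pos (by norm_num)]; simp
  have := ENNReal.toReal_mono (ENNReal.mul_ne_top (eLp_ne_top hp hR0 hg) ENNReal.ofReal_ne_top) h2
  rw [ENNReal.toReal_mul, ENNReal.toReal_ofReal (by positivity)] at this
  rw [mul_comm]; exact this

lemma half_moment [NeZero n] (hp : 2 ≤ p) {q : ℝ} (hpq : p.HolderConjugate q) {R : ℝ} (hR : 2 * p ≤ R)
    (g h : EuclideanSpace ℝ (Fin n) → ℝ) (hg : ContinuousOn g (Sph p n))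
    (hh : ContinuousOn h (Sph p n))
    (hg0 : ∀ x ∈ Sph p n, 0 ≤ g x) (hh0 : ∀ x ∈ Sph p n, 0 ≤ h x) (hug : UG p g h)
    (A : Set (EuclideanSpace ℝ (Fin n))) (hA : coneMeasureE p n A ≤ 1 / 2) 
    (hgA : ∀ x ∉ A, g x = 0) :
    (1 - 2 * Bc p n R) * LN p n R g ≤ 4 * Bc p n R * LN p n R h := by
  have hq1 : 1 < q := hpq.symm.lt
  have hq0 : 0 < q := by linarith
  have hmul := hpq.mul_eq_add
  have hq2 : q ≤ 2 := by nlinarith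
  have hqR : q ≤ R := by linarith
  have hR0 : 0 < R := by linarith
  have key := sphere_moment_real hp hpq (by linarith : p ≤ R) g h hg hh hg0 hh0 hug
  have h1 := half_supp hp hq0 hqR g hg A hA hgA
  set a := LN p n R g
  set b := Bc p n R * (a + 2 * LN p n R h) with hb
  have ha : 0 ≤ a := LN_nonneg _ _
  have hB : 0 ≤ Bc p n R := Bc_nonneg hp (by linarith)
  have hb0 : 0 ≤ b := by have := LN_nonneg (p := p) R h; positivity
  have h2 : LN p n q g ^ q ≤ (1 / 2) ^ (1 - q / R) * a ^ q := by
    refine (Real.rpow_le_rpow (LN_nonneg _ _) h1 hq0.le).trans (le_of_eq ?_)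
    rw [Real.mul_rpow (by positivity) ha, ← Real.rpow_mul (by norm_num)]
    congr 2; field_simp
  have h3 := scal_half hp hpq hR
  have h4 : (2 : ℝ) ^ (-q) * a ^ q ≤ b ^ q := by
    have : 0 ≤ a ^ q := by positivity
    nlinarith
  have h5 : (a / 2) ^ q ≤ b ^ q := by
    rw [Real.div_rpow ha (by norm_num)]
    rw [Real.rpow_neg (by norm_num)] at h4
    rw [div_eq_inv_mul]; exact h4
  have h6 : a / 2 ≤ b := (Real.rpow_le_rpow_iff (by positivity) hb0 hq0).1 h5
  rw [hb] at h6
  linarith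

lemma LN_split [NeZero n] (hp : 2 ≤ p) {R D : ℝ} (hR : 4 ≤ R) (hD : 0 ≤ D)
    (f : EuclideanSpace ℝ (Fin n) → ℝ) (hf : ContinuousOn f (Sph p n))
    (h1 : LN p n R (fun x => max (f x) 0) ≤ D) (h2 : LN p n R (fun x => max (-f x) 0) ≤ D) :
    LN p n R f ≤ 1.2 * D := by
  have hR0 : 0 < R := by linarith
  have e1 := LN_rpow (n := n) hp hR0 f
  have c1 : ContinuousOn (fun x => max (f x) 0) (Sph p n) := by fun_prop
  have c2 : ContinuousOn (fun x => max (-f x) 0) (Sph p n) := by fun_prop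
  have hfin : ∀ g : EuclideanSpace ℝ (Fin n) → ℝ, ContinuousOn g (Sph p n) →
      ∫⁻ x, ENNReal.ofReal (|g x| ^ R) ∂(coneMeasureE p n) ≠ ⊤ := by
    intro g hg
    have := ENNReal.rpow_ne_top_of_nonneg hR0.le (eLp_ne_top hp hR0 hg)
    rw [← lintegral_rpow_enorm_eq_rpow_eLpNorm' hR0] at this
    convert this using 3 with x
    rw [← ENNReal.ofReal_rpow_of_nonneg (abs_nonneg _) hR0.le, ← Real.enorm_eq_ofReal_abs]
  have e2 : LN p n R f ^ R ≤ LN p n R (fun x => max (f x) 0) ^ R + LN p n R (fun x => max (-f x) 0) ^ R := by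
    rw [LN_rpow (n := n) hp hR0, LN_rpow (n := n) hp hR0, LN_rpow (n := n) hp hR0,
      ← ENNReal.toReal_add (hfin _ c1) (hfin _ c2)]
    refine ENNReal.toReal_mono (ENNReal.add_ne_top.2 ⟨hfin _ c1, hfin _ c2⟩) ?_
    have hae : AEMeasurable (fun x => ENNReal.ofReal (|max (f x) 0| ^ R)) (coneMeasureE p n) :=
      ((cont_aesm hp c1).aemeasurable.norm.pow_const R).ennreal_ofReal
    rw [← lintegral_add_left' hae]
    refine lintegral_mono fun x => ?_
    simp only
    rcases le_total 0 (f x) with h | h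
    · rw [max_eq_left h]; exact le_self_add
    · rw [max_eq_left (by linarith : 0 ≤ -f x), abs_neg]; exact le_add_self
  have e3 : LN p n R f ^ R ≤ (1.2 * D) ^ R := by
    have a1 := Real.rpow_le_rpow (LN_nonneg _ _) h1 hR0.le
    have a2 := Real.rpow_le_rpow (LN_nonneg _ _) h2 hR0.le
    have a3 : (2 : ℝ) ≤ 1.2 ^ R := by
      calc (2 : ℝ) ≤ 1.2 ^ (4 : ℝ) := by norm_num
        _ ≤ _ := Real.rpow_le_rpow_of_exponent_le (by norm_num) hR
    rw [Real.mul_rpow (by norm_num) hD]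
    have : 0 ≤ D ^ R := by positivity
    nlinarith
  exact (Real.rpow_le_rpow_iff (LN_nonneg _ _) (by positivity) hR0).1 e3

/-- moment estimate for mean zero functions -/
theorem mean_zero_moment [NeZero n] (hp : 2 ≤ p) {q : ℝ} (hpq : p.HolderConjugate q) {R : ℝ} (hR : 2 * p ≤ R)
    (f h : EuclideanSpace ℝ (Fin n) → ℝ) (hf : ContinuousOn f (Sph p n))
    (hh : ContinuousOn h (Sph p n))
    (hh0 : ∀ x ∈ Sph p n, 0 ≤ h x) (hug : UG p f h)
    (hmean : ∫ x, f x ∂(coneMeasureE p n) = 0) (hB : 2 * Bc p n R < 1) :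
    LN p n R f ≤ 2 * (1.2 * (4 * Bc p n R * LN p n R h / (1 - 2 * Bc p n R))) := by
  have := cone_prob (n := n) hp
  have hR0 : 0 < R := by linarith
  have hB0 : 0 ≤ Bc p n R := Bc_nonneg hp (by linarith)
  have hL0 := LN_nonneg (p := p) R h
  obtain ⟨C, hC0, hC⟩ := cont_bdd hp hf
  obtain ⟨m, hm1, hm2⟩ := exists_median (coneMeasureE p n) f (cont_aesm hp hf).aemeasurable C
    (by filter_upwards [cone_mem_Sph hp] with x hx using hC x hx)
  have c0 : ContinuousOn (fun x => f x - m) (Sph p n) := by fun_prop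
  have c1 : ContinuousOn (fun x => max (f x - m) 0) (Sph p n) := by fun_prop
  have c2 : ContinuousOn (fun x => max (-(f x - m)) 0) (Sph p n) := by fun_prop
  have hd : 0 < 1 - 2 * Bc p n R := by linarith
  have k1 := half_moment hp hpq hR (fun x => max (f x - m) 0) h c1 hh (fun _ _ => le_max_right _ _) hh0
    (by
      intro η hη
      obtain ⟨δ, hδ, H⟩ := hug η hη
      refine ⟨δ, hδ, fun x hx y hy hxy => le_trans ?_ (H x hx y hy hxy)⟩
      refine (abs_max_sub_max_le_abs _ _ _).trans (le_of_eq ?_)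
      congr 1; ring)
    {x | m < f x} hm1 (fun x hx => by
      have hx : ¬ m < f x := hx
      exact max_eq_right (by linarith))
  have k2 := half_moment hp hpq hR (fun x => max (-(f x - m)) 0) h c2 hh (fun _ _ => le_max_right _ _) hh0
    (by
      intro η hη
      obtain ⟨δ, hδ, H⟩ := hug η hη
      refine ⟨δ, hδ, fun x hx y hy hxy => le_trans ?_ (H x hx y hy hxy)⟩
      refine (abs_max_sub_max_le_abs _ _ _).trans (le_of_eq ?_)
      rw [← abs_neg]; congr 1; ring)
    {x | f x < m} hm2 (fun x hx => by
      have hx : ¬ f x < m := hx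
      exact max_eq_right (by linarith))
  have k3 := LN_split hp (by linarith : 4 ≤ R) (D := 4 * Bc p n R * LN p n R h / (1 - 2 * Bc p n R))
    (by positivity) (fun x => f x - m) c0 
    (by rw [le_div_iff₀ hd]; linarith) (by rw [le_div_iff₀ hd]; linarith)
  have k4 : |m| ≤ LN p n R (fun x => f x - m) := by
    have i1 : ∫ x, (f x - m) ∂(coneMeasureE p n) = -m := by
      rw [integral_sub (cont_integrable hp hf) (integrable_const _), hmean]; simp
    have i2 : |m| ≤ ∫ x, |f x - m| ∂(coneMeasureE p n) := by
      rw [← abs_neg, ← i1]; exact abs_integral_le_integral_abs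
    have i3 := LN_eq_integral hp one_pos c0
    simp only [Real.rpow_one, div_one] at i3
    rw [← i3] at i2
    exact i2.trans (LN_exp_mono hp one_pos (by linarith) c0)
  have k5 := LN_add_le hp (by linarith : 1 ≤ R) c0 (g := fun _ => m) continuousOn_const
  simp only [sub_add_cancel] at k5
  have k6 : LN p n R (fun _ => m) ≤ |m| := LN_le_const hp hR0 (abs_nonneg _) (fun _ _ => le_rfl)
  have k7 : LN p n R f ≤ LN p n R (fun x => f x - m) + LN p n R (fun _ => m) := k5
  linarith

end median

section opn
variable {n : ℕ} {p : ℝ}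

lemma op_abs_le_norm (hp : 2 ≤ p) {k : ℕ}
    (T : ContinuousMultilinearMap ℝ (fun _ : Fin k => EuclideanSpace ℝ (Fin n)) ℝ)
    (v : Fin k → EuclideanSpace ℝ (Fin n)) (hv : ∀ i, lpNormE p (v i) = 1) : |T v| ≤ ‖T‖ * (n : ℝ) ^ k := by
  have h1 := T.le_opNorm v
  rw [Real.norm_eq_abs] at h1
  refine h1.trans ?_
  gcongr
  calc ∏ i, ‖v i‖ ≤ ∏ i : Fin k, (n : ℝ) := by
        refine Finset.prod_le_prod (fun _ _ => norm_nonneg _) (fun i _ => ?_)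
        have := norm_le_lpN hp (v i)
        rwa [hv i, mul_one] at this
    _ = _ := by simp

lemma op_bdd (hp : 2 ≤ p) {k : ℕ}
    (T : ContinuousMultilinearMap ℝ (fun _ : Fin k => EuclideanSpace ℝ (Fin n)) ℝ) :
    BddAbove {y | ∃ v : Fin k → EuclideanSpace ℝ (Fin n), (∀ i, lpNormE p (v i) = 1) ∧ y = T v} := by
  refine ⟨‖T‖ * (n : ℝ) ^ k, ?_⟩
  rintro y ⟨v, hv, rfl⟩
  exact (le_abs_self _).trans (op_abs_le_norm hp T v hv)

lemma op_le (hp : 2 ≤ p) {k : ℕ}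
    (T : ContinuousMultilinearMap ℝ (fun _ : Fin k => EuclideanSpace ℝ (Fin n)) ℝ)
    (v : Fin k → EuclideanSpace ℝ (Fin n)) (hv : ∀ i, lpNormE p (v i) = 1) : T v ≤ opNormQE p T :=
  le_csSup (op_bdd hp T) ⟨v, hv, rfl⟩

lemma op_sup_le [NeZero n] (hp : 2 ≤ p) {k : ℕ}
    (T : ContinuousMultilinearMap ℝ (fun _ : Fin k => EuclideanSpace ℝ (Fin n)) ℝ) (c : ℝ)
    (h : ∀ v : Fin k → EuclideanSpace ℝ (Fin n), (∀ i, lpNormE p (v i) = 1) → T v ≤ c) : opNormQE p T ≤ c := by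
  obtain ⟨x0, hx0⟩ := Sph_nonempty (n := n) hp
  refine csSup_le ⟨T (fun _ => x0), fun _ => x0, fun _ => hx0, rfl⟩ ?_
  rintro y ⟨v, hv, rfl⟩
  exact h v hv

lemma op_sub_le [NeZero n] (hp : 2 ≤ p) {k : ℕ}
    (T T' : ContinuousMultilinearMap ℝ (fun _ : Fin k => EuclideanSpace ℝ (Fin n)) ℝ) (c : ℝ)
    (h : ∀ v : Fin k → EuclideanSpace ℝ (Fin n), (∀ i, lpNormE p (v i) = 1) → |T v - T' v| ≤ c) :
    |opNormQE p T - opNormQE p T'| ≤ c := by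
  rw [abs_sub_le_iff]
  constructor
  · have : opNormQE p T ≤ c + opNormQE p T' := op_sup_le hp T _ fun v hv => by
      have := (abs_sub_le_iff.1 (h v hv)).1
      have := op_le hp T' v hv
      linarith
    linarith
  · have : opNormQE p T' ≤ c + opNormQE p T := op_sup_le hp T' _ fun v hv => by
      have := (abs_sub_le_iff.1 (h v hv)).2
      have := op_le hp T v hv
      linarith
    linarith

lemma op_cont [NeZero n] (hp : 2 ≤ p) {k : ℕ} :
    Continuous (fun T : ContinuousMultilinearMap ℝ (fun _ : Fin k => EuclideanSpace ℝ (Fin n)) ℝ => opNormQE p T) := by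
  have : LipschitzWith ((n : NNReal) ^ k) (fun T : ContinuousMultilinearMap ℝ (fun _ : Fin k => EuclideanSpace ℝ (Fin n)) ℝ => opNormQE p T) := by
    refine LipschitzWith.of_dist_le_mul fun T T' => ?_
    rw [Real.dist_eq, dist_eq_norm]
    push_cast
    refine op_sub_le hp T T' _ fun v hv => ?_
    rw [mul_comm]
    exact op_abs_le_norm hp (T - T') v hv
  exact this.continuous

lemma op_abs_cons_le [NeZero n] (hp : 2 ≤ p) {k : ℕ}
    (T : ContinuousMultilinearMap ℝ (fun _ : Fin (k + 1) => EuclideanSpace ℝ (Fin n)) ℝ)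
    (w : EuclideanSpace ℝ (Fin n))
    (v : Fin k → EuclideanSpace ℝ (Fin n)) (hv : ∀ i, lpNormE p (v i) = 1) :
    |T (Fin.cons w v)| ≤ opNormQE p T * lpNormE p w := by
  have key : ∀ w : EuclideanSpace ℝ (Fin n), lpNormE p w = 1 → T (Fin.cons w v) ≤ opNormQE p T := by
    intro w hw
    refine op_le hp T _ fun i => ?_
    refine Fin.cases ?_ (fun j => ?_) i
    · simpa using hw
    · simpa using hv j
  have hsm : ∀ (c : ℝ) (w : EuclideanSpace ℝ (Fin n)), T (Fin.cons (c • w) v) = c * T (Fin.cons w v) := by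
    intro c w
    simpa using T.toMultilinearMap.cons_smul v c w
  have key2 : ∀ w : EuclideanSpace ℝ (Fin n), lpNormE p w = 1 → |T (Fin.cons w v)| ≤ opNormQE p T := by
    intro w hw
    rw [abs_le']
    refine ⟨key w hw, ?_⟩
    have := key (-w) (by rwa [lpN_neg])
    rw [show -w = (-1 : ℝ) • w by simp, hsm] at this
    linarith
  by_cases hw : w = 0
  · subst hw
    have := hsm 0 0
    simp only [smul_zero, zero_mul] at this
    rw [this, lpN_zero hp]; simp
  · have h1 := key2 (prj p w) (prj_mem hp hw)
    have h2 := smul_prj hp w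
    rw [← h2, hsm, abs_mul, abs_of_nonneg (lpN_nonneg _), h2, mul_comm]
    exact mul_le_mul_of_nonneg_right h1 (lpN_nonneg _)

lemma op_nonneg [NeZero n] (hp : 2 ≤ p) {k : ℕ}
    (T : ContinuousMultilinearMap ℝ (fun _ : Fin (k + 1) => EuclideanSpace ℝ (Fin n)) ℝ) : 0 ≤ opNormQE p T := by
  obtain ⟨x0, hx0⟩ := Sph_nonempty (n := n) hp
  have hx0 : lpNormE p x0 = 1 := hx0
  have := op_abs_cons_le hp T x0 (fun _ => x0) (fun _ => hx0)
  rw [hx0, mul_one] at this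
  exact (abs_nonneg _).trans this

lemma F_contAt [NeZero n] (hp : 2 ≤ p) {d k : ℕ} (hk : k ≤ d) {f : EuclideanSpace ℝ (Fin n) → ℝ}
    {x : EuclideanSpace ℝ (Fin n)} (hf : ContDiffAt ℝ (d : ℕ∞) f x) :
    ContinuousAt (fun x => opNormQE p (iteratedFDeriv ℝ k f x)) x := by
  have h1 : ContDiffAt ℝ 0 (iteratedFDeriv ℝ k f) x := hf.iteratedFDeriv_right (by
    simp only [zero_add]; exact_mod_cast hk)
  exact (op_cont hp).continuousAt.comp h1.continuousAt

lemma seg_bound [NeZero n] (hp : 2 ≤ p) {d k : ℕ} (hk : k + 1 ≤ d) {f : EuclideanSpace ℝ (Fin n) → ℝ}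
    {U : Set (EuclideanSpace ℝ (Fin n))} (hU : IsOpen U) (hsub : Sph p n ⊆ U) (hf : ContDiffOn ℝ (d : ℕ∞) f U)
    (η : ℝ) (hη : 0 < η) : ∃ δ > 0, ∀ x ∈ Sph p n, ∀ y, lpNormE p (y - x) ≤ δ →
      ∀ v : Fin k → EuclideanSpace ℝ (Fin n), (∀ i, lpNormE p (v i) = 1) →
      |iteratedFDeriv ℝ k f y v - iteratedFDeriv ℝ k f x v| ≤
        (opNormQE p (iteratedFDeriv ℝ (k + 1) f x) + η) * lpNormE p (y - x) := by
  have hn : (0 : ℝ) < n := by exact_mod_cast Nat.pos_of_ne_zero (NeZero.ne n)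
  have hat : ∀ x ∈ U, ContDiffAt ℝ (d : ℕ∞) f x := fun x hx => hf.contDiffAt (hU.mem_nhds hx)
  obtain ⟨δ1, hδ1, h1⟩ := (Sph_compact (n := n) hp).exists_cthickening_subset_open hU hsub
  have h2 := (Sph_compact (n := n) hp).uniformContinuousAt_of_continuousAt
    (fun x => opNormQE p (iteratedFDeriv ℝ (k + 1) f x)) (fun x hx => F_contAt hp hk (hat x (hsub hx)))
    (Metric.dist_mem_uniformity hη)
  obtain ⟨δ2, hδ2, h2⟩ := Metric.mem_uniformity_dist.1 h2
  refine ⟨min (δ1 / n) (δ2 / (2 * n)), by positivity, fun x hx y hxy v hv => ?_⟩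
  have hnorm : ‖y - x‖ ≤ min δ1 (δ2 / 2) := by
    refine (norm_le_lpN hp _).trans ?_
    refine le_min ?_ ?_
    · have := hxy.trans (min_le_left _ _)
      rw [le_div_iff₀ hn] at this; linarith
    · have := hxy.trans (min_le_right _ _)
      rw [le_div_iff₀ (by positivity)] at this; linarith
  have hz : ∀ s ∈ Set.Icc (0 : ℝ) 1, x + s • (y - x) ∈ U ∧
      opNormQE p (iteratedFDeriv ℝ (k + 1) f (x + s • (y - x))) ≤ opNormQE p (iteratedFDeriv ℝ (k + 1) f x) + η := by
    intro s hs
    have hd : dist (x + s • (y - x)) x ≤ ‖y - x‖ := by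
      rw [dist_eq_norm, add_sub_cancel_left, norm_smul, Real.norm_eq_abs, abs_of_nonneg hs.1]
      exact mul_le_of_le_one_left (norm_nonneg _) hs.2
    refine ⟨h1 (Metric.mem_cthickening_of_dist_le _ x _ _ hx (hd.trans (hnorm.trans (min_le_left _ _)))), ?_⟩
    have h3 : dist x (x + s • (y - x)) < δ2 := by
      rw [dist_comm]
      have := hd.trans (hnorm.trans (min_le_right _ _))
      linarith
    have h4 := h2 h3 hx
    have h4 : dist (opNormQE p (iteratedFDeriv ℝ (k + 1) f x))
      (opNormQE p (iteratedFDeriv ℝ (k + 1) f (x + s • (y - x)))) < η := h4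
    rw [Real.dist_eq, abs_sub_comm] at h4
    linarith [(abs_lt.1 h4).2]
  have key := norm_image_sub_le_of_norm_deriv_le_segment_01'
    (f := fun s : ℝ => iteratedFDeriv ℝ k f (x + s • (y - x)) v)
    (f' := fun s : ℝ => iteratedFDeriv ℝ (k + 1) f (x + s • (y - x)) (Fin.cons (y - x) v))
    (C := (opNormQE p (iteratedFDeriv ℝ (k + 1) f x) + η) * lpNormE p (y - x)) ?_ ?_
  · simpa [Real.norm_eq_abs] using key
  · intro s hs
    have hdiff : DifferentiableAt ℝ (iteratedFDeriv ℝ k f) (x + s • (y - x)) :=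
      (hat _ (hz s hs).1).differentiableAt_iteratedFDeriv (by exact_mod_cast hk)
    have hline : HasDerivAt (fun s : ℝ => x + s • (y - x)) (y - x) s := by
      simpa using ((hasDerivAt_id s).smul_const (y - x)).const_add x
    have h5 := hdiff.hasFDerivAt.comp_hasDerivAt s hline
    have h6 := (ContinuousMultilinearMap.apply ℝ (fun _ : Fin k => EuclideanSpace ℝ (Fin n)) ℝ v).hasFDerivAt.comp_hasDerivAt s h5
    refine HasDerivAt.hasDerivWithinAt ?_
    convert h6 using 1
    · rfl
    · rw [iteratedFDeriv_succ_apply_left]; rfl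
  · intro s hs
    have hs' : s ∈ Set.Icc (0 : ℝ) 1 := ⟨hs.1, hs.2.le⟩
    rw [Real.norm_eq_abs]
    refine (op_abs_cons_le hp _ _ _ hv).trans ?_
    exact mul_le_mul_of_nonneg_right (hz s hs').2 (lpN_nonneg _)

lemma UG_F [NeZero n] (hp : 2 ≤ p) {d k : ℕ} (hk : k + 1 ≤ d) {f : EuclideanSpace ℝ (Fin n) → ℝ}
    {U : Set (EuclideanSpace ℝ (Fin n))} (hU : IsOpen U) (hsub : Sph p n ⊆ U) (hf : ContDiffOn ℝ (d : ℕ∞) f U) :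
    UG p (fun x => opNormQE p (iteratedFDeriv ℝ k f x)) (fun x => opNormQE p (iteratedFDeriv ℝ (k + 1) f x)) := by
  intro η hη
  obtain ⟨δ, hδ, h⟩ := seg_bound hp hk hU hsub hf η hη
  exact ⟨δ, hδ, fun x hx y hy hxy => op_sub_le hp _ _ _ (h x hx y hxy)⟩

lemma UG_f [NeZero n] (hp : 2 ≤ p) {d : ℕ} (hd : 1 ≤ d) {f : EuclideanSpace ℝ (Fin n) → ℝ}
    {U : Set (EuclideanSpace ℝ (Fin n))} (hU : IsOpen U) (hsub : Sph p n ⊆ U) (hf : ContDiffOn ℝ (d : ℕ∞) f U) :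
    UG p f (fun x => opNormQE p (iteratedFDeriv ℝ 1 f x)) := by
  intro η hη
  obtain ⟨δ, hδ, h⟩ := seg_bound hp (k := 0) hd hU hsub hf η hη
  refine ⟨δ, hδ, fun x hx y hy hxy => ?_⟩
  simpa using h x hx y hxy (fun _ => 0) (fun i => i.elim0)

end opn

section osc
variable {n : ℕ} {p : ℝ}

lemma chain_bound (F H : EuclideanSpace ℝ (Fin n) → ℝ) (hug : UG p F H) {L : ℝ}
    (hL0 : 0 ≤ L) (hL : ∀ x ∈ Sph p n, H x ≤ L) (γ : ℝ → EuclideanSpace ℝ (Fin n)) (φ : ℝ → ℝ)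
    (hγ : ∀ s ∈ Set.Icc (0 : ℝ) 1, γ s ∈ Sph p n) (hφ : ContinuousOn φ (Set.Icc 0 1))
    (hd : ∀ a ∈ Set.Icc (0 : ℝ) 1, ∀ b ∈ Set.Icc (0 : ℝ) 1, a ≤ b → lpNormE p (γ b - γ a) ≤ φ b - φ a) :
    |F (γ 1) - F (γ 0)| ≤ L * (φ 1 - φ 0) := by
  have h01 : 0 ≤ φ 1 - φ 0 :=
    (lpN_nonneg _).trans (hd 0 (by simp) 1 (by simp) zero_le_one)
  have main : ∀ η > 0, |F (γ 1) - F (γ 0)| ≤ (L + η) * (φ 1 - φ 0) := by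
    intro η hη
    obtain ⟨δ, hδ, h⟩ := hug η hη
    have huc := isCompact_Icc.uniformContinuousOn_of_continuous hφ
    obtain ⟨ε, hε, hu⟩ := Metric.uniformContinuousOn_iff.1 huc δ hδ
    obtain ⟨m, hm⟩ := exists_nat_one_div_lt hε
    have hM : (0 : ℝ) < (m : ℝ) + 1 := by positivity
    set M : ℝ := (m : ℝ) + 1 with hMdef
    have step : ∀ k ∈ Finset.range (m + 1), |F (γ (((k + 1 : ℕ) : ℝ) / M)) - F (γ ((k : ℝ) / M))| ≤
        (L + η) * (φ (((k + 1 : ℕ) : ℝ) / M) - φ ((k : ℝ) / M)) := by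
      intro k hk
      have hk : (k : ℝ) + 1 ≤ M := by
        have := Finset.mem_range.1 hk
        rw [hMdef]; exact_mod_cast this
      push_cast
      have ha : (k : ℝ) / M ∈ Set.Icc (0 : ℝ) 1 := ⟨by positivity, by rw [div_le_one hM]; linarith⟩
      have hb : ((k : ℝ) + 1) / M ∈ Set.Icc (0 : ℝ) 1 := ⟨by positivity, by rw [div_le_one hM]; linarith⟩
      have hab : (k : ℝ) / M ≤ ((k : ℝ) + 1) / M := by gcongr; linarith
      have hdist := hd _ ha _ hb hab
      have hsub : ((k : ℝ) + 1) / M - (k : ℝ) / M = 1 / M := by ring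
      have h1 := hu _ hb _ ha (by rw [Real.dist_eq, hsub, abs_of_pos (by positivity)]; exact hm)
      rw [Real.dist_eq] at h1
      have h2 := h _ (hγ _ ha) _ (hγ _ hb) (hdist.trans ((le_abs_self _).trans h1.le))
      have hH := hL _ (hγ _ ha)
      refine h2.trans ?_
      gcongr
      exact lpN_nonneg _
    have hsum := Finset.sum_le_sum step
    rw [← Finset.mul_sum, Finset.sum_range_sub (fun k : ℕ => φ ((k : ℝ) / M))] at hsum
    have htel := Finset.sum_range_sub (fun k : ℕ => F (γ ((k : ℝ) / M))) (m + 1)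
    have e1 : (((m + 1 : ℕ) : ℝ)) / M = 1 := by rw [hMdef]; push_cast; exact div_self hM.ne'
    rw [e1] at hsum htel
    simp only [Nat.cast_zero, zero_div] at hsum htel
    rw [← htel]
    exact (Finset.abs_sum_le_sum_abs _ _).trans hsum
  have hlim : Filter.Tendsto (fun η => (L + η) * (φ 1 - φ 0)) (nhdsWithin 0 (Set.Ioi 0)) (nhds ((L + 0) * (φ 1 - φ 0))) :=
    ((tendsto_const_nhds.add Filter.tendsto_id).mul tendsto_const_nhds).mono_left nhdsWithin_le_nhds
  rw [add_zero] at hlim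
  exact ge_of_tendsto hlim (Filter.eventually_of_mem self_mem_nhdsWithin main)

lemma lpN_single (hp : 2 ≤ p) (i : Fin n) (a : ℝ) :
    lpNormE p (EuclideanSpace.single i a) = |a| := by
  have hp0 : 0 < p := by linarith
  rw [lpNormE, Finset.sum_eq_single i]
  · rw [EuclideanSpace.single_apply, if_pos rfl, ← Real.rpow_mul (abs_nonneg _), mul_one_div_cancel hp0.ne',
      Real.rpow_one]
  · intro j _ hj
    rw [EuclideanSpace.single_apply, if_neg hj]; simp [hp0.ne']
  · simp

lemma leg (hp : 2 ≤ p) (F H : EuclideanSpace ℝ (Fin n) → ℝ) (hug : UG p F H) {L : ℝ} (hL0 : 0 ≤ L)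
    (hL : ∀ x ∈ Sph p n, H x ≤ L) (x : EuclideanSpace ℝ (Fin n)) (hx : x ∈ Sph p n) (i : Fin n)
    (s : ℝ) (hs : |s| = 1) (hsx : s * |x i| = x i) :
    |F x - F (EuclideanSpace.single i s)| ≤ L * 2 := by
  have hp0 : 0 < p := by linarith
  have hx1 : lpNormE p x = 1 := hx
  have hsum : ∑ j, |x j| ^ p = 1 := by rw [← lpN_rpow hp, hx1, Real.one_rpow]
  have hxi : |x i| ≤ 1 := (abs_le_lpN hp x i).trans hx1.le
  have hxip : |x i| ^ p ≤ 1 := Real.rpow_le_one (abs_nonneg _) hxi hp0.le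
  have hxip0 : 0 ≤ |x i| ^ p := by positivity
  set c := 1 - |x i| ^ p with hc
  set x' := x - EuclideanSpace.single i (x i) with hx'
  have hx'i : x' i = 0 := by simp [hx']
  have hx'j : ∀ j, j ≠ i → x' j = x j := fun j hj => by simp [hx', hj]
  have hsum' : ∑ j, |x' j| ^ p = c := by
    rw [← Finset.add_sum_erase _ _ (Finset.mem_univ i)] at hsum ⊢
    rw [hx'i, Finset.sum_congr rfl (fun j hj => by rw [hx'j j (Finset.ne_of_mem_erase hj)])]
    rw [abs_zero, Real.zero_rpow hp0.ne']; linarith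
  have hNx' : lpNormE p x' ≤ 1 := by
    rw [← Real.rpow_le_rpow_iff (lpN_nonneg _) zero_le_one hp0, lpN_rpow hp, hsum', Real.one_rpow]
    linarith
  set a : ℝ → ℝ := fun τ => (1 - τ ^ p * c) ^ (1 / p) with ha
  have hτ : ∀ τ ∈ Set.Icc (0 : ℝ) 1, 0 ≤ 1 - τ ^ p * c := by
    intro τ hτ
    have h1 : τ ^ p ≤ 1 := Real.rpow_le_one hτ.1 hτ.2 hp0.le
    have h2 : 0 ≤ τ ^ p := Real.rpow_nonneg hτ.1 _
    nlinarith
  have ha0 : ∀ τ ∈ Set.Icc (0 : ℝ) 1, 0 ≤ a τ := fun τ h => Real.rpow_nonneg (hτ τ h) _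
  have hap : ∀ τ ∈ Set.Icc (0 : ℝ) 1, a τ ^ p = 1 - τ ^ p * c := fun τ h => by
    rw [ha]; simp only; rw [← Real.rpow_mul (hτ τ h), one_div_mul_cancel hp0.ne', Real.rpow_one]
  have hanti : ∀ u ∈ Set.Icc (0 : ℝ) 1, ∀ v ∈ Set.Icc (0 : ℝ) 1, u ≤ v → a v ≤ a u := by
    intro u hu v hv huv
    refine Real.rpow_le_rpow (hτ v hv) ?_ (by positivity)
    have : u ^ p ≤ v ^ p := Real.rpow_le_rpow hu.1 huv hp0.le
    nlinarith
  have key := chain_bound F H hug hL0 hL (fun τ => τ • x' + EuclideanSpace.single i (s * a τ))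
    (fun τ => τ - a τ) ?_ ?_ ?_
  · have e1 : a 1 = |x i| := by
      simp only [ha, Real.one_rpow, one_mul, hc]
      rw [show 1 - (1 - |x i| ^ p) = |x i| ^ p by ring, ← Real.rpow_mul (abs_nonneg _), mul_one_div_cancel hp0.ne',
        Real.rpow_one]
    have e0 : a 0 = 1 := by simp [ha, Real.zero_rpow hp0.ne']
    simp only [one_smul, zero_smul, zero_add, e1, e0, hsx, mul_one] at key
    rw [hx', sub_add_cancel] at key
    refine key.trans ?_
    gcongr
    linarith [abs_nonneg (x i)]
  · intro τ ht
    show lpNormE p _ = 1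
    rw [← Real.rpow_left_inj (lpN_nonneg _) zero_le_one hp0.ne', lpN_rpow hp, Real.one_rpow,
      ← Finset.add_sum_erase _ _ (Finset.mem_univ i)]
    have hsum2 := hsum'
    rw [← Finset.add_sum_erase _ _ (Finset.mem_univ i), hx'i, abs_zero, Real.zero_rpow hp0.ne', zero_add] at hsum2
    have e2 : ∀ j ∈ Finset.univ.erase i, |(τ • x' + EuclideanSpace.single i (s * a τ)) j| ^ p = τ ^ p * |x' j| ^ p := by
      intro j hj
      have hj := Finset.ne_of_mem_erase hj
      simp [hj, abs_mul, abs_of_nonneg ht.1, Real.mul_rpow ht.1 (abs_nonneg _)]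
    rw [Finset.sum_congr rfl e2, ← Finset.mul_sum, hsum2]
    have e3 : (τ • x' + EuclideanSpace.single i (s * a τ)) i = s * a τ := by simp [hx'i]
    rw [e3, abs_mul, hs, one_mul, abs_of_nonneg (ha0 τ ht), hap τ ht]; ring
  · refine continuousOn_id.sub (ContinuousOn.rpow_const ?_ fun _ _ => Or.inr (by positivity))
    exact continuousOn_const.sub ((continuousOn_id.rpow_const fun _ _ => Or.inr hp0.le).mul continuousOn_const)
  · intro u hu v hv huv
    have e4 : (v • x' + EuclideanSpace.single i (s * a v)) - (u • x' + EuclideanSpace.single i (s * a u)) =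
        (v - u) • x' + EuclideanSpace.single i (s * (a v - a u)) := by
      ext j
      by_cases hj : j = i
      · subst hj; simp; ring
      · simp [hj]; ring
    rw [e4]
    refine (lpN_add_le hp _ _).trans ?_
    rw [lpN_smul hp, lpN_single hp, abs_mul, hs, one_mul, abs_of_nonneg (by linarith : 0 ≤ v - u),
      abs_of_nonpos (by linarith [hanti u hu v hv huv])]
    nlinarith [lpN_nonneg (p := p) x']

lemma exists_sgn (a : ℝ) : ∃ s : ℝ, |s| = 1 ∧ s * |a| = a := by
  rcases le_total 0 a with h | h
  · exact ⟨1, by simp, by rw [abs_of_nonneg h, one_mul]⟩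
  · exact ⟨-1, by simp, by rw [abs_of_nonpos h]; ring⟩

theorem lp_oscillation (hp : 2 ≤ p) (hn : 2 ≤ n) (F H : EuclideanSpace ℝ (Fin n) → ℝ) (hug : UG p F H) {L : ℝ} (hL0 : 0 ≤ L)
    (hL : ∀ x ∈ Sph p n, H x ≤ L) (x y : EuclideanSpace ℝ (Fin n)) (hx : x ∈ Sph p n) (hy : y ∈ Sph p n) :
    |F x - F y| ≤ 6 * L := by
  set i : Fin n := ⟨0, by omega⟩
  set j : Fin n := ⟨1, by omega⟩
  have hij : j ≠ i := by simp [i, j, Fin.ext_iff]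
  obtain ⟨s, hs, hsx⟩ := exists_sgn (x i)
  obtain ⟨s', hs', hsy⟩ := exists_sgn (y j)
  have h1 := leg hp F H hug hL0 hL x hx i s hs hsx
  have h2 := leg hp F H hug hL0 hL y hy j s' hs' hsy
  have h3 := leg hp F H hug hL0 hL (EuclideanSpace.single i s) (by show lpNormE p _ = 1; rw [lpN_single hp, hs]) j s' hs'
    (by simp [hij])
  have := abs_sub_le (F x) (F (EuclideanSpace.single i s)) (F y)
  have := abs_sub_le (F (EuclideanSpace.single i s)) (F (EuclideanSpace.single j s')) (F y)
  rw [abs_sub_comm] at h2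
  linarith

end osc

section supp
variable {n : ℕ} {p : ℝ}

lemma cone_open_pos [NeZero n] (hp : 2 ≤ p) {O : Set (EuclideanSpace ℝ (Fin n))} (hO : IsOpen O)
    {x : EuclideanSpace ℝ (Fin n)} (hx : x ∈ Sph p n) (hxO : x ∈ O) : 0 < coneMeasureE p n O := by
  rw [cone_apply hp hO.measurableSet]
  refine ENNReal.mul_pos (ENNReal.inv_ne_zero.2 (Bal_vol_lt hp).ne) ?_
  have hW : IsOpen (({0}ᶜ ∩ prj p ⁻¹' O) ∩ {x : EuclideanSpace ℝ (Fin n) | lpNormE p x < 1}) :=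
    ((prj_continuousOn hp).isOpen_inter_preimage isOpen_compl_singleton hO).inter
      (isOpen_lt (lpN_continuous hp) continuous_const)
  have hx1 : lpNormE p x = 1 := hx
  have hne : (({0}ᶜ ∩ prj p ⁻¹' O) ∩ {x : EuclideanSpace ℝ (Fin n) | lpNormE p x < 1}).Nonempty := by
    refine ⟨(1 / 2 : ℝ) • x, ⟨?_, ?_⟩, ?_⟩
    · simp [Sph_ne_zero hp hx]
    · show prj p _ ∈ O
      rw [prj_smul hp (by norm_num), prj_of_mem hx]; exact hxO
    · show lpNormE p _ < 1
      rw [lpN_smul hp, hx1]; norm_num [abs_of_pos]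
  have := hW.measure_pos volume hne
  refine (lt_of_lt_of_le this (measure_mono ?_)).ne'
  rintro y ⟨⟨_, h1⟩, h2⟩
  have h2 : lpNormE p y < 1 := h2
  exact ⟨h1, h2.le⟩

lemma le_essSup_cone [NeZero n] (hp : 2 ≤ p) {F : EuclideanSpace ℝ (Fin n) → ℝ}
    (hF : ContinuousOn F (Sph p n)) {x : EuclideanSpace ℝ (Fin n)} (hx : x ∈ Sph p n) :
    F x ≤ essSup F (coneMeasureE p n) := by
  by_contra hlt
  push Not at hlt
  obtain ⟨C, hC0, hC⟩ := cont_bdd hp hF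
  have hb : ∀ᵐ y ∂(coneMeasureE p n), F y ≤ essSup F (coneMeasureE p n) := by
    apply ae_le_essSup
    refine ⟨C, ?_⟩
    simp only [Filter.eventually_map]
    filter_upwards [cone_mem_Sph hp] with y hy using (le_abs_self _).trans (hC y hy)
  obtain ⟨O, hO, hOS⟩ := continuousOn_iff'.1 hF (Set.Ioi (essSup F (coneMeasureE p n))) isOpen_Ioi
  have hxO : x ∈ O := by
    have : x ∈ F ⁻¹' (Set.Ioi (essSup F (coneMeasureE p n))) ∩ Sph p n := ⟨hlt, hx⟩
    rw [hOS] at this; exact this.1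
  have hpos := cone_open_pos hp hO hx hxO
  have hz : coneMeasureE p n O = 0 := by
    rw [measure_eq_zero_iff_ae_notMem]
    filter_upwards [cone_mem_Sph hp, hb] with y hy hy2 hyO
    have : y ∈ F ⁻¹' (Set.Ioi (essSup F (coneMeasureE p n))) ∩ Sph p n := by rw [hOS]; exact ⟨hyO, hy⟩
    exact absurd hy2 (not_le.2 this.1)
  exact hpos.ne' hz

lemma LN_const' [NeZero n] (hp : 2 ≤ p) {r : ℝ} (hr : 0 < r) (c : ℝ) :
    LN p n r (fun _ => c) = |c| := by
  have := cone_prob (n := n) hp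
  rw [LN, eLpNorm'_const _ hr, measure_univ, ENNReal.one_rpow, mul_one]; simp

lemma exists_le_LN [NeZero n] (hp : 2 ≤ p) {r : ℝ} (hr : 0 < r) {F : EuclideanSpace ℝ (Fin n) → ℝ}
    (hF : ContinuousOn F (Sph p n)) (hF0 : ∀ x ∈ Sph p n, 0 ≤ F x) : ∃ x ∈ Sph p n, F x ≤ LN p n r F := by
  obtain ⟨x, hx, hmin⟩ := (Sph_compact hp).exists_isMinOn (Sph_nonempty hp) hF
  refine ⟨x, hx, ?_⟩
  have h1 := LN_mono hp hr (f := fun _ => F x) hF (fun y hy => by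
    rw [abs_of_nonneg (hF0 x hx), abs_of_nonneg (hF0 y hy)]; exact hmin hy)
  rw [LN_const' hp hr, abs_of_nonneg (hF0 x hx)] at h1
  exact h1

lemma exists_nonpos [NeZero n] (hp : 2 ≤ p) {f : EuclideanSpace ℝ (Fin n) → ℝ}
    (hf : ContinuousOn f (Sph p n)) (hmean : ∫ x, f x ∂(coneMeasureE p n) = 0) : ∃ x ∈ Sph p n, f x ≤ 0 := by
  have := cone_prob (n := n) hp
  by_contra hcon
  push Not at hcon
  obtain ⟨x, hx, hmin⟩ := (Sph_compact hp).exists_isMinOn (Sph_nonempty hp) hf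
  have : f x ≤ ∫ y, f y ∂(coneMeasureE p n) := by
    have h1 : ∫ y, f x ∂(coneMeasureE p n) ≤ ∫ y, f y ∂(coneMeasureE p n) := by
      refine integral_mono_ae (integrable_const _) (cont_integrable hp hf) ?_
      filter_upwards [cone_mem_Sph hp] with y hy using hmin hy
    simpa using h1
  linarith [hcon x hx]

lemma sup_bound [NeZero n] (hp : 2 ≤ p) (hn : 2 ≤ n) {f h : EuclideanSpace ℝ (Fin n) → ℝ} {L : ℝ} (hL0 : 0 ≤ L)
    (hf : ContinuousOn f (Sph p n)) (hmean : ∫ x, f x ∂(coneMeasureE p n) = 0) (hug : UG p f h)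
    (hL : ∀ x ∈ Sph p n, h x ≤ L) : ∀ x ∈ Sph p n, |f x| ≤ 6 * L := by
  intro x hx
  obtain ⟨y, hy, hy0⟩ := exists_nonpos hp hf hmean
  obtain ⟨z, hz, hz0⟩ := exists_nonpos hp (f := fun x => -f x) (by fun_prop) (by rw [integral_neg, hmean, neg_zero])
  have h1 := abs_le.1 (lp_oscillation hp hn f h hug hL0 hL x y hx hy)
  have h2 := abs_le.1 (lp_oscillation hp hn f h hug hL0 hL x z hx hz)
  rw [abs_le]
  constructor <;> linarith

lemma markov_LN [NeZero n] (hp : 2 ≤ p) {r t c : ℝ} (hr : 0 < r) (ht : 0 < t) (hc : 0 ≤ c) {f : EuclideanSpace ℝ (Fin n) → ℝ}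
    (hf : ContinuousOn f (Sph p n)) (h : LN p n r f ≤ c * t) :
    coneMeasureE p n {x | t ≤ |f x|} ≤ ENNReal.ofReal (c ^ r) := by
  have h1 := mul_meas_ge_le_lintegral₀ (μ := coneMeasureE p n) (f := fun x => ENNReal.ofReal (|f x| ^ r))
    ((cont_aesm hp hf).aemeasurable.norm.pow_const r).ennreal_ofReal (ENNReal.ofReal (t ^ r))
  have hfin : ∫⁻ x, ENNReal.ofReal (|f x| ^ r) ∂(coneMeasureE p n) ≠ ⊤ := by
    have := ENNReal.rpow_ne_top_of_nonneg hr.le (eLp_ne_top hp hr hf)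
    rw [← lintegral_rpow_enorm_eq_rpow_eLpNorm' hr] at this
    convert this using 3 with x
    rw [← ENNReal.ofReal_rpow_of_nonneg (abs_nonneg _) hr.le, ← Real.enorm_eq_ofReal_abs]
  have h2 : ∫⁻ x, ENNReal.ofReal (|f x| ^ r) ∂(coneMeasureE p n) ≤ ENNReal.ofReal (t ^ r) * ENNReal.ofReal (c ^ r) := by
    rw [← ENNReal.ofReal_toReal hfin, ← LN_rpow hp hr, ← ENNReal.ofReal_mul (by positivity),
      ← Real.mul_rpow ht.le hc]
    exact ENNReal.ofReal_le_ofReal (Real.rpow_le_rpow (LN_nonneg _ _) (by linarith) hr.le)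
  have h3 : {x | t ≤ |f x|} ⊆ {x | ENNReal.ofReal (t ^ r) ≤ ENNReal.ofReal (|f x| ^ r)} := by
    intro x hx
    have hx : t ≤ |f x| := hx
    exact ENNReal.ofReal_le_ofReal (Real.rpow_le_rpow ht.le hx hr.le)
  have h4 : ENNReal.ofReal (t ^ r) * coneMeasureE p n {x | t ≤ |f x|} ≤ ENNReal.ofReal (t ^ r) * ENNReal.ofReal (c ^ r) :=
    (mul_le_mul_right (measure_mono h3) _).trans (h1.trans h2)
  have ht0 : ENNReal.ofReal (t ^ r) ≠ 0 := by simp only [ne_eq, ENNReal.ofReal_eq_zero, not_le]; positivity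
  exact (ENNReal.mul_le_mul_iff_right ht0 ENNReal.ofReal_ne_top).1 h4

end supp

section tailb

noncomputable def Cpd (p : ℝ) (d : ℕ) : ℝ := Real.log 2 ^ p / (3 ^ (p - 1) * 4 ^ (2 * p - 1) * p ^ 2 * (p - 1) ^ (p - 1) *
              (d : ℝ) ^ p * Real.exp 1 ^ p)

lemma Cpd_pos {p : ℝ} (hp : 2 ≤ p) {d : ℕ} (hd : 1 ≤ d) : 0 < Cpd p d := by
  have h1 : 0 < Real.log 2 := Real.log_pos (by norm_num)
  have h2 : 0 < p - 1 := by linarith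
  have h3 : (0 : ℝ) < d := by exact_mod_cast hd
  unfold Cpd; positivity

lemma const_aux {p : ℝ} (hp : 2 ≤ p) :
    (2 ^ (p - 1) - 1) * (Real.log 2 / 48) ^ (p - 1) / (2 * p) ≤ (0.0602 : ℝ) ^ p := by
  have hl0 : 0 < Real.log 2 := Real.log_pos (by norm_num)
  have hl := Real.log_two_lt_d9
  obtain ⟨y, rfl⟩ : ∃ y, p = y + 2 := ⟨p - 2, by ring⟩
  have hy : 0 ≤ y := by linarith
  set L := Real.log 2 / 48 with hL
  have hL0 : 0 < L := by positivity
  have e1 : y + 2 - 1 = y + 1 := by ring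
  rw [e1, Real.rpow_add (by norm_num), Real.rpow_add hL0, Real.rpow_add (by norm_num : (0:ℝ) < 0.0602), Real.rpow_one, Real.rpow_one,
    Real.rpow_two]
  have h2 : (1 : ℝ) ≤ 2 ^ y := Real.one_le_rpow (by norm_num) hy
  have h4 : (4 : ℝ) ^ y = 2 ^ y * 2 ^ y := by rw [← Real.mul_rpow (by norm_num) (by norm_num)]; norm_num
  have h5 : (2 : ℝ) ^ y * 2 - 1 ≤ 4 ^ y := by rw [h4]; nlinarith [sq_nonneg ((2 : ℝ) ^ y - 1)]
  have h6 : (4 : ℝ) ^ y * L ^ y ≤ 0.0602 ^ y := by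
    rw [← Real.mul_rpow (by norm_num) hL0.le]
    exact Real.rpow_le_rpow (by positivity) (by rw [hL]; linarith) hy
  have hLy : 0 < L ^ y := by positivity
  rw [div_le_iff₀ (by positivity)]
  have h7 : (2 ^ y * 2 - 1) * L ^ y ≤ 0.0602 ^ y := (mul_le_mul_of_nonneg_right h5 hLy.le).trans h6
  have h8 : L ≤ 0.0602 ^ 2 * 4 := by rw [hL]; norm_num; linarith
  have h9 : (0:ℝ) < 0.0602 ^ y := by positivity
  calc (2 ^ y * 2 - 1) * (L ^ y * L) = ((2 ^ y * 2 - 1) * L ^ y) * L := by ring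
    _ ≤ 0.0602 ^ y * (0.0602 ^ 2 * 4) := mul_le_mul h7 h8 hL0.le h9.le
    _ ≤ 0.0602 ^ y * (0.0602 ^ 2) * (2 * (y + 2)) := by nlinarith

lemma const_eq {p : ℝ} (hp : 2 ≤ p) {d : ℕ} (hd : 1 ≤ d) :
    (p - 1) ^ (p - 1) * (2 ^ (p - 1) - 1) * (2 * p * Cpd p d / Real.log 2)
      = (2 ^ (p - 1) - 1) * (Real.log 2 / 48) ^ (p - 1) / (2 * p) / (d * Real.exp 1) ^ p := by
  have hl0 : 0 < Real.log 2 := Real.log_pos (by norm_num)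
  have h2 : 0 < p - 1 := by linarith
  have h3 : (0 : ℝ) < d := by exact_mod_cast hd
  have hp0 : 0 < p := by linarith
  have e1 : Real.log 2 ^ p = Real.log 2 ^ (p - 1) * Real.log 2 := by
    rw [← Real.rpow_add_one hl0.ne']; congr 1; ring
  have e2 : (4 : ℝ) ^ (2 * p - 1) = 4 * 16 ^ (p - 1) := by
    rw [show (16 : ℝ) = 4 ^ (2 : ℝ) by norm_num, ← Real.rpow_mul (by norm_num), mul_comm (4:ℝ),
      ← Real.rpow_add_one (by norm_num)]; congr 1; ring
  have e3 : (48 : ℝ) ^ (p - 1) = 3 ^ (p - 1) * 16 ^ (p - 1) := by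
    rw [← Real.mul_rpow (by norm_num) (by norm_num)]; norm_num
  unfold Cpd
  rw [e1, e2, Real.div_rpow hl0.le (by norm_num), e3, Real.mul_rpow h3.le (Real.exp_pos 1).le]
  have : 0 < (p - 1) ^ (p - 1) := by positivity
  have : (0:ℝ) < 3 ^ (p - 1) := by positivity
  have : (0:ℝ) < 16 ^ (p - 1) := by positivity
  have : (0:ℝ) < (d:ℝ) ^ p := by positivity
  have : (0:ℝ) < Real.exp 1 ^ p := by positivity
  have : 0 < Real.log 2 ^ (p - 1) := by positivity
  field_simp
  ring

lemma Bc_le {n : ℕ} [NeZero n] {p : ℝ} (hp : 2 ≤ p) {d : ℕ} (hd : 1 ≤ d) {b : ℝ} (hb : 0 < b) :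
    Bc p n (n * b ^ p * (2 * p * Cpd p d / Real.log 2)) ≤ 0.0602 / (d * Real.exp 1) * b := by
  have hl0 : 0 < Real.log 2 := Real.log_pos (by norm_num)
  have h2 : 0 < p - 1 := by linarith
  have h3 : (0 : ℝ) < d := by exact_mod_cast hd
  have hp0 : 0 < p := by linarith
  have hn : (n : ℝ) ≠ 0 := by exact_mod_cast NeZero.ne n
  have hC := Cpd_pos hp hd
  have haux := cpc_aux hp
  have e : (p - 1) ^ (p - 1) * (n * b ^ p * (2 * p * Cpd p d / Real.log 2) / (n * cpc p))
      = ((p - 1) ^ (p - 1) * (2 ^ (p - 1) - 1) * (2 * p * Cpd p d / Real.log 2)) * b ^ p := by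
    unfold cpc
    have : (2 : ℝ) ^ (p - 1) - 1 ≠ 0 := by linarith
    field_simp
  unfold Bc
  rw [e, const_eq hp hd]
  have h4 : (0.0602 / (d * Real.exp 1) * b : ℝ) = ((0.0602 / (d * Real.exp 1) * b : ℝ) ^ p) ^ (1 / p) := by
    rw [← Real.rpow_mul (by positivity), mul_one_div_cancel hp0.ne', Real.rpow_one]
  rw [h4]
  apply Real.rpow_le_rpow
  · have : (0:ℝ) ≤ 2 ^ (p - 1) - 1 := by linarith
    positivity
  · rw [Real.mul_rpow (by positivity) hb.le, Real.div_rpow (by norm_num : (0:ℝ) ≤ 0.0602) (by positivity)]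
    gcongr
    exact const_aux hp
  · positivity

end tailb

section tailc
variable {n : ℕ} {p : ℝ}

lemma rec_down {d : ℕ} (hd : 1 ≤ d) {a M : ℕ → ℝ} {B T b t : ℝ} (ht : 0 < t) (hb : 0 < b) (hB0 : 0 ≤ B)
    (hBT : B ≤ T * b) (hT : 2 * T ≤ 0.0444) (hB : B ≤ 0.1329)
    (ha : ∀ k, 1 ≤ k → k ≤ d → 0 ≤ a k)
    (hM : ∀ k, 1 ≤ k → k < d → M k * b ^ k ≤ t)
    (had : a d * b ^ d ≤ t)
    (hrec : ∀ k, 1 ≤ k → k < d → a k ≤ M k + B * (a k + 2 * a (k + 1))) : a 1 * b ≤ 1.22 * t := by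
  have key : ∀ j, j + 1 ≤ d → a (d - j) * b ^ (d - j) ≤ 1.22 * t := by
    intro j
    induction j with
    | zero => intro _; simp only [Nat.sub_zero]; linarith
    | succ j ih =>
      intro hj
      have ih := ih (by omega)
      obtain ⟨k, hk⟩ : ∃ k, k = d - (j + 1) := ⟨_, rfl⟩
      have e : d - j = k + 1 := by omega
      rw [e] at ih
      rw [← hk]
      have h1 := hrec k (by omega) (by omega)
      have h2 := hM k (by omega) (by omega)
      have h3 := ha k (by omega) (by omega)
      have h4 := ha (k + 1) (by omega) (by omega)
      have hbk : 0 < b ^ k := by positivity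
      set x := a k * b ^ k with hx
      have hx0 : 0 ≤ x := by positivity
      have h5 : x ≤ M k * b ^ k + B * x + 2 * B * (a (k + 1) * b ^ k) := by
        have := mul_le_mul_of_nonneg_right h1 hbk.le
        rw [hx]; nlinarith
      have h6 : 2 * B * (a (k + 1) * b ^ k) ≤ 2 * T * (a (k + 1) * b ^ (k + 1)) := by
        have : 0 ≤ a (k + 1) * b ^ k := by positivity
        rw [pow_succ]; nlinarith
      have h7 : 2 * T * (a (k + 1) * b ^ (k + 1)) ≤ 0.0444 * (1.22 * t) := by
        have : 0 ≤ a (k + 1) * b ^ (k + 1) := by positivity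
        exact mul_le_mul hT ih this (by norm_num)
      have h8 : B * x ≤ 0.1329 * x := by gcongr
      nlinarith
  have := key (d - 1) (by omega)
  rw [show d - (d - 1) = 1 by omega] at this
  simpa using this

lemma sup_down [NeZero n] (hp : 2 ≤ p) (hn : 2 ≤ n) {q : ℝ} (hq : 0 < q) {d : ℕ} (hd : 1 ≤ d)
    {F : ℕ → EuclideanSpace ℝ (Fin n) → ℝ} {b t Md : ℝ} (ht : 0 < t) (hb : 6 * d < b)
    (hF : ∀ k, 1 ≤ k → k ≤ d → ContinuousOn (F k) (Sph p n))
    (hF0 : ∀ k, 1 ≤ k → ∀ x, 0 ≤ F k x)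
    (hug : ∀ k, 1 ≤ k → k < d → UG p (F k) (F (k + 1)))
    (hM : ∀ k, 1 ≤ k → k < d → LN p n q (F k) * b ^ k ≤ t)
    (hMd : ∀ x ∈ Sph p n, F d x ≤ Md) (hMdt : Md * b ^ d ≤ t) :
    ∃ L, 0 ≤ L ∧ 6 * L < t ∧ ∀ x ∈ Sph p n, F 1 x ≤ L := by
  have hd1 : (1 : ℝ) ≤ d := by exact_mod_cast hd
  have hb0 : 0 < b := by linarith
  -- F (d-j) ≤ (j+1) t / b^(d-j)
  have key : ∀ j : ℕ, j + 1 ≤ d → ∀ x ∈ Sph p n, F (d - j) x ≤ (j + 1) * (t / b ^ (d - j)) := by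
    intro j
    induction j with
    | zero =>
      intro _ x hx
      simp only [Nat.sub_zero, Nat.cast_zero, zero_add, one_mul]
      exact (hMd x hx).trans (by rwa [le_div_iff₀ (by positivity)])
    | succ j ih =>
      intro hj x hx
      have ih := ih (by omega)
      obtain ⟨k, hk⟩ : ∃ k, k = d - (j + 1) := ⟨_, rfl⟩
      have e : d - j = k + 1 := by omega
      rw [e] at ih
      rw [← hk]
      obtain ⟨y, hy, hyL⟩ := exists_le_LN hp hq (hF k (by omega) (by omega)) (fun x _ => hF0 k (by omega) x)
      have hM1 : LN p n q (F k) ≤ t / b ^ k := by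
        rw [le_div_iff₀ (by positivity)]; exact hM k (by omega) (by omega)
      have h1 := (abs_le.1 (lp_oscillation hp hn (F k) (F (k + 1)) (hug k (by omega) (by omega))
        (by positivity) ih x y hx hy)).2
      have h2 : 6 * ((j + 1) * (t / b ^ (k + 1))) ≤ (j + 1) * (t / b ^ k) := by
        have : t / b ^ (k + 1) * b = t / b ^ k := by rw [pow_succ]; field_simp
        have h0 : 0 < t / b ^ (k + 1) := by positivity
        have : 6 * (t / b ^ (k + 1)) ≤ t / b ^ k := by rw [← this]; nlinarith
        have hj0 : (0 : ℝ) ≤ j + 1 := by positivity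
        nlinarith
      push_cast
      linarith
  have := key (d - 1) (by omega)
  rw [show d - (d - 1) = 1 by omega, Nat.cast_sub hd, pow_one] at this
  refine ⟨d * (t / b), by positivity, ?_, fun x hx => by simpa using this x hx⟩
  have h0 : 0 < t / b := by positivity
  calc 6 * (d * (t / b)) = 6 * d * (t / b) := by ring
    _ < b * (t / b) := by gcongr
    _ = t := by field_simp

theorem cone_tail [NeZero n] (hp : 2 ≤ p) (hn : 3 ≤ n) {q : ℝ} (hpq : p.HolderConjugate q) {d : ℕ} (hd : 1 ≤ d)
    {f : EuclideanSpace ℝ (Fin n) → ℝ}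
    {U : Set (EuclideanSpace ℝ (Fin n))} (hU : IsOpen U) (hsub : Sph p n ⊆ U) (hf : ContDiffOn ℝ (d : ℕ∞) f U)
    (hmean : ∫ x, f x ∂(coneMeasureE p n) = 0) {t b Md : ℝ} (ht : 0 < t) (hb : 0 < b)
    (hM : ∀ k, 1 ≤ k → k < d → LN p n q (fun x => opNormQE p (iteratedFDeriv ℝ k f x)) * b ^ k ≤ t)
    (hMd : ∀ x ∈ Sph p n, opNormQE p (iteratedFDeriv ℝ d f x) ≤ Md) (hMdt : Md * b ^ d ≤ t) :
    coneMeasureE p n {x | t ≤ |f x|} ≤ ENNReal.ofReal (2 * Real.exp (-(Cpd p d * n * b ^ p))) := by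
  have := cone_prob (n := n) hp
  have hq0 : 0 < q := by linarith [hpq.symm.lt]
  have hp0 : 0 < p := by linarith
  have hd1 : (1 : ℝ) ≤ d := by exact_mod_cast hd
  have hn0 : (0 : ℝ) < n := by exact_mod_cast (by omega : 0 < n)
  have hl0 : 0 < Real.log 2 := Real.log_pos (by norm_num)
  have hC := Cpd_pos hp hd
  set F : ℕ → EuclideanSpace ℝ (Fin n) → ℝ := fun k x => opNormQE p (iteratedFDeriv ℝ k f x) with hFdef
  have hat : ∀ x ∈ Sph p n, ContDiffAt ℝ (d : ℕ∞) f x := fun x hx => hf.contDiffAt (hU.mem_nhds (hsub hx))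
  have hfc : ContinuousOn f (Sph p n) := fun x hx => (hat x hx).continuousAt.continuousWithinAt
  have hF : ∀ k, 1 ≤ k → k ≤ d → ContinuousOn (F k) (Sph p n) := fun k _ hk x hx =>
    (F_contAt hp hk (hat x hx)).continuousWithinAt
  have hF0 : ∀ k, 1 ≤ k → ∀ x, 0 ≤ F k x := by
    intro k hk x
    obtain ⟨k, rfl⟩ : ∃ j, k = j + 1 := ⟨k - 1, by omega⟩
    exact op_nonneg hp _
  have hug : ∀ k, 1 ≤ k → k < d → UG p (F k) (F (k + 1)) := fun k _ hk => UG_F hp hk hU hsub hf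
  have hugf : UG p f (F 1) := UG_f hp hd hU hsub hf
  rcases lt_or_ge (6 * (d : ℝ)) b with hbd | hbd
  · obtain ⟨L, hL0, hLt, hL⟩ := sup_down hp (by omega) hq0 hd ht hbd hF hF0 hug hM hMd hMdt
    have hs := sup_bound hp (by omega) hL0 hfc hmean hugf hL
    have : coneMeasureE p n {x | t ≤ |f x|} = 0 := by
      rw [measure_eq_zero_iff_ae_notMem]
      filter_upwards [cone_mem_Sph hp] with x hx hx2
      have hx2 : t ≤ |f x| := hx2
      linarith [hs x hx]
    rw [this]; exact bot_le
  set r := n * b ^ p * (2 * p * Cpd p d / Real.log 2) with hr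
  have hCr : Cpd p d * n * b ^ p = Real.log 2 / (2 * p) * r := by rw [hr]; field_simp
  have hr0 : 0 < r := by positivity
  rw [hCr]
  rcases lt_or_ge r (2 * p) with hrp | hrp
  · refine prob_le_one.trans ?_
    rw [ENNReal.one_le_ofReal]
    have : Real.log 2 / (2 * p) * r ≤ Real.log 2 := by
      rw [div_mul_eq_mul_div, div_le_iff₀ (by positivity)]; gcongr
    have h2 : Real.exp (-Real.log 2) ≤ Real.exp (-(Real.log 2 / (2 * p) * r)) := by gcongr
    rw [Real.exp_neg, Real.exp_log (by norm_num)] at h2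
    linarith
  set T := 0.0602 / (d * Real.exp 1) with hT
  have hBT : Bc p n r ≤ T * b := Bc_le hp hd hb
  have hB0 : 0 ≤ Bc p n r := Bc_nonneg hp hr0.le
  have he := Real.exp_one_gt_d9
  have hde : 0 < d * Real.exp 1 := by positivity
  have hTe : T ≤ 0.0602 / Real.exp 1 := by
    rw [hT]; gcongr; nlinarith
  have hTd : T * d = 0.0602 / Real.exp 1 := by rw [hT]; field_simp
  have h062 : 0.0602 / Real.exp 1 ≤ 0.02215 := by
    rw [div_le_iff₀ (by positivity)]; nlinarith
  have hT0 : 0 < T := by positivity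
  have hB : Bc p n r ≤ 0.1329 := by
    have : T * b ≤ T * (6 * d) := by gcongr
    nlinarith
  have hrec := rec_down (a := fun k => LN p n r (F k)) (M := fun k => LN p n q (F k)) hd ht hb hB0 hBT (by linarith) hB
    (fun k _ _ => LN_nonneg _ _) hM
    (by
      refine le_trans ?_ hMdt
      have hMd0 : 0 ≤ Md := by
        obtain ⟨x, hx⟩ := Sph_nonempty (n := n) hp
        exact (hF0 d hd x).trans (hMd x hx)
      have := LN_le_const hp hr0 (f := F d) hMd0 (fun x hx => by rw [abs_of_nonneg (hF0 d hd x)]; exact hMd x hx)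
      gcongr)
    (fun k hk1 hk => moment_lin hp hpq (by linarith) (F k) (F (k + 1)) (hF k hk1 hk.le) (hF (k + 1) (by omega) hk)
      (fun x _ => hF0 k hk1 x) (fun x _ => hF0 _ (by omega) x) (hug k hk1 hk))
  have hmz := mean_zero_moment hp hpq hrp f (F 1) hfc (hF 1 le_rfl hd) (fun x _ => hF0 1 le_rfl x) hugf hmean (by linarith)
  have hrec : LN p n r (F 1) * b ≤ 1.22 * t := hrec
  have hLN0 := LN_nonneg (p := p) r (F 1)
  have hfin : LN p n r f ≤ Real.exp (-1) * t := by
    refine hmz.trans ?_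
    have h1 : Bc p n r * LN p n r (F 1) ≤ 0.0602 / Real.exp 1 * (1.22 * t) := by
      calc Bc p n r * LN p n r (F 1) ≤ (T * b) * LN p n r (F 1) := by gcongr
        _ = T * (LN p n r (F 1) * b) := by ring
        _ ≤ _ := by gcongr
    have h2 : 4 * Bc p n r * LN p n r (F 1) / (1 - 2 * Bc p n r) ≤ 4 * (0.0602 / Real.exp 1 * (1.22 * t)) / 0.7342 := by
      apply div_le_div₀ (by positivity) (by linarith) (by norm_num) (by linarith)
    rw [Real.exp_neg]
    have : 0 < (Real.exp 1)⁻¹ * t := by positivity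
    rw [div_eq_mul_inv 0.0602] at h2
    calc _ ≤ 2 * (1.2 * (4 * (0.0602 * (Real.exp 1)⁻¹ * (1.22 * t)) / 0.7342)) := by linarith
      _ = (2 * 1.2 * 4 * 0.0602 * 1.22 / 0.7342) * ((Real.exp 1)⁻¹ * t) := by ring
      _ ≤ 1 * ((Real.exp 1)⁻¹ * t) := by gcongr; norm_num
      _ = _ := one_mul _
  refine (markov_LN hp hr0 ht (Real.exp_pos _).le hfc hfin).trans (ENNReal.ofReal_le_ofReal ?_)
  rw [← Real.exp_mul]
  have h2p : Real.log 2 / (2 * p) ≤ 1 := by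
    rw [div_le_one (by positivity)]; linarith [Real.log_two_lt_d9]
  calc Real.exp (-1 * r) ≤ Real.exp (-(Real.log 2 / (2 * p) * r)) := by
        apply Real.exp_le_exp.2; nlinarith
    _ ≤ _ := by linarith [Real.exp_pos (-(Real.log 2 / (2 * p) * r))]

end tailc

section plane
variable {m : ℕ}

noncomputable def Jm (m : ℕ) (y : ℝ × EuclideanSpace ℝ (Fin m)) : EuclideanSpace ℝ (Fin (m + 1)) :=
  WithLp.toLp 2 (Fin.cons y.1 (WithLp.ofLp y.2) : Fin (m + 1) → ℝ)

lemma Jm_zero (y : ℝ × EuclideanSpace ℝ (Fin m)) : Jm m y 0 = y.1 := rfl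
lemma Jm_succ (y : ℝ × EuclideanSpace ℝ (Fin m)) (i : Fin m) : Jm m y i.succ = y.2 i := rfl

lemma Jm_eta (y : EuclideanSpace ℝ (Fin (m + 1))) :
    Jm m (y 0, WithLp.toLp 2 (fun i => y i.succ)) = y := by
  ext i
  refine Fin.cases ?_ (fun i => ?_) i <;> rfl

lemma Jm_smul (c s : ℝ) (z : EuclideanSpace ℝ (Fin m)) : c • Jm m (s, z) = Jm m (c * s, c • z) := by
  ext i
  refine Fin.cases ?_ (fun i => ?_) i
  · simp [Jm_zero]
  · simp [Jm_succ]

lemma Jm_mp : MeasurePreserving (Jm m) volume volume := by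
  have h1 : MeasurePreserving (MeasurableEquiv.piFinSuccAbove (fun _ : Fin (m + 1) => ℝ) 0).symm volume volume :=
    (volume_preserving_piFinSuccAbove (fun _ : Fin (m + 1) => ℝ) 0).symm
  have h2 : MeasurePreserving (Prod.map (id : ℝ → ℝ) (WithLp.ofLp : EuclideanSpace ℝ (Fin m) → (Fin m → ℝ)))
      (volume.prod volume) (volume.prod volume) :=
    (MeasurePreserving.id volume).prod (PiLp.volume_preserving_ofLp (Fin m))
  have h3 := (PiLp.volume_preserving_toLp (Fin (m + 1))).comp (h1.comp h2)
  have e : Jm m = (WithLp.toLp 2 ∘ (MeasurableEquiv.piFinSuccAbove (fun _ : Fin (m + 1) => ℝ) 0).symm ∘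
      Prod.map (id : ℝ → ℝ) (WithLp.ofLp : EuclideanSpace ℝ (Fin m) → (Fin m → ℝ))) := by
    funext y
    ext i
    refine Fin.cases ?_ (fun i => ?_) i <;> rfl
  rw [e]
  exact h3

lemma Jm_isom (a : ℝ) : Isometry (fun z => Jm m (a, z)) := by
  refine Isometry.of_dist_eq fun x y => ?_
  rw [EuclideanSpace.dist_eq, EuclideanSpace.dist_eq, Fin.sum_univ_succ]
  simp [Jm_zero, Jm_succ]

lemma haus_const (m : ℕ) : ∃ c : ENNReal, c ≠ 0 ∧ c ≠ ⊤ ∧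
    (μH[(m : ℝ)] : Measure (EuclideanSpace ℝ (Fin m))) = c • volume := by
  have h := isAddHaarMeasure_hausdorffMeasure (E := EuclideanSpace ℝ (Fin m))
  simp only [finrank_euclideanSpace, Fintype.card_fin] at h
  have := Measure.isAddLeftInvariant_eq_smul (μH[(m : ℝ)] : Measure (EuclideanSpace ℝ (Fin m))) volume
  have h2 := Measure.addHaarScalarFactor_pos_of_isAddHaarMeasure (μH[(m : ℝ)] : Measure (EuclideanSpace ℝ (Fin m))) volume
  refine ⟨(Measure.addHaarScalarFactor (μH[(m : ℝ)] : Measure (EuclideanSpace ℝ (Fin m))) volume : NNReal), ?_, ENNReal.coe_ne_top, ?_⟩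
  · exact_mod_cast h2.ne'
  · exact this

lemma int_pow {a : ℝ} (ha : 0 < a) :
    ∫⁻ s in Set.Ioc 0 a, ENNReal.ofReal ((s / a) ^ m) = ENNReal.ofReal (a / (m + 1)) := by
  rw [← ofReal_integral_eq_lintegral_ofReal]
  · rw [← intervalIntegral.integral_of_le ha.le]
    congr 1
    simp only [div_pow]
    rw [intervalIntegral.integral_div, integral_pow]
    simp; field_simp; ring
  · refine (intervalIntegrable_iff_integrableOn_Ioc_of_le ha.le).1 ?_
    apply Continuous.intervalIntegrable; fun_prop
  · filter_upwards [ae_restrict_mem measurableSet_Ioc] with s hs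
    have := hs.1
    positivity

lemma plane_vol {D : Set (EuclideanSpace ℝ (Fin (m + 1)))} (hD : MeasurableSet D)
    (hrad : ∀ s > (0:ℝ), ∀ y, s • y ∈ D ↔ y ∈ D) {a : ℝ} (ha : 0 < a) :
    volume {y | y ∈ D ∧ 0 < y 0 ∧ y 0 ≤ a} = ENNReal.ofReal (a / (m + 1)) * volume {z | Jm m (a, z) ∈ D} := by
  have hms : MeasurableSet {y : EuclideanSpace ℝ (Fin (m + 1)) | y ∈ D ∧ 0 < y 0 ∧ y 0 ≤ a} := by
    refine hD.inter (MeasurableSet.inter ?_ ?_)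
    · exact measurableSet_lt (f := fun _ => (0:ℝ)) (g := fun y : EuclideanSpace ℝ (Fin (m + 1)) => y 0) measurable_const (by fun_prop)
    · exact measurableSet_le (f := fun y : EuclideanSpace ℝ (Fin (m + 1)) => y 0) (g := fun _ => a) (by fun_prop) measurable_const
  rw [← Jm_mp.measure_preimage hms.nullMeasurableSet, Measure.volume_eq_prod,
    Measure.prod_apply (Jm_mp.measurable hms)]
  have : ∀ s : ℝ, volume (Prod.mk s ⁻¹' (Jm m ⁻¹' {y | y ∈ D ∧ 0 < y 0 ∧ y 0 ≤ a})) =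
      (Set.Ioc 0 a).indicator (fun s => ENNReal.ofReal ((s / a) ^ m) * volume {z | Jm m (a, z) ∈ D}) s := by
    intro s
    by_cases hs : s ∈ Set.Ioc 0 a
    · rw [Set.indicator_of_mem hs]
      have hs0 := hs.1
      have e : Prod.mk s ⁻¹' (Jm m ⁻¹' {y | y ∈ D ∧ 0 < y 0 ∧ y 0 ≤ a}) =
          (fun z => (a / s) • z) ⁻¹' {z | Jm m (a, z) ∈ D} := by
        ext z
        show (Jm m (s, z) ∈ D ∧ 0 < s ∧ s ≤ a) ↔ Jm m (a, (a / s) • z) ∈ D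
        rw [← hrad (a / s) (by positivity) (Jm m (s, z)), Jm_smul, div_mul_cancel₀ _ hs0.ne']
        exact ⟨fun h => h.1, fun h => ⟨h, hs.1, hs.2⟩⟩
      rw [e, Measure.addHaar_preimage_smul _ (by positivity)]
      congr 2
      rw [finrank_euclideanSpace, Fintype.card_fin, abs_of_pos (by positivity), ← inv_pow, inv_div]
    · rw [Set.indicator_of_notMem hs]
      have e : Prod.mk s ⁻¹' (Jm m ⁻¹' {y | y ∈ D ∧ 0 < y 0 ∧ y 0 ≤ a}) = ∅ := by
        ext z
        simp only [Set.mem_empty_iff_false, iff_false]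
        rintro ⟨-, h1, h2⟩
        exact hs ⟨h1, h2⟩
      rw [e, measure_empty]
  simp_rw [this]
  rw [lintegral_indicator measurableSet_Ioc, lintegral_mul_const _ (by fun_prop), int_pow ha]

lemma plane_haus (D : Set (EuclideanSpace ℝ (Fin (m + 1)))) (a : ℝ) :
    μH[(m : ℝ)] {y | y ∈ D ∧ y 0 = a} = μH[(m : ℝ)] {z | Jm m (a, z) ∈ D} := by
  rw [← (Jm_isom (m := m) a).hausdorffMeasure_image (Or.inl (by positivity))]
  apply congrArg
  ext y
  constructor
  · rintro ⟨h1, h2⟩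
    refine ⟨WithLp.toLp 2 (fun i => y i.succ), ?_, ?_⟩
    · show Jm m _ ∈ D
      rw [← h2, Jm_eta]; exact h1
    · show Jm m _ = y
      rw [← h2, Jm_eta]
  · rintro ⟨z, hz, rfl⟩
    exact ⟨hz, rfl⟩

lemma plane (m : ℕ) : ∃ κ : ENNReal, κ ≠ 0 ∧ κ ≠ ⊤ ∧ ∀ (D : Set (EuclideanSpace ℝ (Fin (m + 1)))) (hD : MeasurableSet D)
    (hrad : ∀ s > (0:ℝ), ∀ y, s • y ∈ D ↔ y ∈ D) (g : EuclideanSpace ℝ (Fin (m + 1))) (hg : g ≠ 0),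
    μH[(m : ℝ)] {y | y ∈ D ∧ inner ℝ g y = 1} = κ * ENNReal.ofReal ‖g‖ * volume {y | y ∈ D ∧ 0 < inner ℝ g y ∧ inner ℝ g y ≤ 1} := by
  obtain ⟨c, hc0, hct, hc⟩ := haus_const m
  refine ⟨c * ENNReal.ofReal (m + 1), ?_, ?_, ?_⟩
  · refine mul_ne_zero hc0 ?_
    simp only [ne_eq, ENNReal.ofReal_eq_zero, not_le]; positivity
  · exact ENNReal.mul_ne_top hct ENNReal.ofReal_ne_top
  intro D hD hrad g hg
  have hg0 : 0 < ‖g‖ := norm_pos_iff.2 hg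
  set e0 : EuclideanSpace ℝ (Fin (m + 1)) := EuclideanSpace.single 0 1 with he0
  have hn : ‖g‖ = ‖‖g‖ • e0‖ := by rw [norm_smul, he0]; simp
  set R := (ℝ ∙ (g - ‖g‖ • e0))ᗮ.reflection with hR
  have hRg : R g = ‖g‖ • e0 := Submodule.reflection_sub hn
  have hin : ∀ y, inner ℝ g (R.symm y) = ‖g‖ * y 0 := by
    intro y
    rw [← R.inner_map_map, hRg, LinearIsometryEquiv.apply_symm_apply, inner_smul_left, he0, EuclideanSpace.inner_single_left]
    simp
  have hrad' : ∀ s > (0:ℝ), ∀ y, s • y ∈ R.symm ⁻¹' D ↔ y ∈ R.symm ⁻¹' D := by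
    intro s hs y
    show R.symm (s • y) ∈ D ↔ R.symm y ∈ D
    rw [map_smul, hrad s hs]
  have hD' : MeasurableSet (R.symm ⁻¹' D) := R.symm.continuous.measurable hD
  have h1 := plane_vol hD' hrad' (a := 1 / ‖g‖) (by positivity)
  have h2 := plane_haus (R.symm ⁻¹' D) (1 / ‖g‖)
  have e1 : {y | y ∈ R.symm ⁻¹' D ∧ 0 < y 0 ∧ y 0 ≤ 1 / ‖g‖} = R.symm ⁻¹' {y | y ∈ D ∧ 0 < inner ℝ g y ∧ inner ℝ g y ≤ 1} := by
    ext y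
    show (R.symm y ∈ D ∧ 0 < y 0 ∧ y 0 ≤ 1 / ‖g‖) ↔ (R.symm y ∈ D ∧ 0 < inner ℝ g (R.symm y) ∧ inner ℝ g (R.symm y) ≤ 1)
    rw [hin, mul_pos_iff_of_pos_left hg0, le_div_iff₀' hg0]
  have e2 : {y | y ∈ R.symm ⁻¹' D ∧ y 0 = 1 / ‖g‖} = R.symm ⁻¹' {y | y ∈ D ∧ inner ℝ g y = 1} := by
    ext y
    show (R.symm y ∈ D ∧ y 0 = 1 / ‖g‖) ↔ (R.symm y ∈ D ∧ inner ℝ g (R.symm y) = 1)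
    rw [hin, eq_div_iff hg0.ne', mul_comm]
  have hm : MeasurableSet {y | y ∈ D ∧ 0 < inner ℝ g y ∧ inner ℝ g y ≤ 1} := by
    refine hD.inter (MeasurableSet.inter ?_ ?_)
    · exact measurableSet_lt (f := fun _ => (0:ℝ)) (g := fun y => inner ℝ g y) measurable_const (by fun_prop)
    · exact measurableSet_le (f := fun y => inner ℝ g y) (g := fun _ => (1:ℝ)) (by fun_prop) measurable_const
  rw [e1, R.symm.measurePreserving.measure_preimage hm.nullMeasurableSet] at h1
  have h3 := R.symm.toIsometryEquiv.hausdorffMeasure_preimage (m : ℝ) {y | y ∈ D ∧ inner ℝ g y = 1}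
  simp only [LinearIsometryEquiv.coe_toIsometryEquiv] at h3
  rw [e2, h3, hc] at h2
  rw [h2, h1, Measure.smul_apply, smul_eq_mul]
  have : ENNReal.ofReal (m + 1) * ENNReal.ofReal ‖g‖ * ENNReal.ofReal (1 / ‖g‖ / (m + 1)) = 1 := by
    rw [← ENNReal.ofReal_mul (by positivity), ← ENNReal.ofReal_mul (by positivity), ← ENNReal.ofReal_one]
    congr 1; field_simp
  rw [mul_assoc c, mul_assoc c, ← mul_assoc _ _ (volume _), this, one_mul]

end plane

section localest
variable {n : ℕ} {p : ℝ}

/-- the gradient of the `ℓ_p` norm on the sphere -/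
noncomputable def gv (p : ℝ) {n : ℕ} (x : EuclideanSpace ℝ (Fin n)) : EuclideanSpace ℝ (Fin n) :=
  WithLp.toLp 2 (fun i => |x i| ^ (p - 2) * x i)

lemma gv_abs (hp : 2 ≤ p) (x : EuclideanSpace ℝ (Fin n)) (i : Fin n) : |gv p x i| = |x i| ^ (p - 1) := by
  show |(|x i| ^ (p - 2) * x i)| = _
  rw [abs_mul, abs_of_nonneg (by positivity)]
  rcases eq_or_ne (x i) 0 with h | h
  · rw [h]; simp only [abs_zero, mul_zero]
    rw [Real.zero_rpow (by linarith)]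
  · rw [← Real.rpow_add_one (by positivity)]; congr 1; ring

lemma gv_norm (hp : 2 ≤ p) (x : EuclideanSpace ℝ (Fin n)) : ‖gv p x‖ ^ 2 = ∑ i, |x i| ^ (2 * p - 2) := by
  rw [EuclideanSpace.norm_sq_eq]
  refine Finset.sum_congr rfl fun i _ => ?_
  rw [Real.norm_eq_abs, gv_abs hp, ← Real.rpow_natCast, ← Real.rpow_mul (abs_nonneg _)]
  congr 1; push_cast; ring

lemma gv_inner (x y : EuclideanSpace ℝ (Fin n)) : inner ℝ (gv p x) y = ∑ i, |x i| ^ (p - 2) * x i * y i := by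
  rw [PiLp.inner_apply]
  refine Finset.sum_congr rfl fun i _ => ?_
  show inner ℝ (|x i| ^ (p - 2) * x i) (y i) = _
  simp [mul_comm]

lemma gv_inner_self (hp : 2 ≤ p) {x : EuclideanSpace ℝ (Fin n)} (hx : x ∈ Sph p n) : inner ℝ (gv p x) x = 1 := by
  have hx1 : lpNormE p x = 1 := hx
  have := lpN_rpow hp x
  rw [hx1, Real.one_rpow] at this
  rw [gv_inner, this]
  refine Finset.sum_congr rfl fun i _ => ?_
  rcases eq_or_ne (x i) 0 with h | h
  · rw [h]; simp only [abs_zero, mul_zero]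
    rw [Real.zero_rpow (by linarith)]
  · rw [mul_assoc, ← abs_mul_abs_self, ← mul_assoc, ← Real.rpow_add_one (by positivity), ← Real.rpow_add_one (by positivity)]
    congr 1; ring

lemma gv_cont (hp : 2 ≤ p) : Continuous (gv p : EuclideanSpace ℝ (Fin n) → _) := by
  unfold gv
  refine (PiLp.continuous_toLp 2 _).comp (continuous_pi fun i => ?_)
  refine Continuous.mul ?_ (by fun_prop)
  exact Continuous.rpow_const (by fun_prop) (fun _ => Or.inr (by linarith))

lemma gv_ne (hp : 2 ≤ p) {x : EuclideanSpace ℝ (Fin n)} (hx : x ∈ Sph p n) : gv p x ≠ 0 := by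
  intro h
  have := gv_inner_self hp hx
  rw [h, inner_zero_left] at this
  norm_num at this

lemma strict_S (hp : 2 ≤ p) {x0 : EuclideanSpace ℝ (Fin n)} (hx0 : x0 ∈ Sph p n) {ε : ℝ} (hε : 0 < ε) :
    ∃ δ > 0, ∀ y ∈ Sph p n, ∀ z ∈ Sph p n, dist y x0 < δ → dist z x0 < δ →
      |inner ℝ (gv p x0) (y - z)| ≤ ε * ‖y - z‖ := by
  have hp0 : 0 < p := by linarith
  have hc : ContDiff ℝ 1 (fun y : EuclideanSpace ℝ (Fin n) => ∑ i, |y i| ^ p) := by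
    refine ContDiff.sum fun i _ => ?_
    exact (contDiff_norm_rpow (E := ℝ) (by linarith : 1 < p)).comp (by fun_prop : ContDiff ℝ 1 (fun y : EuclideanSpace ℝ (Fin n) => y i))
  have hd : HasFDerivAt (fun y : EuclideanSpace ℝ (Fin n) => ∑ i, |y i| ^ p) (p • innerSL ℝ (gv p x0)) x0 := by
    have h1 : HasFDerivAt (fun y : EuclideanSpace ℝ (Fin n) => ∑ i, |y i| ^ p)
        (∑ i, (p * |x0 i| ^ (p - 2) * x0 i) • (EuclideanSpace.proj i : EuclideanSpace ℝ (Fin n) →L[ℝ] ℝ)) x0 := by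
      refine HasFDerivAt.fun_sum fun i _ => ?_
      exact (hasDerivAt_abs_rpow (x0 i) (by linarith : 1 < p)).comp_hasFDerivAt x0
        (EuclideanSpace.proj i : EuclideanSpace ℝ (Fin n) →L[ℝ] ℝ).hasFDerivAt
    refine h1.congr_fderiv ?_
    symm
    ext y
    simp only [_root_.smul_apply, innerSL_apply_apply, _root_.sum_apply, smul_eq_mul]
    rw [gv_inner, Finset.mul_sum]
    refine Finset.sum_congr rfl fun i _ => ?_
    show _ = p * |x0 i| ^ (p - 2) * x0 i * y i
    ring
  have hs := hc.contDiffAt.hasStrictFDerivAt' hd (by norm_num)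
  have hs2 := hs.isLittleO.def (c := p * ε) (by positivity)
  rw [Metric.eventually_nhds_iff] at hs2
  obtain ⟨δ, hδ, h⟩ := hs2
  refine ⟨δ, hδ, fun y hy z hz hyx hzx => ?_⟩
  have h3 := @h (y, z) (by rw [Prod.dist_eq]; exact max_lt hyx hzx)
  have e1 : ∑ i, |y i| ^ p = 1 := by rw [← lpN_rpow hp, show lpNormE p y = 1 from hy, Real.one_rpow]
  have e2 : ∑ i, |z i| ^ p = 1 := by rw [← lpN_rpow hp, show lpNormE p z = 1 from hz, Real.one_rpow]
  simp only [e1, e2, _root_.smul_apply, innerSL_apply_apply, smul_eq_mul] at h3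
  rw [sub_self, zero_sub, norm_neg, Real.norm_eq_abs, abs_mul, abs_of_pos hp0, mul_assoc] at h3
  exact le_of_mul_le_mul_left h3 hp0

lemma proj_S [NeZero n] (hp : 2 ≤ p) {x0 : EuclideanSpace ℝ (Fin n)} (hx0 : x0 ∈ Sph p n) {η : ℝ} (hη : 0 < η) (hη1 : η < 1) :
    ∃ V : Set (EuclideanSpace ℝ (Fin n)), IsOpen V ∧ x0 ∈ V ∧ (∀ y ∈ V, |inner ℝ (gv p x0) y - 1| ≤ η) ∧
      ∀ y ∈ V ∩ Sph p n, ∀ z ∈ V ∩ Sph p n,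
        ‖(inner ℝ (gv p x0) y)⁻¹ • y - (inner ℝ (gv p x0) z)⁻¹ • z - (y - z)‖ ≤ η * ‖y - z‖ := by
  set ε := min (1 / 2) (η / (2 + 4 * n)) with hε
  have hn0 : (0 : ℝ) ≤ n := by positivity
  have hε0 : 0 < ε := by positivity
  have hε1 : ε ≤ 1 / 2 := min_le_left _ _
  have hε2 : ε * (2 + 4 * n) ≤ η := by
    rw [← le_div_iff₀ (by positivity)]; exact min_le_right _ _
  obtain ⟨δ, hδ, h⟩ := strict_S hp hx0 hε0
  have hcont : Continuous (fun y => |inner ℝ (gv p x0) y - 1|) := by fun_prop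
  refine ⟨Metric.ball x0 δ ∩ {y | |inner ℝ (gv p x0) y - 1| < ε}, Metric.isOpen_ball.inter
    (isOpen_lt hcont continuous_const), ⟨Metric.mem_ball_self hδ, ?_⟩, ?_, ?_⟩
  · show |inner ℝ (gv p x0) x0 - 1| < ε
    rw [gv_inner_self hp hx0]; simpa using hε0
  · rintro y ⟨-, hy⟩
    have hy : |inner ℝ (gv p x0) y - 1| < ε := hy
    nlinarith
  · rintro y ⟨⟨hy1, hy2⟩, hyS⟩ z ⟨⟨hz1, hz2⟩, hzS⟩
    have hy2 : |inner ℝ (gv p x0) y - 1| < ε := hy2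
    have hz2 : |inner ℝ (gv p x0) z - 1| < ε := hz2
    have h1 := h y hyS z hzS hy1 hz1
    have hzn : ‖z‖ ≤ n := by
      have := norm_le_lpN hp z
      rwa [show lpNormE p z = 1 from hzS, mul_one] at this
    rw [inner_sub_right] at h1
    set a := inner ℝ (gv p x0) y
    set b := inner ℝ (gv p x0) z
    have ha : 1 / 2 ≤ a := by linarith [(abs_lt.1 hy2).1]
    have hb : 1 / 2 ≤ b := by linarith [(abs_lt.1 hz2).1]
    have e : a⁻¹ • y - b⁻¹ • z - (y - z) = (a⁻¹ - 1) • (y - z) + (a⁻¹ - b⁻¹) • z := by module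
    have hai : a⁻¹ ≤ 2 := by rw [inv_le_comm₀ (by linarith) (by norm_num)]; linarith
    have hbi : b⁻¹ ≤ 2 := by rw [inv_le_comm₀ (by linarith) (by norm_num)]; linarith
    have ha0 : 0 < a⁻¹ := inv_pos.2 (by linarith)
    have hb0 : 0 < b⁻¹ := inv_pos.2 (by linarith)
    have hs1 : |a⁻¹ - 1| ≤ 2 * ε := by
      have : a⁻¹ - 1 = a⁻¹ * -(a - 1) := by field_simp; ring
      rw [this, abs_mul, abs_neg, abs_of_pos ha0]
      exact mul_le_mul hai hy2.le (abs_nonneg _) (by norm_num)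
    have hs2 : |a⁻¹ - b⁻¹| ≤ 4 * (ε * ‖y - z‖) := by
      have : a⁻¹ - b⁻¹ = (a⁻¹ * b⁻¹) * -(a - b) := by
        have : a ≠ 0 := by linarith
        have : b ≠ 0 := by linarith
        field_simp; ring
      rw [this, abs_mul, abs_neg, abs_of_pos (by positivity)]
      exact mul_le_mul (by nlinarith) h1 (abs_nonneg _) (by norm_num)
    rw [e]
    refine (norm_add_le _ _).trans ?_
    rw [norm_smul, norm_smul, Real.norm_eq_abs, Real.norm_eq_abs]
    have h0 := norm_nonneg (y - z)
    calc |a⁻¹ - 1| * ‖y - z‖ + |a⁻¹ - b⁻¹| * ‖z‖ ≤ 2 * ε * ‖y - z‖ + 4 * (ε * ‖y - z‖) * n := by gcongr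
      _ = ε * (2 + 4 * n) * ‖y - z‖ := by ring
      _ ≤ _ := by gcongr

end localest

section localmeas
variable {m : ℕ} {p : ℝ}

lemma local_meas (hp : 2 ≤ p) {κ : ENNReal}
    (hκ : ∀ (D : Set (EuclideanSpace ℝ (Fin (m + 1)))) (hD : MeasurableSet D)
      (hrad : ∀ s > (0:ℝ), ∀ y, s • y ∈ D ↔ y ∈ D) (g : EuclideanSpace ℝ (Fin (m + 1))) (hg : g ≠ 0),
      μH[(m : ℝ)] {y | y ∈ D ∧ inner ℝ g y = 1} = κ * ENNReal.ofReal ‖g‖ * volume {y | y ∈ D ∧ 0 < inner ℝ g y ∧ inner ℝ g y ≤ 1})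
    {x0 : EuclideanSpace ℝ (Fin (m + 1))} (hx0 : x0 ∈ Sph p (m + 1)) {s : ℝ} (hs : 1 < s) :
    ∃ V : Set (EuclideanSpace ℝ (Fin (m + 1))), IsOpen V ∧ x0 ∈ V ∧ ∀ A, MeasurableSet A → A ⊆ V ∩ Sph p (m + 1) →
      μH[(m : ℝ)] A ≤ ENNReal.ofReal s ^ (2 * m + 1) *
          (κ * ENNReal.ofReal ‖gv p x0‖ * (volume (Bal p (m + 1)) * coneMeasureE p (m + 1) A)) ∧
      κ * ENNReal.ofReal ‖gv p x0‖ * (volume (Bal p (m + 1)) * coneMeasureE p (m + 1) A)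
        ≤ ENNReal.ofReal s ^ (2 * m + 1) * μH[(m : ℝ)] A := by
  have hs0 : 0 < s := by linarith
  set η := 1 - s⁻¹ with hη
  have hsi : s⁻¹ < 1 := inv_lt_one_of_one_lt₀ hs
  have hsi0 : 0 < s⁻¹ := inv_pos.2 hs0
  have hη0 : 0 < η := by linarith
  have hη1 : η < 1 := by linarith
  have hηs : 1 + η ≤ s := by
    have : s⁻¹ * s = 1 := inv_mul_cancel₀ hs0.ne'
    nlinarith
  obtain ⟨V, hV, hxV, hV1, hV2⟩ := proj_S hp hx0 hη0 hη1
  refine ⟨V, hV, hxV, fun A hA hAV => ?_⟩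
  set g := gv p x0 with hg
  set D := prj p ⁻¹' A with hD
  have hAS : ∀ a ∈ A, lpNormE p a = 1 := fun a ha => (hAV ha).2
  have hl : ∀ a ∈ A, s⁻¹ ≤ inner ℝ g a ∧ inner ℝ g a ≤ s := fun a ha => by
    have := abs_le.1 (hV1 a (hAV ha).1)
    constructor <;> linarith
  have hDm : MeasurableSet D := prj_meas hp hA
  have hDy : ∀ y ∈ D, 0 < lpNormE p y ∧ ∃ a ∈ A, y = lpNormE p y • a := by
    intro y hy
    have hya : prj p y ∈ A := hy
    refine ⟨?_, prj p y, hya, (smul_prj hp y).symm⟩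
    apply lpN_pos hp
    rintro rfl
    have := hAS _ hya
    simp [prj, lpN_zero hp] at this
  have hrad : ∀ c > (0:ℝ), ∀ y, c • y ∈ D ↔ y ∈ D := by
    intro c hc y
    show prj p (c • y) ∈ A ↔ prj p y ∈ A
    rw [prj_smul hp hc]
  have hk := hκ D hDm hrad g (gv_ne hp hx0)
  set K := {y | y ∈ D ∧ 0 < inner ℝ g y ∧ inner ℝ g y ≤ 1} with hK
  -- volume of K
  have hμ : volume (D ∩ Bal p (m + 1)) = volume (Bal p (m + 1)) * coneMeasureE p (m + 1) A := by
    rw [cone_apply hp hA, ← mul_assoc, ENNReal.mul_inv_cancel (Bal_vol_pos hp).ne' (Bal_vol_lt hp).ne, one_mul]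
  have hK1 : volume K ≤ ENNReal.ofReal s ^ (m + 1) * (volume (Bal p (m + 1)) * coneMeasureE p (m + 1) A) := by
    rw [← hμ, ← ENNReal.ofReal_pow hs0.le, ← cone_scale hp hA hs0]
    apply measure_mono
    rintro y ⟨hy, h1, h2⟩
    refine ⟨hy, ?_⟩
    show lpNormE p y ≤ s
    obtain ⟨h0, a, ha, hya⟩ := hDy y hy
    rw [hya, inner_smul_right] at h2
    have := (hl a ha).1
    have h3 : lpNormE p y * s⁻¹ ≤ 1 := le_trans (by gcongr) h2
    rwa [← div_eq_mul_inv, div_le_one hs0] at h3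
  have hK2 : volume (Bal p (m + 1)) * coneMeasureE p (m + 1) A ≤ ENNReal.ofReal s ^ (m + 1) * volume K := by
    have h1 : ENNReal.ofReal (s⁻¹ ^ (m + 1)) * volume (D ∩ Bal p (m + 1)) ≤ volume K := by
      rw [← cone_scale hp hA hsi0]
      apply measure_mono
      rintro y ⟨hy, h1⟩
      have h1 : lpNormE p y ≤ s⁻¹ := h1
      obtain ⟨h0, a, ha, hya⟩ := hDy y hy
      have h3 := hl a ha
      refine ⟨hy, ?_, ?_⟩
      · rw [hya, inner_smul_right]
        exact mul_pos h0 (by linarith [h3.1])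
      · rw [hya, inner_smul_right]
        calc _ ≤ s⁻¹ * s := mul_le_mul h1 h3.2 (by linarith [h3.1]) hsi0.le
          _ = 1 := inv_mul_cancel₀ hs0.ne'
    rw [← hμ]
    calc volume (D ∩ Bal p (m + 1)) = ENNReal.ofReal s ^ (m + 1) * (ENNReal.ofReal (s⁻¹ ^ (m + 1)) * volume (D ∩ Bal p (m + 1))) := by
          rw [← mul_assoc, ← ENNReal.ofReal_pow hs0.le, ← ENNReal.ofReal_mul (by positivity), ← mul_pow,
            mul_inv_cancel₀ hs0.ne']; simp
      _ ≤ _ := by gcongr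
  -- the projected set
  set P : EuclideanSpace ℝ (Fin (m + 1)) → EuclideanSpace ℝ (Fin (m + 1)) := fun y => (inner ℝ g y)⁻¹ • y with hP
  have hPA : {y | y ∈ D ∧ inner ℝ g y = 1} = P '' A := by
    ext y
    constructor
    · rintro ⟨hy, h1⟩
      obtain ⟨h0, a, ha, hya⟩ := hDy y hy
      refine ⟨a, ha, ?_⟩
      rw [hya, inner_smul_right] at h1
      show (inner ℝ g a)⁻¹ • a = y
      rw [hya]
      congr 1
      exact inv_eq_of_mul_eq_one_left h1
    · rintro ⟨a, ha, rfl⟩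
      have := (hl a ha).1
      have h0 : 0 < inner ℝ g a := by linarith
      refine ⟨?_, ?_⟩
      · show prj p ((inner ℝ g a)⁻¹ • a) ∈ A
        rw [prj_smul hp (inv_pos.2 h0), prj_of_mem (hAV ha).2]; exact ha
      · show inner ℝ g ((inner ℝ g a)⁻¹ • a) = 1
        rw [inner_smul_right, inv_mul_cancel₀ h0.ne']
  have hinv : prj p '' (P '' A) = A := by
    rw [Set.image_image]
    have : Set.EqOn (fun x => prj p (P x)) id A := by
      intro a ha
      have := (hl a ha).1
      have h0 : 0 < inner ℝ g a := by linarith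
      show prj p ((inner ℝ g a)⁻¹ • a) = a
      rw [prj_smul hp (inv_pos.2 h0), prj_of_mem (hAV ha).2]
    rw [this.image_eq, Set.image_id]
  rw [hPA] at hk
  have hL1 : LipschitzOnWith s.toNNReal P A := by
    refine LipschitzOnWith.of_dist_le_mul fun y hy z hz => ?_
    rw [Real.coe_toNNReal _ hs0.le, dist_eq_norm, dist_eq_norm]
    have h1 := hV2 y (hAV hy) z (hAV hz)
    have h2 := norm_add_le (P y - P z - (y - z)) (y - z)
    rw [sub_add_cancel] at h2
    have := norm_nonneg (y - z)
    calc _ ≤ _ := h2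
      _ ≤ η * ‖y - z‖ + ‖y - z‖ := by linarith
      _ ≤ _ := by nlinarith
  have hL2 : LipschitzOnWith s.toNNReal (prj p) (P '' A) := by
    refine LipschitzOnWith.of_dist_le_mul ?_
    rintro _ ⟨y, hy, rfl⟩ _ ⟨z, hz, rfl⟩
    have e : ∀ a ∈ A, prj p (P a) = a := by
      intro a ha
      have := (hl a ha).1
      have h0 : 0 < inner ℝ g a := by linarith
      show prj p ((inner ℝ g a)⁻¹ • a) = a
      rw [prj_smul hp (inv_pos.2 h0), prj_of_mem (hAV ha).2]
    rw [e y hy, e z hz, Real.coe_toNNReal _ hs0.le, dist_eq_norm, dist_eq_norm]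
    have h1 := hV2 y (hAV hy) z (hAV hz)
    have h2 := norm_sub_le (P y - P z) (P y - P z - (y - z))
    rw [sub_sub_cancel] at h2
    have h3 : s⁻¹ * ‖y - z‖ ≤ ‖P y - P z‖ := by
      have : s⁻¹ = 1 - η := by rw [hη]; ring
      rw [this]; linarith
    rwa [inv_mul_le_iff₀ hs0] at h3
  have hH1 := hL1.hausdorffMeasure_image_le (d := (m : ℝ)) (by positivity)
  have hH2 := hL2.hausdorffMeasure_image_le (d := (m : ℝ)) (by positivity)
  rw [hinv] at hH2
  rw [ENNReal.rpow_natCast] at hH1 hH2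
  rw [hk] at hH1 hH2
  have hσ : ((s.toNNReal : NNReal) : ENNReal) = ENNReal.ofReal s := rfl
  rw [hσ] at hH1 hH2
  set σ := ENNReal.ofReal s
  have hpow : σ ^ (2 * m + 1) = σ ^ m * σ ^ (m + 1) := by rw [← pow_add]; congr 1; ring
  rw [hpow]
  constructor
  · calc _ ≤ _ := hH2
      _ ≤ σ ^ m * (κ * ENNReal.ofReal ‖g‖ * (σ ^ (m + 1) * (volume (Bal p (m + 1)) * coneMeasureE p (m + 1) A))) := by gcongr
      _ = _ := by ring
  · calc _ ≤ κ * ENNReal.ofReal ‖g‖ * (σ ^ (m + 1) * volume K) := by gcongr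
      _ = σ ^ (m + 1) * (κ * ENNReal.ofReal ‖g‖ * volume K) := by ring
      _ ≤ σ ^ (m + 1) * (σ ^ m * μH[(m : ℝ)] A) := by gcongr
      _ = _ := by ring

end localmeas

section globalmeas
variable {m : ℕ} {p : ℝ}

/-- weighted cone measure -/
noncomputable def wM (p : ℝ) (n : ℕ) (A : Set (EuclideanSpace ℝ (Fin n))) : ENNReal :=
  ∫⁻ x in A, ENNReal.ofReal ‖gv p x‖ ∂(coneMeasureE p n)

lemma local_meas2 (hp : 2 ≤ p) {κ : ENNReal}
    (hκ : ∀ (D : Set (EuclideanSpace ℝ (Fin (m + 1)))) (hD : MeasurableSet D)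
      (hrad : ∀ s > (0:ℝ), ∀ y, s • y ∈ D ↔ y ∈ D) (g : EuclideanSpace ℝ (Fin (m + 1))) (hg : g ≠ 0),
      μH[(m : ℝ)] {y | y ∈ D ∧ inner ℝ g y = 1} = κ * ENNReal.ofReal ‖g‖ * volume {y | y ∈ D ∧ 0 < inner ℝ g y ∧ inner ℝ g y ≤ 1})
    {x0 : EuclideanSpace ℝ (Fin (m + 1))} (hx0 : x0 ∈ Sph p (m + 1)) {s : ℝ} (hs : 1 < s) :
    ∃ V : Set (EuclideanSpace ℝ (Fin (m + 1))), IsOpen V ∧ x0 ∈ V ∧ ∀ A, MeasurableSet A → A ⊆ V ∩ Sph p (m + 1) →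
      μH[(m : ℝ)] A ≤ ENNReal.ofReal s ^ (2 * m + 2) * (κ * volume (Bal p (m + 1)) * wM p (m + 1) A) ∧
      κ * volume (Bal p (m + 1)) * wM p (m + 1) A ≤ ENNReal.ofReal s ^ (2 * m + 2) * μH[(m : ℝ)] A := by
  have hs0 : 0 < s := by linarith
  obtain ⟨V, hV, hxV, h⟩ := local_meas hp hκ hx0 hs
  have hw0 : 0 < ‖gv p x0‖ := norm_pos_iff.2 (gv_ne hp hx0)
  have hwc : Continuous (fun x : EuclideanSpace ℝ (Fin (m + 1)) => ‖gv p x‖) := (gv_cont hp).norm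
  refine ⟨V ∩ ({x | ‖gv p x‖ < s * ‖gv p x0‖} ∩ {x | ‖gv p x0‖ < s * ‖gv p x‖}),
    hV.inter ((isOpen_lt hwc continuous_const).inter (isOpen_lt continuous_const (by fun_prop))),
    ⟨hxV, ?_, ?_⟩, fun A hA hAV => ?_⟩
  · show ‖gv p x0‖ < s * ‖gv p x0‖
    nlinarith
  · show ‖gv p x0‖ < s * ‖gv p x0‖
    nlinarith
  obtain ⟨h1, h2⟩ := h A hA (fun x hx => ⟨(hAV hx).1.1, (hAV hx).2⟩)
  set σ := ENNReal.ofReal s with hσ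
  have hM1 : wM p (m + 1) A ≤ σ * (ENNReal.ofReal ‖gv p x0‖ * coneMeasureE p (m + 1) A) := by
    unfold wM
    rw [← mul_assoc, ← ENNReal.ofReal_mul hs0.le, ← setLIntegral_const]
    refine setLIntegral_mono' hA fun x hx => ENNReal.ofReal_le_ofReal ?_
    have : ‖gv p x‖ < s * ‖gv p x0‖ := (hAV hx).1.2.1
    exact this.le
  have hM2 : ENNReal.ofReal ‖gv p x0‖ * coneMeasureE p (m + 1) A ≤ σ * wM p (m + 1) A := by
    unfold wM
    rw [← setLIntegral_const, ← lintegral_const_mul' _ _ ENNReal.ofReal_ne_top]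
    refine setLIntegral_mono' hA fun x hx => ?_
    rw [← ENNReal.ofReal_mul hs0.le]
    refine ENNReal.ofReal_le_ofReal ?_
    have : ‖gv p x0‖ < s * ‖gv p x‖ := (hAV hx).1.2.2
    exact this.le
  have hpow : σ ^ (2 * m + 2) = σ * σ ^ (2 * m + 1) := by rw [← pow_succ']
  rw [hpow]
  constructor
  · calc _ ≤ _ := h1
      _ = σ ^ (2 * m + 1) * (κ * volume (Bal p (m + 1)) * (ENNReal.ofReal ‖gv p x0‖ * coneMeasureE p (m + 1) A)) := by ring
      _ ≤ σ ^ (2 * m + 1) * (κ * volume (Bal p (m + 1)) * (σ * wM p (m + 1) A)) := by gcongr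
      _ = _ := by ring
  · calc _ ≤ κ * volume (Bal p (m + 1)) * (σ * (ENNReal.ofReal ‖gv p x0‖ * coneMeasureE p (m + 1) A)) := by gcongr
      _ = σ * (κ * ENNReal.ofReal ‖gv p x0‖ * (volume (Bal p (m + 1)) * coneMeasureE p (m + 1) A)) := by ring
      _ ≤ σ * (σ ^ (2 * m + 1) * μH[(m : ℝ)] A) := by gcongr
      _ = _ := by ring

lemma compact_glue {X : Type*} [TopologicalSpace X] [MeasurableSpace X] [BorelSpace X] {S : Set X} (hS : IsCompact S)
    (M1 M2 : Measure X) (h : ∀ x ∈ S, ∃ V : Set X, IsOpen V ∧ x ∈ V ∧ ∀ A, MeasurableSet A → A ⊆ V ∩ S → M1 A ≤ M2 A)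
    {A : Set X} (hA : MeasurableSet A) (hAS : A ⊆ S) : M1 A ≤ M2 A := by
  have : ∃ V : Set X, IsOpen V ∧ S ⊆ V ∧ ∀ A, MeasurableSet A → A ⊆ V ∩ S → M1 A ≤ M2 A := by
    refine hS.induction_on (p := fun T => ∃ V : Set X, IsOpen V ∧ T ⊆ V ∧ ∀ A, MeasurableSet A → A ⊆ V ∩ S → M1 A ≤ M2 A) ?_ ?_ ?_ ?_
    · refine ⟨∅, isOpen_empty, le_rfl, fun A _ hA => ?_⟩
      have : A = ∅ := Set.subset_empty_iff.1 (fun x hx => (hA hx).1)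
      simp [this]
    · rintro s t hst ⟨V, hV, hsV, h⟩
      exact ⟨V, hV, hst.trans hsV, h⟩
    · rintro s t ⟨V, hV, hsV, h1⟩ ⟨W, hW, hsW, h2⟩
      refine ⟨V ∪ W, hV.union hW, Set.union_subset_union hsV hsW, fun A hA hAS => ?_⟩
      rw [← measure_inter_add_sdiff (μ := M1) A hV.measurableSet, ← measure_inter_add_sdiff (μ := M2) A hV.measurableSet]
      refine add_le_add (h1 _ (hA.inter hV.measurableSet) fun x hx => ⟨hx.2, (hAS hx.1).2⟩)
        (h2 _ (hA.diff hV.measurableSet) fun x hx => ⟨(hAS hx.1).1.resolve_left hx.2, (hAS hx.1).2⟩)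
    · intro x hx
      obtain ⟨V, hV, hxV, h⟩ := h x hx
      exact ⟨V, mem_nhdsWithin_of_mem_nhds (hV.mem_nhds hxV), V, hV, le_rfl, h⟩
  obtain ⟨V, hV, hSV, h⟩ := this
  exact h A hA fun x hx => ⟨hSV (hAS hx), hAS hx⟩

lemma le_of_scale {a b : ENNReal} (k : ℕ) (hb : b ≠ ⊤) (h : ∀ s : ℝ, 1 < s → a ≤ ENNReal.ofReal s ^ k * b) : a ≤ b := by
  have ht : Filter.Tendsto (fun s : ℝ => ENNReal.ofReal s ^ k * b) (nhdsWithin 1 (Set.Ioi 1)) (nhds (ENNReal.ofReal 1 ^ k * b)) := by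
    have h1 : Filter.Tendsto (fun s : ℝ => ENNReal.ofReal s ^ k) (nhdsWithin 1 (Set.Ioi 1)) (nhds (ENNReal.ofReal 1 ^ k)) :=
      ((ENNReal.continuous_pow k).comp ENNReal.continuous_ofReal).continuousAt.tendsto.mono_left nhdsWithin_le_nhds
    exact ENNReal.Tendsto.mul_const h1 (Or.inr hb)
  simp only [ENNReal.ofReal_one, one_pow, one_mul] at ht
  refine ge_of_tendsto ht ?_
  filter_upwards [self_mem_nhdsWithin] with s hs using h s hs

theorem haus_eq (hp : 2 ≤ p) : ∃ κ : ENNReal, κ ≠ 0 ∧ κ ≠ ⊤ ∧ ∀ A : Set (EuclideanSpace ℝ (Fin (m + 1))), MeasurableSet A →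
    A ⊆ Sph p (m + 1) → μH[(m : ℝ)] A = κ * wM p (m + 1) A := by
  obtain ⟨κ, hκ0, hκt, hκ⟩ := plane m
  have hb0 := (Bal_vol_pos (n := m + 1) hp).ne'
  have hbt := (Bal_vol_lt (n := m + 1) hp).ne
  have := cone_prob (n := m + 1) hp
  refine ⟨κ * volume (Bal p (m + 1)), mul_ne_zero hκ0 hb0, ENNReal.mul_ne_top hκt hbt, fun A hA hAS => ?_⟩
  have hMt : wM p (m + 1) A ≠ ⊤ := by
    have hwc : ContinuousOn (fun x : EuclideanSpace ℝ (Fin (m + 1)) => ‖gv p x‖) (Sph p (m + 1)) := (gv_cont hp).norm.continuousOn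
    obtain ⟨C, hC0, hC⟩ := cont_bdd hp hwc
    unfold wM
    refine ((setLIntegral_mono' hA (g := fun _ => ENNReal.ofReal C) fun x hx =>
      ENNReal.ofReal_le_ofReal ((le_abs_self _).trans (hC x (hAS hx)))).trans_lt ?_).ne
    rw [setLIntegral_const]
    exact ENNReal.mul_lt_top ENNReal.ofReal_lt_top (measure_lt_top _ _)
  set W : Measure (EuclideanSpace ℝ (Fin (m + 1))) := (κ * volume (Bal p (m + 1))) •
    (coneMeasureE p (m + 1)).withDensity (fun x => ENNReal.ofReal ‖gv p x‖) with hW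
  have hWA : ∀ A, MeasurableSet A → W A = κ * volume (Bal p (m + 1)) * wM p (m + 1) A := by
    intro A hA
    rw [hW, Measure.smul_apply, withDensity_apply _ hA, smul_eq_mul]; rfl
  have hWt : κ * volume (Bal p (m + 1)) * wM p (m + 1) A ≠ ⊤ := ENNReal.mul_ne_top (ENNReal.mul_ne_top hκt hbt) hMt
  have key1 : ∀ s : ℝ, 1 < s → μH[(m : ℝ)] A ≤ ENNReal.ofReal s ^ (2 * m + 2) * (κ * volume (Bal p (m + 1)) * wM p (m + 1) A) := by
    intro s hs
    have := compact_glue (Sph_compact hp) μH[(m : ℝ)] (ENNReal.ofReal s ^ (2 * m + 2) • W) (fun x hx => by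
      obtain ⟨V, hV, hxV, h⟩ := local_meas2 hp hκ hx hs
      refine ⟨V, hV, hxV, fun A hA hAV => ?_⟩
      rw [Measure.smul_apply, hWA A hA]
      exact (h A hA hAV).1) hA hAS
    rwa [Measure.smul_apply, hWA A hA] at this
  have key2 : ∀ s : ℝ, 1 < s → κ * volume (Bal p (m + 1)) * wM p (m + 1) A ≤ ENNReal.ofReal s ^ (2 * m + 2) * μH[(m : ℝ)] A := by
    intro s hs
    have := compact_glue (Sph_compact hp) W (ENNReal.ofReal s ^ (2 * m + 2) • μH[(m : ℝ)]) (fun x hx => by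
      obtain ⟨V, hV, hxV, h⟩ := local_meas2 hp hκ hx hs
      refine ⟨V, hV, hxV, fun A hA hAV => ?_⟩
      rw [hWA A hA, Measure.smul_apply]
      exact (h A hA hAV).2) hA hAS
    rwa [hWA A hA, Measure.smul_apply] at this
  have h1 := le_of_scale _ hWt key1
  exact le_antisymm h1 (le_of_scale _ (ne_top_of_le_ne_top hWt h1) key2)

end globalmeas

section moments
variable {n : ℕ} {p : ℝ}

lemma prj_coord_rpow (hp : 2 ≤ p) {a : ℝ} (ha : 0 ≤ a) (x : EuclideanSpace ℝ (Fin n)) (i : Fin n) :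
    ENNReal.ofReal (lpNormE p x ^ a) * ENNReal.ofReal (|prj p x i| ^ a) = ENNReal.ofReal (|x i| ^ a) := by
  have h0 := lpN_nonneg (p := p) x
  rw [← ENNReal.ofReal_mul (by positivity), ← Real.mul_rpow h0 (abs_nonneg _)]
  congr 2
  conv_rhs => rw [← smul_prj hp x]
  simp [abs_mul, abs_of_nonneg h0]

lemma cone_mom [NeZero n] (hp : 2 ≤ p) {a : ℝ} (ha : 0 ≤ a) (i : Fin n) :
    (∫⁻ x, ENNReal.ofReal (lpNormE p x ^ a) ∂(gm p (zet p n) n)) * ∫⁻ x, ENNReal.ofReal (|x i| ^ a) ∂(coneMeasureE p n)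
      = ENNReal.ofReal (gI p a / gI p 0) := by
  rw [← gm_mom (n := n) hp ha i, ← polar_gm (g := fun t => ENNReal.ofReal (t ^ a)) (φ := fun x => ENNReal.ofReal (|x i| ^ a)) hp
    (by fun_prop) (by fun_prop) (zet p n)]
  refine lintegral_congr fun x => ?_
  exact prj_coord_rpow hp ha x i

lemma cone_mom_p [NeZero n] (hp : 2 ≤ p) (i : Fin n) :
    ∫⁻ x, ENNReal.ofReal (|x i| ^ p) ∂(coneMeasureE p n) = ENNReal.ofReal (1 / n) := by
  have hp0 : 0 < p := by linarith
  have hn : (0 : ℝ) < n := by exact_mod_cast Nat.pos_of_ne_zero (NeZero.ne n)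
  have h := cone_mom (n := n) hp hp0.le i
  rw [gm_Np hp, gI_p hp] at h
  have h1 : ENNReal.ofReal (n / p) ≠ 0 := by simp only [ne_eq, ENNReal.ofReal_eq_zero, not_le]; positivity
  rw [← ENNReal.mul_right_inj h1 ENNReal.ofReal_ne_top, h, ← ENNReal.ofReal_mul (by positivity)]
  congr 1; field_simp

lemma gm_N2p [NeZero n] (hp : 2 ≤ p) :
    ENNReal.ofReal ((n / p) ^ 2) ≤ ∫⁻ x, ENNReal.ofReal (lpNormE p x ^ (2 * p)) ∂(gm p (zet p n) n) := by
  have : Fact (2 ≤ p) := ⟨hp⟩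
  have hN : Measurable (lpNormE p : EuclideanSpace ℝ (Fin n) → ℝ) := (lpN_continuous hp).measurable
  have h := ENNReal.lintegral_mul_norm_pow_le (μ := gm p (zet p n) n)
    (f := fun x => ENNReal.ofReal (lpNormE p x ^ (2 * p))) (g := fun _ => 1) (p := 1 / 2) (q := 1 / 2)
    (by fun_prop) (by fun_prop) (by norm_num) (by norm_num) (by norm_num)
  have e : ∀ x : EuclideanSpace ℝ (Fin n), ENNReal.ofReal (lpNormE p x ^ (2 * p)) ^ (1 / 2 : ℝ) * (1 : ENNReal) ^ (1 / 2 : ℝ)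
      = ENNReal.ofReal (lpNormE p x ^ p) := by
    intro x
    have h0 := lpN_nonneg (p := p) x
    rw [ENNReal.one_rpow, mul_one, ENNReal.ofReal_rpow_of_nonneg (by positivity) (by norm_num), ← Real.rpow_mul h0]
    congr 2; ring
  simp_rw [e] at h
  rw [gm_Np hp] at h
  simp only [lintegral_const, measure_univ, mul_one, ENNReal.one_rpow] at h
  have h2 := ENNReal.rpow_le_rpow h (by norm_num : (0:ℝ) ≤ 2)
  rw [← ENNReal.rpow_mul] at h2
  norm_num at h2
  rwa [ENNReal.ofReal_pow (by positivity)]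

lemma cone_mom_2p [NeZero n] (hp : 2 ≤ p) (i : Fin n) :
    ∫⁻ x, ENNReal.ofReal (|x i| ^ (2 * p)) ∂(coneMeasureE p n) ≤ ENNReal.ofReal ((p + 1) / n ^ 2) := by
  have hp0 : 0 < p := by linarith
  have hn : (0 : ℝ) < n := by exact_mod_cast Nat.pos_of_ne_zero (NeZero.ne n)
  have h := cone_mom (n := n) hp (a := 2 * p) (by linarith) i
  rw [gI_2p hp] at h
  have h1 : ENNReal.ofReal ((n / p) ^ 2) ≠ 0 := by simp only [ne_eq, ENNReal.ofReal_eq_zero, not_le]; positivity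
  rw [← ENNReal.mul_le_mul_iff_right h1 ENNReal.ofReal_ne_top]
  refine (mul_le_mul_left (gm_N2p (n := n) hp) _).trans ?_
  rw [h, ← ENNReal.ofReal_mul (by positivity)]
  apply le_of_eq
  congr 1; field_simp; ring

lemma cone_mom_mid [NeZero n] (hp : 2 ≤ p) (i : Fin n) :
    ∫⁻ x, ENNReal.ofReal (|x i| ^ (2 * p - 2)) ∂(coneMeasureE p n) ≤
      ENNReal.ofReal ((n : ℝ) ^ (2 / p - 2) * (p + 1) ^ (1 - 2 / p)) := by
  have hp0 : 0 < p := by linarith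
  have hn : (0 : ℝ) < n := by exact_mod_cast Nat.pos_of_ne_zero (NeZero.ne n)
  have h2p : 2 / p ≤ 1 := by rw [div_le_one hp0]; exact hp
  have h := ENNReal.lintegral_mul_norm_pow_le (μ := coneMeasureE p n)
    (f := fun x => ENNReal.ofReal (|x i| ^ p)) (g := fun x => ENNReal.ofReal (|x i| ^ (2 * p))) (p := 2 / p) (q := 1 - 2 / p)
    (by fun_prop) (by fun_prop) (by positivity) (by linarith) (by ring)
  have e : ∀ x : EuclideanSpace ℝ (Fin n), ENNReal.ofReal (|x i| ^ p) ^ (2 / p) * ENNReal.ofReal (|x i| ^ (2 * p)) ^ (1 - 2 / p)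
      = ENNReal.ofReal (|x i| ^ (2 * p - 2)) := by
    intro x
    rw [ENNReal.ofReal_rpow_of_nonneg (by positivity) (by positivity), ENNReal.ofReal_rpow_of_nonneg (by positivity) (by linarith),
      ← ENNReal.ofReal_mul (by positivity), ← Real.rpow_mul (abs_nonneg _), ← Real.rpow_mul (abs_nonneg _),
      ← Real.rpow_add_of_nonneg (abs_nonneg _) (by positivity) (mul_nonneg (by linarith) (by linarith))]
    congr 2; field_simp; ring
  simp_rw [e] at h
  refine h.trans ?_
  rw [cone_mom_p hp]
  refine (mul_le_mul_right (ENNReal.rpow_le_rpow (cone_mom_2p hp i) (by linarith)) _).trans ?_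
  rw [ENNReal.ofReal_rpow_of_nonneg (by positivity) (by positivity), ENNReal.ofReal_rpow_of_nonneg (by positivity) (by linarith),
      ← ENNReal.ofReal_mul (by positivity)]
  apply ENNReal.ofReal_le_ofReal
  apply le_of_eq
  rw [Real.div_rpow (by positivity) (by positivity), Real.div_rpow (by positivity) (by positivity), Real.one_rpow,
    ← Real.rpow_natCast, ← Real.rpow_mul hn.le]
  have : (n : ℝ) ^ (2 / p - 2) = 1 / ((n : ℝ) ^ (2 / p) * (n : ℝ) ^ (((2 : ℕ) : ℝ) * (1 - 2 / p))) := by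
    rw [← Real.rpow_add hn, one_div, ← Real.rpow_neg hn.le]; congr 1; push_cast; ring
  rw [this]; field_simp

lemma w_sq_int [NeZero n] (hp : 2 ≤ p) :
    ∫⁻ x, ENNReal.ofReal ‖gv p x‖ ^ (2 : ℝ) ∂(coneMeasureE p n) ≤
      ENNReal.ofReal ((n : ℝ) ^ (2 / p - 1) * (p + 1) ^ (1 - 2 / p)) := by
  have hn : (0 : ℝ) < n := by exact_mod_cast Nat.pos_of_ne_zero (NeZero.ne n)
  have e : ∀ x : EuclideanSpace ℝ (Fin n), ENNReal.ofReal ‖gv p x‖ ^ (2 : ℝ) = ∑ i, ENNReal.ofReal (|x i| ^ (2 * p - 2)) := by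
    intro x
    rw [← ENNReal.ofReal_sum_of_nonneg (fun i _ => by positivity), ← gv_norm hp, ENNReal.ofReal_pow (norm_nonneg _),
      ← ENNReal.rpow_natCast]; norm_num
  simp_rw [e]
  rw [lintegral_finsetSum _ (fun i _ => by fun_prop)]
  refine (Finset.sum_le_sum fun i _ => cone_mom_mid hp i).trans ?_
  rw [Finset.sum_const, Finset.card_univ, Fintype.card_fin, nsmul_eq_mul, ← ENNReal.ofReal_natCast, ← ENNReal.ofReal_mul (by positivity)]
  apply ENNReal.ofReal_le_ofReal
  apply le_of_eq
  rw [← mul_assoc]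
  congr 1
  rw [mul_comm, ← Real.rpow_add_one hn.ne']; congr 1; ring

lemma w_lower [NeZero n] (hp : 2 ≤ p) {x : EuclideanSpace ℝ (Fin n)} (hx : x ∈ Sph p n) : (n : ℝ) ^ (1 / p - 1 / 2) ≤ ‖gv p x‖ := by
  have hp0 : 0 < p := by linarith
  have hn : (0 : ℝ) < n := by exact_mod_cast Nat.pos_of_ne_zero (NeZero.ne n)
  have h2p : 2 / p ≤ 1 := by rw [div_le_one hp0]; exact hp
  have h := Real.rpow_sum_le_const_mul_sum_rpow (Finset.univ : Finset (Fin n)) (fun i => |x i| ^ p) (p := 2 - 2 / p) (by linarith)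
  have e1 : ∑ i, |(|x i| ^ p)| = 1 := by
    simp_rw [abs_of_nonneg (Real.rpow_nonneg (abs_nonneg (x _)) p)]
    rw [← lpN_rpow hp, show lpNormE p x = 1 from hx, Real.one_rpow]
  have e2 : ∑ i, |(|x i| ^ p)| ^ (2 - 2 / p) = ‖gv p x‖ ^ 2 := by
    rw [gv_norm hp]
    refine Finset.sum_congr rfl fun i _ => ?_
    rw [abs_of_nonneg (by positivity), ← Real.rpow_mul (abs_nonneg _)]
    congr 1; field_simp
  rw [e1, e2, Real.one_rpow, Finset.card_univ, Fintype.card_fin] at h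
  have h3 : (n : ℝ) ^ (2 / p - 1) ≤ ‖gv p x‖ ^ 2 := by
    rw [show 2 / p - 1 = -(2 - 2 / p - 1) by ring, Real.rpow_neg hn.le, inv_le_iff_one_le_mul₀' (by positivity)]
    exact h
  apply (pow_le_pow_iff_left₀ (by positivity) (norm_nonneg _) two_ne_zero).1
  rw [← Real.rpow_natCast, ← Real.rpow_mul hn.le]
  rw [show (1 / p - 1 / 2) * ((2 : ℕ) : ℝ) = 2 / p - 1 by push_cast; ring]
  exact h3

lemma wM_Sph [NeZero n] (hp : 2 ≤ p) : ENNReal.ofReal ((n : ℝ) ^ (1 / p - 1 / 2)) ≤ wM p n (Sph p n) := by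
  have := cone_prob (n := n) hp
  unfold wM
  have h1 : coneMeasureE p n (Sph p n) = 1 := by
    rw [prob_compl_eq_zero_iff (Sph_meas hp) |>.symm]
    rw [measure_eq_zero_iff_ae_notMem]
    filter_upwards [cone_mem_Sph hp] with y hy h using h hy
  calc _ = ∫⁻ x in Sph p n, ENNReal.ofReal ((n : ℝ) ^ (1 / p - 1 / 2)) ∂(coneMeasureE p n) := by
        rw [setLIntegral_const, h1, mul_one]
    _ ≤ _ := setLIntegral_mono' (Sph_meas hp) fun x hx => ENNReal.ofReal_le_ofReal (w_lower hp hx)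

lemma wM_upper [NeZero n] (hp : 2 ≤ p) {A : Set (EuclideanSpace ℝ (Fin n))} (hA : MeasurableSet A) :
    wM p n A ≤ ENNReal.ofReal ((n : ℝ) ^ (1 / p - 1 / 2)) * (ENNReal.ofReal ((p + 1) ^ ((1 : ℝ) / 2 - 1 / p)) *
      coneMeasureE p n A ^ (1 / 2 : ℝ)) := by
  have hn : (0 : ℝ) < n := by exact_mod_cast Nat.pos_of_ne_zero (NeZero.ne n)
  have hp0 : 0 < p := by linarith
  have hg : Measurable (fun x : EuclideanSpace ℝ (Fin n) => ENNReal.ofReal ‖gv p x‖) := (gv_cont hp).norm.measurable.ennreal_ofReal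
  unfold wM
  have h := ENNReal.lintegral_mul_norm_pow_le (μ := (coneMeasureE p n).restrict A)
    (f := fun x => ENNReal.ofReal ‖gv p x‖ ^ (2 : ℝ)) (g := fun x => 1) (p := 1 / 2) (q := 1 / 2)
    (hg.pow_const _).aemeasurable (by fun_prop) (by norm_num) (by norm_num) (by norm_num)
  have e : ∀ x : EuclideanSpace ℝ (Fin n), (ENNReal.ofReal ‖gv p x‖ ^ (2 : ℝ)) ^ (1 / 2 : ℝ) * (1 : ENNReal) ^ (1 / 2 : ℝ) = ENNReal.ofReal ‖gv p x‖ := by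
    intro x
    rw [← ENNReal.rpow_mul]; norm_num
  simp_rw [e] at h
  refine h.trans ?_
  rw [← mul_assoc]
  refine mul_le_mul' ?_ ?_
  · refine (ENNReal.rpow_le_rpow ((setLIntegral_le_lintegral A _).trans (w_sq_int hp)) (by norm_num)).trans ?_
    rw [ENNReal.ofReal_rpow_of_nonneg (by positivity) (by norm_num), ← ENNReal.ofReal_mul (by positivity)]
    apply ENNReal.ofReal_le_ofReal
    apply le_of_eq
    rw [Real.mul_rpow (by positivity) (by positivity), ← Real.rpow_mul hn.le, ← Real.rpow_mul (by positivity)]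
    congr 2 <;> ring
  · simp

theorem surf_le (hp : 2 ≤ p) (hn : 1 ≤ n) {A : Set (EuclideanSpace ℝ (Fin n))} (hA : MeasurableSet (A ∩ Sph p n)) :
    surfaceMeasure p n A ≤ ENNReal.ofReal ((p + 1) ^ ((1 : ℝ) / 2 - 1 / p)) * coneMeasureE p n A ^ (1 / 2 : ℝ) := by
  obtain ⟨m, rfl⟩ : ∃ m, n = m + 1 := ⟨n - 1, by omega⟩
  obtain ⟨κ, hκ0, hκt, hκ⟩ := haus_eq (m := m) hp
  have hm : (((m + 1 : ℕ) : ℝ) - 1) = m := by push_cast; ring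
  have hs : surfaceMeasure p (m + 1) A = (μH[(m : ℝ)] (Sph p (m + 1)))⁻¹ * μH[(m : ℝ)] (A ∩ Sph p (m + 1)) := by
    unfold surfaceMeasure
    rw [hm, show {x : EuclideanSpace ℝ (Fin (m + 1)) | lpNormE p x = 1} = Sph p (m + 1) from rfl,
      Measure.smul_apply, Measure.restrict_apply' (Sph_meas hp), smul_eq_mul]
  rw [hs, hκ _ hA Set.inter_subset_right, hκ _ (Sph_meas hp) le_rfl]
  have h1 := wM_Sph (n := m + 1) hp
  have h2 := wM_upper hp hA
  have h3 : coneMeasureE p (m + 1) (A ∩ Sph p (m + 1)) ≤ coneMeasureE p (m + 1) A := measure_mono Set.inter_subset_left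
  rw [mul_comm, ← div_eq_mul_inv]
  apply ENNReal.div_le_of_le_mul
  calc κ * wM p (m + 1) (A ∩ Sph p (m + 1)) ≤ κ * (wM p (m + 1) (Sph p (m + 1)) * (ENNReal.ofReal ((p + 1) ^ ((1 : ℝ) / 2 - 1 / p)) *
      coneMeasureE p (m + 1) A ^ (1 / 2 : ℝ))) := by
        gcongr
        exact h2.trans (by gcongr)
    _ = _ := by ring

end moments

lemma surf_le_one {p : ℝ} {n : ℕ} (A : Set (EuclideanSpace ℝ (Fin n))) : surfaceMeasure p n A ≤ 1 := by
  refine (measure_mono (Set.subset_univ A)).trans ?_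
  unfold surfaceMeasure
  rw [Measure.smul_apply, Measure.restrict_apply_univ, smul_eq_mul]
  exact ENNReal.inv_mul_le_one _

lemma pow_bound_aux {p t M m : ℝ} {k : ℕ} (hp : 2 ≤ p) (hk : 1 ≤ k) (ht : 0 ≤ t) (hM : 0 ≤ M) (hm : 0 < m)
    (h : m ≤ (t / M) ^ (p / k)) : 0 < t ∧ M * (m ^ (1 / p)) ^ k ≤ t := by
  have hk0 : (0 : ℝ) < k := by exact_mod_cast hk
  have hp0 : 0 < p := by linarith
  have hpk : 0 < p / k := by positivity
  have h0 : 0 ≤ t / M := by positivity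
  have hpos : 0 < t / M := by
    rcases h0.lt_or_eq with h1 | h1
    · exact h1
    · rw [← h1, Real.zero_rpow hpk.ne'] at h; linarith
  have hM0 : 0 < M := by
    rcases hM.lt_or_eq with h1 | h1
    · exact h1
    · rw [← h1] at hpos; simp at hpos
  refine ⟨by have := (div_pos_iff_of_pos_right hM0).1 hpos; exact this, ?_⟩
  have h2 := Real.rpow_le_rpow hm.le h (by positivity : 0 ≤ (k : ℝ) / p)
  rw [← Real.rpow_mul h0, show p / k * (k / p) = 1 by field_simp, Real.rpow_one, le_div_iff₀ hM0] at h2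
  rw [← Real.rpow_natCast, ← Real.rpow_mul hm.le, show 1 / p * (k : ℝ) = k / p by ring, mul_comm]
  exact h2

/-- Corollary 4.7 (2): higher order concentration (tail bound form) for the surface
measure on the `ℓ_p`-sphere; the integral norms of the derivatives are taken with respect
to the cone measure. -/
theorem higher_order_tail_bound_surface (p : ℝ) (hp : 2 ≤ p) (q : ℝ)
    (hq : q = p / (p - 1)) (n : ℕ) (hn : 3 ≤ n) (d : ℕ) (hd : 1 ≤ d)
    (f : EuclideanSpace ℝ (Fin n) → ℝ) (U : Set (EuclideanSpace ℝ (Fin n))) (hU : IsOpen U)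
    (hsub : {x : EuclideanSpace ℝ (Fin n) | lpNormE p x = 1} ⊆ U)
    (hf : ContDiffOn ℝ (d : ℕ∞) f U)
    (hmean : ∫ x, f x ∂(coneMeasureE p n) = 0)
    (t : ℝ) (ht : 0 ≤ t) :
    surfaceMeasure p n {x | t ≤ |f x|} ≤
      ENNReal.ofReal (Real.sqrt 2 * (p + 1) ^ ((1 : ℝ) / 2 - 1 / p) * Real.exp
        (-(Real.log 2 ^ p / (3 ^ (p - 1) * 4 ^ (2 * p - 1) * p ^ 2 * (p - 1) ^ (p - 1) *
              (d : ℝ) ^ p * Real.exp 1 ^ p) / 2) * n *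
          sInf (insert ((t / opNormLinftyE (coneMeasureE p n) p d f) ^ (p / d))
            {y | ∃ k : ℕ, 1 ≤ k ∧ k < d ∧
              y = (t / opNormLqE (coneMeasureE p n) p q k f) ^ (p / k)}))) := by
  have : NeZero n := ⟨by omega⟩
  have hsub' : Sph p n ⊆ U := hsub
  have hp0 : 0 < p := by linarith
  have hn0 : (0 : ℝ) < n := by exact_mod_cast (by omega : 0 < n)
  have hpq : p.HolderConjugate q := by rw [hq]; exact Real.HolderConjugate.conjExponent (by linarith)
  have hq0 : 0 < q := by linarith [hpq.symm.lt]
  have hat : ∀ x ∈ Sph p n, ContDiffAt ℝ (d : ℕ∞) f x := fun x hx => hf.contDiffAt (hU.mem_nhds (hsub' hx))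
  have hFc : ∀ k, k ≤ d → ContinuousOn (fun x => opNormQE p (iteratedFDeriv ℝ k f x)) (Sph p n) :=
    fun k hk x hx => (F_contAt hp hk (hat x hx)).continuousWithinAt
  have hF0 : ∀ k, 1 ≤ k → ∀ x, 0 ≤ opNormQE p (iteratedFDeriv ℝ k f x) := by
    intro k hk x
    obtain ⟨j, rfl⟩ : ∃ j, k = j + 1 := ⟨k - 1, by omega⟩
    exact op_nonneg hp _
  have hLq : ∀ k, 1 ≤ k → k ≤ d → opNormLqE (coneMeasureE p n) p q k f = LN p n q (fun x => opNormQE p (iteratedFDeriv ℝ k f x)) := by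
    intro k hk hkd
    rw [LN_eq_integral hp hq0 (hFc k hkd)]
    unfold opNormLqE
    simp_rw [abs_of_nonneg (hF0 k hk _)]
  have hLi : ∀ x ∈ Sph p n, opNormQE p (iteratedFDeriv ℝ d f x) ≤ opNormLinftyE (coneMeasureE p n) p d f :=
    fun x hx => le_essSup_cone hp (hFc d le_rfl) hx
  have hLi0 : 0 ≤ opNormLinftyE (coneMeasureE p n) p d f := by
    obtain ⟨x0, hx0⟩ := Sph_nonempty (n := n) hp
    exact (hF0 d hd x0).trans (hLi x0 hx0)
  set T : Set ℝ := insert ((t / opNormLinftyE (coneMeasureE p n) p d f) ^ (p / d))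
            {y | ∃ k : ℕ, 1 ≤ k ∧ k < d ∧
              y = (t / opNormLqE (coneMeasureE p n) p q k f) ^ (p / k)} with hT
  change _ ≤ ENNReal.ofReal (√2 * (p + 1) ^ ((1 : ℝ) / 2 - 1 / p) * Real.exp (-(Cpd p d / 2) * n * sInf T))
  have hC := Cpd_pos hp hd
  have hfac : 1 ≤ (p + 1) ^ ((1 : ℝ) / 2 - 1 / p) := by
    apply Real.one_le_rpow (by linarith)
    have : 1 / p ≤ 1 / 2 := one_div_le_one_div_of_le (by norm_num) hp
    linarith
  have hs2 : 1 ≤ √2 := by rw [Real.one_le_sqrt]; norm_num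
  rcases le_or_gt (sInf T) 0 with hm | hm
  · refine (surf_le_one _).trans ?_
    rw [ENNReal.one_le_ofReal]
    have he : 1 ≤ Real.exp (-(Cpd p d / 2) * n * sInf T) := by
      rw [Real.one_le_exp_iff]
      have : 0 ≤ (Cpd p d / 2) * n := by positivity
      nlinarith
    exact one_le_mul_of_one_le_of_one_le (one_le_mul_of_one_le_of_one_le hs2 hfac) he
  have hTb : BddBelow T := by
    by_contra h
    rw [Real.sInf_of_not_bddBelow h] at hm
    exact lt_irrefl _ hm
  obtain ⟨ht0, hd1⟩ := pow_bound_aux hp hd ht hLi0 hm (csInf_le hTb (Set.mem_insert _ _))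
  have hk1 : ∀ k, 1 ≤ k → k < d → LN p n q (fun x => opNormQE p (iteratedFDeriv ℝ k f x)) * (sInf T ^ (1 / p)) ^ k ≤ t := by
    intro k hk hkd
    rw [← hLq k hk hkd.le]
    refine (pow_bound_aux hp hk ht ?_ hm (csInf_le hTb (Set.mem_insert_of_mem _ ⟨k, hk, hkd, rfl⟩))).2
    rw [hLq k hk hkd.le]
    exact LN_nonneg _ _
  have hct := cone_tail hp hn hpq hd hU hsub' hf hmean ht0 (Real.rpow_pos_of_pos hm (1 / p)) hk1 hLi hd1
  have hA : MeasurableSet ({x | t ≤ |f x|} ∩ Sph p n) := by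
    have hfc : ContinuousOn (fun x => |f x|) (Sph p n) := (hf.continuousOn.mono hsub').abs
    have := hfc.preimage_isClosed_of_isClosed (Sph_closed hp) (isClosed_Ici (a := t))
    rw [Set.inter_comm]
    exact this.measurableSet
  refine (surf_le hp (by omega) hA).trans ?_
  refine (mul_le_mul_right (ENNReal.rpow_le_rpow hct (by norm_num)) _).trans ?_
  rw [ENNReal.ofReal_rpow_of_nonneg (by positivity) (by norm_num), ← ENNReal.ofReal_mul (by positivity)]
  apply ENNReal.ofReal_le_ofReal
  apply le_of_eq
  rw [Real.mul_rpow (by norm_num) (Real.exp_pos _).le, ← Real.sqrt_eq_rpow, ← Real.exp_mul, ← Real.rpow_mul hm.le,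
    one_div_mul_cancel hp0.ne', Real.rpow_one]
  rw [show -(Cpd p d * n * sInf T) * (1 / 2) = -(Cpd p d / 2) * n * sInf T by ring]
  ring
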